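/- Let A, B be invertible 5×5 complex matrices satisfying the braid relation A*B*A = B*A*B, such that the pair (A,B) is irreducible and the subgroup G of GL(5,ℂ) generated by A and B is primitive. If A^t is not a scalar matrix for every t ∈ {1,2,3,4,5,6,9,10,11,12} (equivalently, the projective order of A lies in {7,8} or is at least 13), then G is infinite. -/

import Mathlib

/-- The pair of matrices `(A, B)` acting on `ℂ^d` is irreducible if the only subspaces
invariant under both `A` and `B` are `0` and all of `ℂ^d`. -/
def MatPairIrreducible {d : ℕ} (A B : Matrix (Fin d) (Fin d) ℂ) : Prop :=
  ∀ W : Submodule ℂ (Fin d → ℂ),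
    (∀ v ∈ W, A.mulVec v ∈ W) → (∀ v ∈ W, B.mulVec v ∈ W) → W = ⊥ ∨ W = ⊤

/-- The subgroup of `GL(d, ℂ)` generated by the (invertible) matrices `A` and `B`. -/
def matGenGroup {d : ℕ} (A B : Matrix (Fin d) (Fin d) ℂ) :
    Subgroup (Matrix (Fin d) (Fin d) ℂ)ˣ :=
  Subgroup.closure {g : (Matrix (Fin d) (Fin d) ℂ)ˣ |
    (g : Matrix (Fin d) (Fin d) ℂ) = A ∨ (g : Matrix (Fin d) (Fin d) ℂ) = B}

/-- A subgroup `G ≤ GL(d, ℂ)` is imprimitive if there are `n ≥ 2` nonzero subspaces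
`V₁, …, Vₙ` of `ℂ^d` whose internal direct sum is `ℂ^d`, such that every element of `G`
maps each `Vᵢ` onto some `Vⱼ`, and some element of `G` maps some `Vᵢ` onto `Vⱼ` with
`j ≠ i`. -/
def MatGroupImprimitive {d : ℕ} (G : Subgroup (Matrix (Fin d) (Fin d) ℂ)ˣ) : Prop :=
  ∃ n : ℕ, 2 ≤ n ∧ ∃ V : Fin n → Submodule ℂ (Fin d → ℂ),
    (∀ i, V i ≠ ⊥) ∧ iSupIndep V ∧ (⨆ i, V i) = ⊤ ∧
    (∀ g ∈ G, ∀ i, ∃ j,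
      (V i).map (Matrix.mulVecLin (g : Matrix (Fin d) (Fin d) ℂ)) = V j) ∧
    (∃ g ∈ G, ∃ i j, i ≠ j ∧
      (V i).map (Matrix.mulVecLin (g : Matrix (Fin d) (Fin d) ℂ)) = V j)

namespace FiniteBraid

/-- some element of the list satisfies `p` -/
def anyL (p : ℕ → Bool) (l : List ℕ) : Bool :=
  List.rec false (fun a _ ih => Bool.rec ih true (p a)) l

/-- all elements of the list satisfy `p` -/
def allL (p : ℕ → Bool) (l : List ℕ) : Bool :=
  List.rec true (fun a _ ih => Bool.rec false ih (p a)) l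

/-- the elements of the list that satisfy `p` -/
def filt (p : ℕ → Bool) (l : List ℕ) : List ℕ :=
  List.rec [] (fun a _ ih => Bool.rec ih (a :: ih) (p a)) l

/-- the numbers below `n`, in decreasing order -/
def down (n : ℕ) : List ℕ := Nat.rec [] (fun n ih => n :: ih) n

def orB (a b : Bool) : Bool := Bool.rec b true a

def andB (a b : Bool) : Bool := Bool.rec false b a

/-- `f x`, with `x` brought to normal form first -/
def force {α : Type} (x : ℕ) (f : ℕ → α) : α := Nat.rec (f 0) (fun n _ => f (Nat.succ n)) x

/-- `f l`, with `l` brought to normal form first -/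
def forceL {α : Type} (l : List ℕ) (f : List ℕ → α) : α :=
  List.rec (fun f => f []) (fun a _ ih f => force a fun a => ih fun t => f (a :: t)) l f

def sumL (g : ℕ → ℕ) (l : List ℕ) : ℕ := List.rec 0 (fun a _ ih => Nat.add (g a) ih) l

def gcdL (N : ℕ) (l : List ℕ) : ℕ := List.rec N (fun a _ ih => Nat.gcd a ih) l

def takeL (n : ℕ) (l : List ℕ) : List ℕ :=
  Nat.rec (fun _ => []) (fun _ ih l => List.rec [] (fun a t _ => a :: ih t) l) n l

/-- `k` is coprime to `N` -/
def cop (N k : ℕ) : Bool := Nat.beq (Nat.gcd k N) 1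

/-- sextant -/
def rg (N z : ℕ) : ℕ := Nat.div (Nat.mul 6 (Nat.mod z N)) N

/-- the bit of the mask `m` at position `i` -/
def bit (m i : ℕ) : ℕ := Nat.mod (Nat.shiftRight m i) 2

/-- the packed mask counts of one sextant -/
def wt (g : ℕ) : ℕ :=
  Nat.mod (Nat.shiftRight 83401268310847689172190254923251728 (Nat.mul 24 g)) 16777216

/-- the packed mask counts of `k • X` -/
def wtX (N k : ℕ) (X : List ℕ) : ℕ := sumL (fun x => wt (rg N (Nat.mul k x))) X

/-- the packed lower bounds with `r` entries missing -/
def low (r : ℕ) : ℕ := Nat.rec 8939110 (fun r _ => Nat.rec 8943479 (fun _ _ => 8947848) r) r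

/-- the packed counts `s` can be completed by `r` further entries -/
def feas (r s : ℕ) : Bool :=
  andB (Nat.beq (Nat.land (Nat.add s 6702149) 8947848) 0)
    (Nat.beq (Nat.land (Nat.add s (low r)) 8947848) 8947848)

/-- the mask of the sextants satisfying `f` -/
def msk (f : ℕ → Bool) : ℕ :=
  sumL (fun g => Bool.rec 0 (Nat.shiftLeft 1 g) (f g)) [0, 1, 2, 3, 4, 5]

/-- the sextants allowed for the next of `r + 1` missing entries -/
def amask (r s : ℕ) : ℕ := msk fun g => feas r (Nat.add s (wt g))

def lorL (g : ℕ → ℕ) (l : List ℕ) : ℕ := List.rec 0 (fun a _ ih => Nat.lor (g a) ih) l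

def blocks (N : ℕ) : List ℕ := down (Nat.succ (Nat.div N 64))

/-- positions `64 g + b` with `rg (k (64 a + b)) = g` -/
def blk (N k a : ℕ) : ℕ :=
  lorL (fun b => Nat.shiftLeft 1
    (Nat.add (Nat.mul 64 (rg N (Nat.mul k (Nat.add (Nat.mul 64 a) b)))) b)) (down 64)

/-- for each sextant `g`, the bit set of all `z < N` with `k * z` in `g` -/
def tabs (N k : ℕ) : List ℕ :=
  List.rec [] (fun g _ ih => lorL (fun a => Nat.shiftLeft (Nat.mod (Nat.shiftRight (blk N k a)
    (Nat.mul 64 g)) 18446744073709551616) (Nat.mul 64 a)) (blocks N) :: ih) [0, 1, 2, 3, 4, 5]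

/-- the union of the bit sets selected by the mask -/
def sel (ts : List ℕ) : ℕ → ℕ :=
  List.rec (fun _ => 0) (fun t _ ih A => Nat.lor (Bool.rec 0 t (Nat.beq (Nat.mod A 2) 1)) (ih (Nat.div A 2))) ts

/-- all elements of a bit set of size at most `64 n` -/
def allBits (p : ℕ → Bool) (n B : ℕ) : Bool :=
  allL (fun a => force (Nat.mod (Nat.shiftRight B (Nat.mul 64 a)) 18446744073709551616) fun w =>
    Nat.rec (fun w => Nat.beq w 0) (fun _ ih w => orB (Nat.beq w 0) <| force (Nat.log2 w) fun b =>
      andB (p (Nat.add (Nat.mul 64 a) b)) (force (Nat.xor w (Nat.shiftLeft 1 b)) fun w => ih w)) 64 w) (down n)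

def Dv (N z : ℕ) : ℕ :=
  Bool.rec (Bool.rec (Nat.sub (Nat.mul 5 N) (Nat.mul 4 z)) (Nat.sub (Nat.mul 4 z) N)
    (Nat.ble (Nat.mul 4 z) (Nat.mul 3 N))) (Nat.sub N (Nat.mul 4 z)) (Nat.blt (Nat.mul 4 z) N)

/-- `z` lies strictly between `N / 3` and `2 * N / 3` -/
def isL (N z : ℕ) : Bool := andB (Nat.blt N (Nat.mul 3 z)) (Nat.blt (Nat.mul 3 z) (Nat.mul 2 N))

def cntLt (N k d : ℕ) (X : List ℕ) : ℕ :=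
  sumL (fun x => Bool.rec 0 1 (Nat.blt (Dv N (Nat.mod (Nat.mul k x) N)) d)) X

/-- the sign pattern fails for `k • X` -/
def patBad (N k : ℕ) (X : List ℕ) : Bool :=
  anyL (fun x => Bool.not (Nat.beq (Bool.rec 0 1 (isL N (Nat.mod (Nat.mul k x) N)))
    (Nat.mod (cntLt N k (Dv N (Nat.mod (Nat.mul k x) N)) X) 2))) X

/-- some admissible power identifies the elements of `X` -/
def goodL (N : ℕ) (X : List ℕ) : Bool :=
  anyL (fun t => allL (fun x => allL (fun y =>
    Nat.beq (Nat.mod (Nat.mul t x) N) (Nat.mod (Nat.mul t y) N)) X) X) [1,2,3,4,5,6,9,10,11,12]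

/-- the bound table: (mask, lo, hi), packed -/
def tbl : List ℕ := [12*64+2*8+2, 11*64+2*8+3, 14*64+2*8+3, 28*64+2*8+3]

def tm (t : ℕ) : ℕ := Nat.div t 64

def tlo (t : ℕ) : ℕ := Nat.mod (Nat.div t 8) 8

def thi (t : ℕ) : ℕ := Nat.mod t 8

/-- the number of elements of `k • X` in the mask -/
def evX (N m k : ℕ) (X : List ℕ) : ℕ := sumL (fun x => bit m (rg N (Nat.mul k x))) X

/-- `e` repeats or reflects an element of `X` -/
def clash (N e : ℕ) (X : List ℕ) : Bool :=
  anyL (fun x => orB (Nat.beq e x) (andB (Nat.beq (Nat.mod (Nat.mul 2 (Nat.add x e)) N) 0)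
    (Bool.not (Nat.beq (Nat.mod (Nat.add x e) N) 0)))) X

/-- order of `e` not divisible by `Q` or trivially excluded -/
def dis (N Q e : ℕ) : Bool :=
  orB (Bool.not (Nat.beq (Nat.mod (Nat.div N (Nat.gcd e N)) Q) 0))
    (orB (Nat.beq (Nat.mul 3 e) N) (Nat.beq (Nat.mul 3 e) (Nat.mul 2 N)))

/-- the bit set of all exponents that are not discarded -/
def allowed (N Q : ℕ) : ℕ :=
  lorL (fun a => Nat.shiftLeft (lorL (fun b => Bool.rec (Nat.shiftLeft 1 b) 0
    (orB (Nat.ble N (Nat.add (Nat.mul 64 a) b)) (dis N Q (Nat.add (Nat.mul 64 a) b)))) (down 64)) (Nat.mul 64 a)) (blocks N)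

/-- a complete list is excluded or good -/
def final (N : ℕ) (us X : List ℕ) : Bool :=
  orB (anyL (fun k => Bool.not (feas 0 (wtX N k X))) us) <|
  orB (goodL N X) (anyL (fun k => patBad N k X) us)

/-- packed choice: score*2^40 + k*2^20 + t*2 + side, maximal -/
def choice (N r : ℕ) (ks : List (ℕ × List ℕ)) (X : List ℕ) : ℕ :=
  List.rec 0 (fun kt _ ih => force kt.1 fun k => force ih fun ih =>
    List.rec ih (fun t _ b => force b fun b => force (evX N (tm t) k X) fun c =>
      force (Nat.add (Nat.mul (Nat.sub (Nat.sub (Nat.add 100 (Nat.mul 6 (tlo t))) (Nat.mul 6 c))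
        (Bool.rec (Nat.mul 3 r) (Nat.mul 2 r) (Nat.beq (tm t) 12))) 1099511627776)
        (Nat.add (Nat.mul k 1048576) (Nat.mul 2 t))) fun s1 =>
      force (Nat.add (Nat.mul (Nat.add (Nat.sub 100 (Nat.mul 6 (thi t))) (Nat.add (Nat.mul 6 c)
        (Bool.rec (Nat.mul 3 r) (Nat.mul 2 r) (Nat.beq (tm t) 12)))) 1099511627776)
        (Nat.add (Nat.mul k 1048576) (Nat.add 1 (Nat.mul 2 t)))) fun s2 =>
      force (Bool.rec b s1 (Nat.blt b s1)) fun b => Bool.rec b s2 (Nat.blt b s2)) tbl) ks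

/-- the units modulo `N` congruent to one modulo `M` -/
def hsOf (N M : ℕ) : List ℕ :=
  filt (cop N) (List.rec [] (fun i _ ih => Nat.add 1 (Nat.mul i M) :: ih) (down (Nat.div N M)))

def candBad (N r k t side c n : ℕ) (hs : List ℕ) (e : ℕ) : Bool :=
  force (Nat.mul r (sumL (fun h => bit (tm t) (rg N (Nat.mul (Nat.mul k h) e))) hs)) fun S =>
  Bool.rec (Nat.blt (Nat.mul n (Nat.sub (thi t) c)) S) (Nat.blt S (Nat.mul n (Nat.sub (tlo t) c))) (Nat.beq side 0)

/-- `e` is not minimal in its orbit under `hs` -/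
def nonmin (N : ℕ) (hs : List ℕ) (e : ℕ) : Bool := anyL (fun h => Nat.blt (Nat.mod (Nat.mul h e) N) e) hs

/-- branch on one bound that the missing entries have to meet -/
def expand (N r : ℕ) (ks : List (ℕ × List ℕ)) (hs X : List ℕ) (go : ℕ → Bool) (B : ℕ) : Bool :=
  force (choice N r ks X) fun ch =>
  force (Nat.mod (Nat.div ch 1048576) 1048576) fun k =>
  force (Nat.mod (Nat.div ch 2) 524288) fun t =>
  force (Nat.mod ch 2) fun side =>
  force (evX N (tm t) k X) fun c =>
  force (sumL (fun _ => 1) hs) fun n =>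
  andB (cop N k) <| andB (anyL (Nat.beq t) tbl) <|
  allBits (fun e => orB (nonmin N hs e) <| orB (clash N e X) <|
    orB (candBad N r k t side c n hs e) (go e)) (Nat.succ (Nat.div N 64)) B

/-- place the last two entries -/
def last (N : ℕ) (us X : List ℕ) (B : ℕ) : Bool :=
  force (sumL (fun x => x) X) fun sx =>
  allBits (fun e => force (Nat.mod (Nat.sub (Nat.mul 5 N) (Nat.add e sx)) N) fun x =>
    orB (Nat.ble x e) <| orB (Nat.beq (bit B x) 0) <| orB (clash N e X) <| orB (clash N x (e :: X)) <|
    final N us (x :: e :: X)) (Nat.succ (Nat.div N 64)) B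

/-- the bit set of candidates for the next entry -/
def cands (N r al : ℕ) (ks : List (ℕ × List ℕ)) (X : List ℕ) : ℕ :=
  List.rec al (fun kt _ ih => Nat.land (sel kt.2 (amask r (wtX N kt.1 X))) ih) ks

/-- the recursive search for valid configurations extending `X` -/
def solve (N C al : ℕ) (ks : List (ℕ × List ℕ)) (us : List ℕ) (r : ℕ) : List ℕ → Bool :=
  Nat.rec (fun X => force (cands N 1 al ks X) fun B => last N us X B)
    (fun r ih X => force (cands N (Nat.add r 2) al ks X) fun B =>
      forceL (hsOf N (Nat.div N (Nat.gcd C (gcdL N X)))) fun hs =>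
      expand N (Nat.add r 3) ks hs X (fun e => ih (e :: X)) B) r

/-- the units modulo `N` -/
def units (N : ℕ) : List ℕ := filt (cop N) (down N)

def mkTabs {α : Type} (N : ℕ) (l : List ℕ) (f : List (ℕ × List ℕ) → α) : α :=
  List.rec (fun f => f []) (fun k _ ih f => force k fun k => forceL (tabs N k) fun t =>
    ih fun l => f ((k, t) :: l)) l f

def allX (p : List ℕ → Bool) (l : List (List ℕ)) : Bool :=
  List.rec true (fun X _ ih => Bool.rec false ih (p X)) l

/-- the search started from all lists in `Xs` -/
def search (N Q C r kp up : ℕ) (Xs : List (List ℕ)) : Bool :=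
  forceL (takeL up (units N)) fun us => mkTabs N (takeL kp us) fun ks =>
  force (allowed N Q) fun al => allX (solve N C al ks us r) Xs

theorem force_eq {α : Type} (x : ℕ) (f : ℕ → α) : force x f = f x := by cases x <;> rfl

theorem forceL_eq {α : Type} (l : List ℕ) (f : List ℕ → α) : forceL l f = f l := by
  induction l generalizing f with
  | nil => rfl
  | cons a t ih =>
    change force a (fun a => forceL t fun t => f (a :: t)) = _
    rw [force_eq, ih]

theorem orB_eq (a b : Bool) : orB a b = (a || b) := by cases a <;> rfl

theorem andB_eq (a b : Bool) : andB a b = (a && b) := by cases a <;> rfl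

theorem anyL_iff (p : ℕ → Bool) (l : List ℕ) : anyL p l = true ↔ ∃ a ∈ l, p a = true := by
  induction l with
  | nil => simp [anyL]
  | cons a t ih =>
    have h : anyL p (a :: t) = (p a || anyL p t) := by
      change Bool.rec (motive := fun _ => Bool) (anyL p t) true (p a) = _
      cases p a <;> rfl
    simp [h, ih]

theorem allL_iff (p : ℕ → Bool) (l : List ℕ) : allL p l = true ↔ ∀ a ∈ l, p a = true := by
  induction l with
  | nil => simp [allL]
  | cons a t ih =>
    have h : allL p (a :: t) = (p a && allL p t) := by
      change Bool.rec (motive := fun _ => Bool) false (allL p t) (p a) = _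
      cases p a <;> rfl
    simp [h, ih]

theorem allX_iff (p : List ℕ → Bool) (l : List (List ℕ)) :
    allX p l = true ↔ ∀ a ∈ l, p a = true := by
  induction l with
  | nil => simp [allX]
  | cons a t ih =>
    have h : allX p (a :: t) = (p a && allX p t) := by
      change Bool.rec (motive := fun _ => Bool) false (allX p t) (p a) = _
      cases p a <;> rfl
    simp [h, ih]

theorem mem_filt (p : ℕ → Bool) (l : List ℕ) (x : ℕ) : x ∈ filt p l ↔ x ∈ l ∧ p x = true := by
  have h : filt p l = l.filter p := by
    induction l with
    | nil => rfl
    | cons a t ih =>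
      change Bool.rec (motive := fun _ => List ℕ) (filt p t) (a :: filt p t) (p a) = _
      rw [ih]
      cases h : p a <;> simp [h]
  simp [h]

theorem mem_down (n x : ℕ) : x ∈ down n ↔ x < n := by
  induction n with
  | zero => simp [down]
  | succ n ih =>
    change x ∈ n :: down n ↔ _
    simp [ih]
    omega

theorem sumL_eq (g : ℕ → ℕ) (l : List ℕ) : sumL g l = (l.map g).sum := by
  induction l with
  | nil => rfl
  | cons a t ih =>
    change g a + sumL g t = _
    simp [ih]

theorem gcdL_dvd (N : ℕ) (l : List ℕ) : gcdL N l ∣ N ∧ ∀ x ∈ l, gcdL N l ∣ x := by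
  induction l with
  | nil => simp [gcdL]
  | cons a t ih =>
    change Nat.gcd a (gcdL N t) ∣ N ∧ ∀ x ∈ a :: t, Nat.gcd a (gcdL N t) ∣ x
    refine ⟨(Nat.gcd_dvd_right _ _).trans ih.1, fun x hx => ?_⟩
    rcases List.mem_cons.1 hx with rfl | hx
    · exact Nat.gcd_dvd_left _ _
    · exact (Nat.gcd_dvd_right _ _).trans (ih.2 x hx)

theorem takeL_subset (n : ℕ) (l : List ℕ) : ∀ x ∈ takeL n l, x ∈ l := by
  induction n generalizing l with
  | zero => intro x hx; cases hx
  | succ n ih =>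
    cases l with
    | nil => intro x hx; cases hx
    | cons a t =>
      intro x hx
      change x ∈ a :: takeL n t at hx
      rcases List.mem_cons.1 hx with rfl | hx
      · exact List.mem_cons_self
      · exact List.mem_cons_of_mem _ (ih t x hx)

theorem cop_iff (N k : ℕ) : cop N k = true ↔ Nat.Coprime k N := by
  rw [Nat.coprime_iff_gcd_eq_one]
  exact ⟨Nat.eq_of_beq_eq_true, fun h => by unfold cop; rw [h]; rfl⟩

theorem mem_units (N k : ℕ) : k ∈ units N → Nat.Coprime k N := by
  intro h
  exact (cop_iff N k).1 ((mem_filt _ _ _).1 h).2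

theorem mem_hsOf (N M h : ℕ) :
    h ∈ hsOf N M ↔ (∃ i < N / M, h = 1 + i * M) ∧ Nat.Coprime h N := by
  have key : ∀ l : List ℕ, (List.rec [] (fun i _ ih => Nat.add 1 (Nat.mul i M) :: ih) l : List ℕ)
      = l.map fun i => 1 + i * M := by
    intro l
    induction l with
    | nil => rfl
    | cons a t ih => rw [List.map_cons, ← ih]; rfl
  unfold hsOf
  rw [mem_filt, cop_iff, key]
  simp only [List.mem_map, mem_down]
  change (∃ a, a < N / M ∧ _) ∧ _ ↔ _
  simp only [eq_comm]

theorem testBit_lorL (g : ℕ → ℕ) (l : List ℕ) (i : ℕ) :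
    (lorL g l).testBit i = true ↔ ∃ a ∈ l, (g a).testBit i = true := by
  induction l with
  | nil => simp [lorL]
  | cons a t ih =>
    change (Nat.lor (g a) (lorL g t)).testBit i = true ↔ _
    have : Nat.lor (g a) (lorL g t) = g a ||| lorL g t := rfl
    rw [this, Nat.testBit_or]
    simp [ih]

theorem shl (a b : ℕ) : Nat.shiftLeft a b = a <<< b := rfl
theorem shr (a b : ℕ) : Nat.shiftRight a b = a >>> b := rfl

theorem testBit_one_shl (a i : ℕ) : (Nat.shiftLeft 1 a).testBit i = true ↔ a = i := by
  rw [shl, Nat.one_shiftLeft, Nat.testBit_two_pow]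
  simp

theorem bit_eq (m i : ℕ) : bit m i = (m.testBit i).toNat := by
  unfold bit
  rw [shr, Nat.testBit, Nat.one_and_eq_mod_two]
  change (m >>> i) % 2 = _
  rcases Nat.mod_two_eq_zero_or_one (m >>> i) with h | h <;> simp [h]

theorem mem_blocks (N a : ℕ) : a ∈ blocks N ↔ a ≤ N / 64 := by
  unfold blocks
  rw [mem_down]
  exact Nat.lt_succ_iff

/-- one round of the bit iteration -/
def bitLoop (p : ℕ → Bool) (a fuel : ℕ) : ℕ → Bool :=
  Nat.rec (fun w => Nat.beq w 0) (fun _ ih w => orB (Nat.beq w 0) <| force (Nat.log2 w) fun b =>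
      andB (p (Nat.add (Nat.mul 64 a) b)) (force (Nat.xor w (Nat.shiftLeft 1 b)) fun w => ih w)) fuel

theorem bitLoop_spec (p : ℕ → Bool) (a fuel w : ℕ) (h : bitLoop p a fuel w = true) :
    ∀ b, w.testBit b = true → p (64 * a + b) = true := by
  induction fuel generalizing w with
  | zero =>
    have : w = 0 := Nat.eq_of_beq_eq_true h
    simp [this]
  | succ n ih =>
    intro b hb
    change orB (Nat.beq w 0) (force (Nat.log2 w) fun b => andB (p (Nat.add (Nat.mul 64 a) b))
      (force (Nat.xor w (Nat.shiftLeft 1 b)) fun w => bitLoop p a n w)) = true at h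
    rw [orB_eq, force_eq, andB_eq, force_eq, Bool.or_eq_true, Bool.and_eq_true] at h
    rcases h with h | ⟨h1, h2⟩
    · have : w = 0 := Nat.eq_of_beq_eq_true h
      simp [this] at hb
    · by_cases hbl : b = w.log2
      · rw [hbl]; exact h1
      · refine ih _ h2 b ?_
        have : Nat.xor w (Nat.shiftLeft 1 w.log2) = w ^^^ (1 <<< w.log2) := rfl
        rw [this, Nat.testBit_xor, hb, Nat.one_shiftLeft, Nat.testBit_two_pow]
        simp [Ne.symm hbl]

theorem allBits_spec (p : ℕ → Bool) (n B : ℕ) (h : allBits p n B = true) (e : ℕ) (he : e < 64 * n)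
    (hB : B.testBit e = true) : p e = true := by
  unfold allBits at h
  rw [allL_iff] at h
  have h1 := h (e / 64) ((mem_down _ _).2 (by omega))
  rw [force_eq] at h1
  have h2 := bitLoop_spec p (e / 64) 64 _ h1 (e % 64) ?_
  · rwa [Nat.div_add_mod] at h2
  · change (B >>> (64 * (e / 64)) % 18446744073709551616).testBit _ = true
    rw [show 18446744073709551616 = 2 ^ 64 by norm_num, Nat.testBit_mod_two_pow,
      Nat.testBit_shiftRight, Nat.div_add_mod, hB]
    simp [Nat.mod_lt]

theorem rg_lt (N z : ℕ) (hN : 0 < N) : rg N z < 6 := by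
  unfold rg
  change 6 * (z % N) / N < 6
  rw [Nat.div_lt_iff_lt_mul hN]
  have := Nat.mod_lt z hN
  omega

/-- bit set of the positions whose sextant is `g` -/
def tab (N k g : ℕ) : ℕ :=
  lorL (fun a => Nat.shiftLeft (Nat.mod (Nat.shiftRight (blk N k a)
    (Nat.mul 64 g)) 18446744073709551616) (Nat.mul 64 a)) (blocks N)

theorem tabs_eq (N k : ℕ) : tabs N k = [tab N k 0, tab N k 1, tab N k 2, tab N k 3, tab N k 4,
  tab N k 5] := rfl

theorem testBit_tab (N k e : ℕ) (he : e < N) : (tab N k (rg N (k * e))).testBit e = true := by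
  unfold tab
  rw [testBit_lorL]
  refine ⟨e / 64, (mem_blocks _ _).2 (Nat.div_le_div_right he.le), ?_⟩
  change ((blk N k (e / 64) >>> (64 * rg N (k * e)) % 18446744073709551616)
    <<< (64 * (e / 64))).testBit e = true
  rw [Nat.testBit_shiftLeft, show 18446744073709551616 = 2 ^ 64 by norm_num, Nat.testBit_mod_two_pow,
    Nat.testBit_shiftRight, Bool.and_eq_true, Bool.and_eq_true, decide_eq_true_eq, decide_eq_true_eq]
  refine ⟨by omega, by omega, ?_⟩
  unfold blk
  rw [testBit_lorL]
  refine ⟨e % 64, (mem_down _ _).2 (Nat.mod_lt _ (by norm_num)), ?_⟩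
  rw [testBit_one_shl]
  change 64 * rg N (k * (64 * (e / 64) + e % 64)) + e % 64 = _
  rw [Nat.div_add_mod]
  omega

theorem sel_cons (t : ℕ) (ts : List ℕ) (A : ℕ) :
    sel (t :: ts) A = (if A % 2 = 1 then t else 0) ||| sel ts (A / 2) := by
  change Nat.lor (Bool.rec (motive := fun _ => ℕ) 0 t (Nat.beq (Nat.mod A 2) 1)) (sel ts (A / 2)) = _
  rcases Nat.mod_two_eq_zero_or_one A with h | h
  · have : Nat.beq (Nat.mod A 2) 1 = false := by change Nat.beq (A % 2) 1 = false; rw [h]; rfl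
    rw [this, h]; rfl
  · have : Nat.beq (Nat.mod A 2) 1 = true := by change Nat.beq (A % 2) 1 = true; rw [h]; rfl
    rw [this, h]; rfl

theorem testBit_sel (ts : List ℕ) (A g t e : ℕ) (hg : ts[g]? = some t) (hA : A.testBit g = true)
    (ht : t.testBit e = true) : (sel ts A).testBit e = true := by
  induction ts generalizing A g with
  | nil => simp at hg
  | cons u us ih =>
    rw [sel_cons, Nat.testBit_or, Bool.or_eq_true]
    cases g with
    | zero =>
      left
      simp only [List.getElem?_cons_zero, Option.some.injEq] at hg
      rw [Nat.testBit_zero, decide_eq_true_eq] at hA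
      rw [if_pos hA, hg, ht]
    | succ g =>
      right
      refine ih (A / 2) g (by simpa using hg) ?_
      rw [← Nat.testBit_succ]; exact hA

theorem testBit_sel_tabs (N k A e : ℕ) (he : e < N) (hA : A.testBit (rg N (k * e)) = true) :
    (sel (tabs N k) A).testBit e = true := by
  refine testBit_sel _ A (rg N (k * e)) (tab N k (rg N (k * e))) e ?_ hA (testBit_tab N k e he)
  have := rg_lt N (k * e) (by omega)
  rw [tabs_eq]
  generalize rg N (k * e) = g at *
  interval_cases g <;> rfl

theorem testBit_six : ∀ b0 b1 b2 b3 b4 b5 : Bool, ∀ g : Fin 6,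
    (sumL (fun g => Bool.rec 0 (Nat.shiftLeft 1 g) (([b0, b1, b2, b3, b4, b5][g]?).getD true))
      [0, 1, 2, 3, 4, 5]).testBit g = ([b0, b1, b2, b3, b4, b5][(g : ℕ)]?).getD true := by
  decide +kernel

theorem sumL_congr (f g : ℕ → ℕ) (l : List ℕ) (h : ∀ a ∈ l, f a = g a) : sumL f l = sumL g l := by
  rw [sumL_eq, sumL_eq, List.map_congr_left h]

theorem testBit_msk (f : ℕ → Bool) (g : ℕ) (hg : g < 6) : (msk f).testBit g = f g := by
  unfold msk
  have h : ∀ a ∈ [0, 1, 2, 3, 4, 5],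
      f a = ([f 0, f 1, f 2, f 3, f 4, f 5][(a : ℕ)]?).getD true := by simp
  rw [sumL_congr _ (fun a => Bool.rec 0 (Nat.shiftLeft 1 a)
    (([f 0, f 1, f 2, f 3, f 4, f 5][(a : ℕ)]?).getD true)) _ fun a ha => by rw [← h a ha],
    h g (by interval_cases g <;> simp)]
  exact testBit_six (f 0) (f 1) (f 2) (f 3) (f 4) (f 5) ⟨g, hg⟩

theorem testBit_amask (r s g : ℕ) (hg : g < 6) : (amask r s).testBit g = feas r (s + wt g) :=
  testBit_msk (fun g => feas r (Nat.add s (wt g))) g hg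

theorem testBit_lorL_blocks (F : ℕ → ℕ → ℕ) (N e : ℕ) (he : e < N)
    (h : (F (e / 64) (e % 64)).testBit (e % 64) = true) :
    (lorL (fun a => Nat.shiftLeft (lorL (F a) (down 64)) (Nat.mul 64 a)) (blocks N)).testBit e
      = true := by
  rw [testBit_lorL]
  refine ⟨e / 64, (mem_blocks _ _).2 (Nat.div_le_div_right he.le), ?_⟩
  rw [shl, Nat.testBit_shiftLeft, Bool.and_eq_true, decide_eq_true_eq]
  have h64 : Nat.mul 64 (e / 64) = 64 * (e / 64) := rfl
  rw [h64]
  refine ⟨by omega, ?_⟩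
  rw [testBit_lorL]
  refine ⟨e % 64, (mem_down _ _).2 (Nat.mod_lt _ (by norm_num)), ?_⟩
  rwa [show e - 64 * (e / 64) = e % 64 by omega]

theorem testBit_allowed (N Q e : ℕ) (he : e < N) (hd : dis N Q e = false) :
    (allowed N Q).testBit e = true := by
  unfold allowed
  refine testBit_lorL_blocks (fun a b => Bool.rec (Nat.shiftLeft 1 b) 0
    (orB (Nat.ble N (Nat.add (Nat.mul 64 a) b)) (dis N Q (Nat.add (Nat.mul 64 a) b)))) N e he ?_
  have h : Nat.add (Nat.mul 64 (e / 64)) (e % 64) = e := Nat.div_add_mod _ _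
  have h2 : Nat.ble N e = false := by
    rw [← Bool.not_eq_true, Nat.ble_eq]; omega
  have h3 : orB (Nat.ble N (Nat.add (Nat.mul 64 (e / 64)) (e % 64)))
    (dis N Q (Nat.add (Nat.mul 64 (e / 64)) (e % 64))) = false := by rw [h, h2, hd]; rfl
  rw [h3]
  exact (testBit_one_shl _ _).2 rfl

theorem mkTabs_eq {α : Type} (N : ℕ) (l : List ℕ) (f : List (ℕ × List ℕ) → α) :
    mkTabs N l f = f (l.map fun k => (k, tabs N k)) := by
  induction l generalizing f with
  | nil => rfl
  | cons a t ih =>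
    change force a (fun k => forceL (tabs N k) fun t' => mkTabs N t fun l => f ((k, t') :: l)) = _
    rw [force_eq, forceL_eq, ih]
    rfl

theorem testBit_cands (N r al : ℕ) (ks : List (ℕ × List ℕ)) (X : List ℕ) (e : ℕ) (he : e < N)
    (hks : ∀ kt ∈ ks, kt.2 = tabs N kt.1) (hal : al.testBit e = true)
    (hf : ∀ kt ∈ ks, feas r (wtX N kt.1 X + wt (rg N (kt.1 * e))) = true) :
    (cands N r al ks X).testBit e = true := by
  induction ks with
  | nil => exact hal
  | cons a t ih =>
    change (Nat.land (sel a.2 (amask r (wtX N a.1 X))) (cands N r al t X)).testBit e = true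
    have : ∀ a b, Nat.land a b = a &&& b := fun _ _ => rfl
    rw [this, Nat.testBit_and, Bool.and_eq_true]
    refine ⟨?_, ih (fun kt h => hks kt (List.mem_cons_of_mem _ h))
      (fun kt h => hf kt (List.mem_cons_of_mem _ h))⟩
    rw [hks a List.mem_cons_self]
    apply testBit_sel_tabs N a.1 _ e he
    rw [testBit_amask _ _ _ (rg_lt _ _ (by omega))]
    exact hf a List.mem_cons_self

/-- the sign pattern forced on the residues `Z` -/
def Pat (N : ℕ) (Z : Multiset ℕ) : Prop :=
  (Z.map fun z => Dv N (z % N)).Nodup ∧ ∀ z ∈ Z, 3 * (z % N) ≠ N ∧ 3 * (z % N) ≠ 2 * N ∧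
    (isL N (z % N) = true ↔ Odd (Z.countP fun y => Dv N (y % N) < Dv N (z % N)))

/-- five sextants satisfying all mask bounds -/
def Bnd (g : Multiset ℕ) : Prop :=
  (g.map (bit 12)).sum = 2 ∧ (2 ≤ (g.map (bit 11)).sum ∧ (g.map (bit 11)).sum ≤ 3) ∧
  (2 ≤ (g.map (bit 14)).sum ∧ (g.map (bit 14)).sum ≤ 3) ∧
  (2 ≤ (g.map (bit 28)).sum ∧ (g.map (bit 28)).sum ≤ 3) ∧
  (g.map (bit 2)).sum ≤ 1 ∧ (g.map (bit 16)).sum ≤ 1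

theorem ble_iff (a b : ℕ) : Nat.ble a b = true ↔ a ≤ b :=
  ⟨Nat.le_of_ble_eq_true, Nat.ble_eq_true_of_le⟩

theorem Dv_eq (N z : ℕ) : Dv N z = if 4 * z < N then N - 4 * z else
    if 4 * z ≤ 3 * N then 4 * z - N else 5 * N - 4 * z := by
  unfold Dv
  change Bool.rec (motive := fun _ => ℕ) (Bool.rec (motive := fun _ => ℕ) (5 * N - 4 * z) (4 * z - N)
    (Nat.ble (4 * z) (3 * N))) (N - 4 * z) (Nat.ble (4 * z + 1) N) = _
  by_cases h : 4 * z < N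
  · rw [if_pos h, (ble_iff _ _).2 h]
  · rw [if_neg h, Bool.eq_false_iff.2 fun h' => h ((ble_iff _ _).1 h')]
    by_cases h2 : 4 * z ≤ 3 * N
    · rw [if_pos h2, (ble_iff _ _).2 h2]
    · rw [if_neg h2, Bool.eq_false_iff.2 fun h' => h2 ((ble_iff _ _).1 h')]

theorem isL_iff (N z : ℕ) : isL N z = true ↔ N < 3 * z ∧ 3 * z < 2 * N := by
  unfold isL
  rw [andB_eq, Bool.and_eq_true]
  exact and_congr (ble_iff _ _) (ble_iff _ _)

theorem rg_spec (N z : ℕ) (hN : 0 < N) :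
    rg N z * N ≤ 6 * (z % N) ∧ 6 * (z % N) < (rg N z + 1) * N := by
  have : rg N z = 6 * (z % N) / N := rfl
  rw [this]
  refine ⟨Nat.div_mul_le_self _ _, ?_⟩
  rw [mul_comm (_ + 1)]
  exact Nat.lt_mul_div_succ _ hN

/-- height of a sextant -/
def lvl (g : ℕ) : ℕ := ([1, 0, 1, 2, 3, 2][g]?).getD 0

theorem isL_iff_bit (N z : ℕ) (hN : 0 < N) (h : 3 * (z % N) ≠ N) :
    isL N (z % N) = true ↔ bit 12 (rg N z) = 1 := by
  have h1 := rg_spec N z hN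
  have h2 := rg_lt N z hN
  rw [isL_iff]
  generalize z % N = w at *
  generalize rg N z = g at *
  interval_cases g <;> simp [bit] <;> omega

theorem lvl_mono (N z w : ℕ) (hN : 0 < N) (_ : 3 * (z % N) ≠ N)
    (_ : 3 * (w % N) ≠ 2 * N) (h4 : Dv N (z % N) < Dv N (w % N)) :
    lvl (rg N z) ≤ lvl (rg N w) := by
  have h1 := rg_spec N z hN
  have h2 := rg_lt N z hN
  have h1' := rg_spec N w hN
  have h2' := rg_lt N w hN
  rw [Dv_eq, Dv_eq] at h4
  generalize z % N = x at *
  generalize w % N = y at *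
  generalize rg N z = g at *
  generalize rg N w = g' at *
  interval_cases g <;> interval_cases g' <;> simp [lvl] <;> split_ifs at h4 <;> omega

theorem sextant_bounds : ∀ a b c d e : Fin 6, lvl a ≤ lvl b → lvl b ≤ lvl c → lvl c ≤ lvl d →
    lvl d ≤ lvl e → bit 12 a = 0 → bit 12 b = 1 → bit 12 c = 0 → bit 12 d = 1 → bit 12 e = 0 →
    (2 ≤ bit 11 a + bit 11 b + bit 11 c + bit 11 d + bit 11 e ∧
      bit 11 a + bit 11 b + bit 11 c + bit 11 d + bit 11 e ≤ 3) ∧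
    (2 ≤ bit 14 a + bit 14 b + bit 14 c + bit 14 d + bit 14 e ∧
      bit 14 a + bit 14 b + bit 14 c + bit 14 d + bit 14 e ≤ 3) ∧
    (2 ≤ bit 28 a + bit 28 b + bit 28 c + bit 28 d + bit 28 e ∧
      bit 28 a + bit 28 b + bit 28 c + bit 28 d + bit 28 e ≤ 3) ∧
    bit 2 a + bit 2 b + bit 2 c + bit 2 d + bit 2 e ≤ 1 ∧
    bit 16 a + bit 16 b + bit 16 c + bit 16 d + bit 16 e ≤ 1 := by
  decide +kernel

theorem exists_sorted (N : ℕ) (Z : Multiset ℕ) (hc : Z.card = 5)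
    (hn : (Z.map fun z => Dv N (z % N)).Nodup) :
    ∃ a b c d e, Z = ↑[a, b, c, d, e] ∧ Dv N (a % N) < Dv N (b % N) ∧ Dv N (b % N) < Dv N (c % N) ∧
      Dv N (c % N) < Dv N (d % N) ∧ Dv N (d % N) < Dv N (e % N) := by
  let r : ℕ → ℕ → Prop := fun x y => Dv N (x % N) ≤ Dv N (y % N)
  have : Std.Total r := ⟨fun x y => le_total _ _⟩
  have : IsTrans ℕ r := ⟨fun x y z => le_trans⟩
  have hp := List.perm_insertionSort r Z.toList
  have hs := List.pairwise_insertionSort r Z.toList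
  have hZ : Z = ↑(Z.toList.insertionSort r) := by
    rw [Multiset.coe_eq_coe.2 hp, Multiset.coe_toList]
  generalize Z.toList.insertionSort r = l at *
  subst hZ
  have hl : l.length = 5 := by simpa using hc
  match l, hl with
  | [a, b, c, d, e], _ =>
    refine ⟨a, b, c, d, e, rfl, ?_⟩
    simp only [Multiset.map_coe, Multiset.coe_nodup, List.map_cons, List.map_nil, List.nodup_cons,
      List.mem_cons, not_or] at hn
    simp only [List.pairwise_cons, List.mem_cons, forall_eq_or_imp] at hs
    obtain ⟨⟨h1, -⟩, ⟨h2, -⟩, ⟨h3, -⟩, ⟨h4, -⟩, -⟩ := hs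
    exact ⟨lt_of_le_of_ne h1 hn.1.1, lt_of_le_of_ne h2 hn.2.1.1, lt_of_le_of_ne h3 hn.2.2.1.1,
      lt_of_le_of_ne h4 hn.2.2.2.1.1⟩

theorem Pat.bnd {N : ℕ} {Z : Multiset ℕ} (hN : 0 < N) (hc : Z.card = 5) (h : Pat N Z) :
    Bnd (Z.map (rg N)) := by
  obtain ⟨hn, hZ⟩ := h
  obtain ⟨a, b, c, d, e, rfl, h1, h2, h3, h4⟩ := exists_sorted N Z hc hn
  obtain ⟨a1, a2, a3⟩ := hZ a (by simp)
  obtain ⟨b1, b2, b3⟩ := hZ b (by simp)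
  obtain ⟨c1, c2, c3⟩ := hZ c (by simp)
  obtain ⟨d1, d2, d3⟩ := hZ d (by simp)
  obtain ⟨e1, e2, e3⟩ := hZ e (by simp)
  have l1 := lvl_mono N a b hN a1 b2 h1
  have l2 := lvl_mono N b c hN b1 c2 h2
  have l3 := lvl_mono N c d hN c1 d2 h3
  have l4 := lvl_mono N d e hN d1 e2 h4
  rw [isL_iff_bit N _ hN a1] at a3
  rw [isL_iff_bit N _ hN b1] at b3
  rw [isL_iff_bit N _ hN c1] at c3
  rw [isL_iff_bit N _ hN d1] at d3
  rw [isL_iff_bit N _ hN e1] at e3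
  have hb : ∀ g, bit 12 g = 0 ∨ bit 12 g = 1 := fun g => Nat.mod_two_eq_zero_or_one _
  have A : bit 12 (rg N a) = 0 := by
    refine (hb _).resolve_right fun h => ?_
    have := a3.1 h
    simp [h1.not_gt, (h1.trans h2).not_gt, (h1.trans (h2.trans h3)).not_gt,
      (h1.trans (h2.trans (h3.trans h4))).not_gt] at this
  have B : bit 12 (rg N b) = 1 := by
    rw [b3]
    simp [h1, h2.not_gt, (h2.trans h3).not_gt,
      ((h2.trans (h3.trans h4))).not_gt]
  have C : bit 12 (rg N c) = 0 := by
    refine (hb _).resolve_right fun h => ?_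
    have := c3.1 h
    simp [h1.trans h2, h2, h3.not_gt, (h3.trans h4).not_gt] at this
    revert this; decide
  have D : bit 12 (rg N d) = 1 := by
    rw [d3]
    simp [h1.trans (h2.trans h3), h2.trans h3, h3, h4.not_gt]
    decide
  have E : bit 12 (rg N e) = 0 := by
    refine (hb _).resolve_right fun h => ?_
    have := e3.1 h
    simp [h1.trans (h2.trans (h3.trans h4)), h2.trans (h3.trans h4), h3.trans h4,
      h4] at this
    revert this; decide
  have := sextant_bounds ⟨_, rg_lt N a hN⟩ ⟨_, rg_lt N b hN⟩ ⟨_, rg_lt N c hN⟩ ⟨_, rg_lt N d hN⟩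
    ⟨_, rg_lt N e hN⟩ l1 l2 l3 l4 A B C D E
  simp only [Bnd, Multiset.map_coe, Multiset.sum_coe, List.map_cons, List.map_nil, List.sum_cons,
    List.sum_nil, A, B, C, D, E, add_zero]
  refine ⟨rfl, ?_⟩
  simpa only [add_assoc] using this

set_option synthInstance.maxHeartbeats 400000 in
set_option synthInstance.maxSize 1000 in
theorem feas_of_sextants : ∀ a b c d e : Fin 6,
    bit 12 a + bit 12 b + bit 12 c + bit 12 d + bit 12 e = 2 →
    (2 ≤ bit 11 a + bit 11 b + bit 11 c + bit 11 d + bit 11 e ∧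
      bit 11 a + bit 11 b + bit 11 c + bit 11 d + bit 11 e ≤ 3) →
    (2 ≤ bit 14 a + bit 14 b + bit 14 c + bit 14 d + bit 14 e ∧
      bit 14 a + bit 14 b + bit 14 c + bit 14 d + bit 14 e ≤ 3) →
    (2 ≤ bit 28 a + bit 28 b + bit 28 c + bit 28 d + bit 28 e ∧
      bit 28 a + bit 28 b + bit 28 c + bit 28 d + bit 28 e ≤ 3) →
    bit 2 a + bit 2 b + bit 2 c + bit 2 d + bit 2 e ≤ 1 →
    bit 16 a + bit 16 b + bit 16 c + bit 16 d + bit 16 e ≤ 1 →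
    feas 4 (wt a) = true ∧ feas 3 (wt a + wt b) = true ∧ feas 2 (wt a + wt b + wt c) = true ∧
    feas 1 (wt a + wt b + wt c + wt d) = true ∧
    feas 0 (wt a + wt b + wt c + wt d + wt e) = true := by
  decide +kernel

theorem Bnd.feas {a b c d e : ℕ} (h : Bnd ↑[a, b, c, d, e])
    (h6 : a < 6 ∧ b < 6 ∧ c < 6 ∧ d < 6 ∧ e < 6) :
    feas 4 (wt a) = true ∧ feas 3 (wt a + wt b) = true ∧ feas 2 (wt a + wt b + wt c) = true ∧
    feas 1 (wt a + wt b + wt c + wt d) = true ∧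
    feas 0 (wt a + wt b + wt c + wt d + wt e) = true := by
  simp only [Bnd, Multiset.map_coe, Multiset.sum_coe, List.map_cons, List.map_nil, List.sum_cons,
    List.sum_nil, add_zero] at h
  simp only [← add_assoc] at h
  obtain ⟨h1, h2, h3, h4, h5, h7⟩ := h
  exact feas_of_sextants ⟨a, h6.1⟩ ⟨b, h6.2.1⟩ ⟨c, h6.2.2.1⟩ ⟨d, h6.2.2.2.1⟩ ⟨e, h6.2.2.2.2⟩
    h1 h2 h3 h4 h5 h7

/-- all Galois conjugates of the exponents `E` satisfy the sign pattern -/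
def Valid (N : ℕ) (E : Multiset ℕ) : Prop :=
  E.card = 5 ∧ N ∣ E.sum ∧ ∀ k, Nat.Coprime k N → Pat N (E.map (k * ·))

/-- some admissible power identifies all exponents -/
def Good (N : ℕ) (E : Multiset ℕ) : Prop :=
  ∃ t ∈ [1, 2, 3, 4, 5, 6, 9, 10, 11, 12], ∀ x ∈ E, ∀ y ∈ E, t * x % N = t * y % N

/-- fixed part `X` and missing part `R` of a valid configuration -/
def Cfg (N Q : ℕ) (X : List ℕ) (R : Multiset ℕ) : Prop :=
  Valid N (↑X + R) ∧ (∀ x ∈ X, x < N) ∧ ∀ e ∈ R, e < N ∧ Q ∣ N / Nat.gcd e N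

theorem rg_congr {N a b : ℕ} (h : a % N = b % N) : rg N a = rg N b := by
  change 6 * (a % N) / N = 6 * (b % N) / N
  rw [h]

theorem pat_map_mod (N : ℕ) (Z : Multiset ℕ) : Pat N (Z.map (· % N)) ↔ Pat N Z := by
  simp [Pat, Multiset.map_map, Multiset.countP_map, ← Multiset.countP_eq_card_filter]

theorem pat_map_congr {N : ℕ} {E : Multiset ℕ} {f g : ℕ → ℕ} (h : ∀ x ∈ E, f x % N = g x % N) :
    Pat N (E.map f) ↔ Pat N (E.map g) := by
  have := Multiset.map_congr (s := E) rfl h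
  rw [← pat_map_mod, ← pat_map_mod N (E.map g), Multiset.map_map, Multiset.map_map]
  exact iff_of_eq (congrArg _ this)

theorem Valid.map {N h : ℕ} {E : Multiset ℕ} (hE : Valid N E) (hh : Nat.Coprime h N) :
    Valid N (E.map fun x => h * x % N) := by
  obtain ⟨h1, h2, h3⟩ := hE
  refine ⟨by simpa using h1, ?_, fun k hk => ?_⟩
  · have : (E.map fun x => h * x % N).sum % N = (h * E.sum) % N := by
      have e : (E.map fun x => h * x).sum = h * E.sum := by
        simpa using Multiset.sum_map_mul_left (s := E) (a := h) (f := id)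
      rw [← e, Multiset.sum_nat_mod, Multiset.sum_nat_mod (E.map fun x => h * x),
        Multiset.map_map, Multiset.map_map]
      simp
    exact Nat.dvd_of_mod_eq_zero (this.trans (Nat.mod_eq_zero_of_dvd (h2.mul_left h)))
  · rw [Multiset.map_map]
    refine (pat_map_congr fun x _ => ?_).1 (h3 (k * h) (Nat.Coprime.mul_left hk hh))
    simp [mul_assoc, Nat.mul_mod]

theorem Good.of_map {N h : ℕ} {E : Multiset ℕ} (hh : Nat.Coprime h N)
    (hg : Good N (E.map fun x => h * x % N)) : Good N E := by
  obtain ⟨t, ht, h1⟩ := hg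
  refine ⟨t, ht, fun x hx y hy => ?_⟩
  have := h1 _ (Multiset.mem_map_of_mem _ hx) _ (Multiset.mem_map_of_mem _ hy)
  simp only [Nat.mul_mod_mod] at this
  have h2 : h * (t * x) ≡ h * (t * y) [MOD N] := by
    rw [Nat.mul_left_comm, Nat.mul_left_comm h]; exact this
  exact Nat.ModEq.cancel_left_of_coprime (by rw [Nat.gcd_comm]; exact hh) h2

theorem Valid.bnd {N k : ℕ} {E : Multiset ℕ} (hN : 0 < N) (hE : Valid N E) (hk : Nat.Coprime k N) :
    Bnd (E.map fun x => rg N (k * x)) := by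
  have := (hE.2.2 k hk).bnd hN (by simpa using hE.1)
  rwa [Multiset.map_map] at this

theorem Bnd.feas_part {Y R : Multiset ℕ} {r : ℕ} (h : Bnd (Y + R)) (hr : R.card = r)
    (hY : Y.card + r = 5) (hr4 : r ≤ 4) (h6 : ∀ g ∈ Y + R, g < 6) :
    FiniteBraid.feas r (Y.map wt).sum = true := by
  obtain ⟨Y, rfl⟩ : ∃ l : List ℕ, Y = ↑l := ⟨Y.toList, by simp⟩
  obtain ⟨R, rfl⟩ : ∃ l : List ℕ, R = ↑l := ⟨R.toList, by simp⟩
  simp only [Multiset.coe_card, Multiset.map_coe, Multiset.sum_coe,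
    Multiset.coe_add, Multiset.mem_coe] at *
  obtain ⟨L, rfl⟩ : ∃ L, L = Y ++ R := ⟨_, rfl⟩
  have hL : (Y ++ R).length = 5 := by simp; omega
  have key : ∀ L : List ℕ, L.length = 5 → Bnd ↑L → (∀ g ∈ L, g < 6) → ∀ r ≤ 4,
      FiniteBraid.feas r ((L.take (5 - r)).map wt).sum = true := by
    intro L hL hB h6 r hr
    match L, hL with
    | [a, b, c, d, e], _ =>
      have := hB.feas ⟨h6 a (by simp), h6 b (by simp), h6 c (by simp), h6 d (by simp),
        h6 e (by simp)⟩
      interval_cases r <;> simpa [← add_assoc] using by tauto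
  have := key _ hL h h6 r hr4
  rwa [show 5 - r = Y.length by omega, List.take_left] at this

theorem wtX_eq (N k : ℕ) (X : List ℕ) :
    wtX N k X = (Multiset.map wt (Multiset.map (fun x => rg N (k * x)) ↑X)).sum := by
  unfold wtX
  rw [sumL_eq]
  simp
  rfl

theorem Cfg.feas {N Q k : ℕ} {X : List ℕ} {R : Multiset ℕ} {e r : ℕ} (hN : 0 < N)
    (h : Cfg N Q X (e ::ₘ R)) (hr : R.card = r) (hX : X.length + 1 + r = 5)
    (hk : Nat.Coprime k N) : FiniteBraid.feas r (wtX N k X + wt (rg N (k * e))) = true := by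
  have hb := h.1.bnd hN hk
  have : (X : Multiset ℕ) + e ::ₘ R = (e ::ₘ ↑X) + R := by
    rw [Multiset.add_cons, Multiset.cons_add]
  rw [this, Multiset.map_add] at hb
  have := hb.feas_part (r := r) (by simpa using hr) (by simpa using by omega) (by omega) (by
    intro g hg
    rw [← Multiset.map_add] at hg
    obtain ⟨x, -, rfl⟩ := Multiset.mem_map.1 hg
    exact rg_lt _ _ hN)
  rw [wtX_eq]
  simpa [add_comm] using this

theorem Valid.nodup_Dv {N : ℕ} {E : Multiset ℕ} (h : Valid N E) :
    (E.map fun z => Dv N (z % N)).Nodup := by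
  have := (h.2.2 1 (Nat.coprime_one_left N)).1
  simpa using this

theorem Valid.ne_third {N : ℕ} {E : Multiset ℕ} (h : Valid N E) {e : ℕ} (he : e ∈ E) :
    3 * (e % N) ≠ N ∧ 3 * (e % N) ≠ 2 * N := by
  have := (h.2.2 1 (Nat.coprime_one_left N)).2 e (by simpa using he)
  exact ⟨this.1, this.2.1⟩

theorem beq_iff (a b : ℕ) : Nat.beq a b = true ↔ a = b :=
  ⟨Nat.eq_of_beq_eq_true, fun h => by rw [h]; exact Nat.beq_refl b⟩

theorem Cfg.dis {N Q : ℕ} {X : List ℕ} {R : Multiset ℕ} {e : ℕ}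
    (h : Cfg N Q X R) (he : e ∈ R) : FiniteBraid.dis N Q e = false := by
  obtain ⟨h1, h2⟩ := h.2.2 e he
  obtain ⟨h3, h4⟩ := h.1.ne_third (e := e) (by simp [he])
  rw [Nat.mod_eq_of_lt h1] at h3 h4
  rw [← Bool.not_eq_true]
  unfold FiniteBraid.dis
  rw [orB_eq, orB_eq, Bool.or_eq_true, Bool.or_eq_true, beq_iff, beq_iff, Bool.not_eq_true',
    ← Bool.not_eq_true, beq_iff]
  change ¬ (¬ (N / Nat.gcd e N % Q = 0) ∨ 3 * e = N ∨ 3 * e = 2 * N)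
  rw [Nat.mod_eq_zero_of_dvd h2]
  tauto

theorem Cfg.testBit_cands {N Q r al : ℕ} {ks : List (ℕ × List ℕ)} {X : List ℕ} {R : Multiset ℕ}
    {e : ℕ} (hN : 0 < N) (h : Cfg N Q X R) (he : e ∈ R) (hr : R.card = r + 1)
    (hX : X.length + 1 + r = 5) (hal : al = allowed N Q)
    (hks : ∀ kt ∈ ks, Nat.Coprime kt.1 N ∧ kt.2 = tabs N kt.1) :
    (cands N r al ks X).testBit e = true := by
  refine FiniteBraid.testBit_cands N r al ks X e (h.2.2 e he).1 (fun kt hkt => (hks kt hkt).2)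
    (hal ▸ testBit_allowed N Q e (h.2.2 e he).1 (h.dis he)) fun kt hkt => ?_
  obtain ⟨R', rfl⟩ := Multiset.exists_cons_of_mem he
  exact h.feas hN (by simpa using hr) hX (hks kt hkt).1

theorem Dv_eq_of_add {N x e : ℕ} (hx : x < N) (he : e < N) (h : 2 * (x + e) % N = 0)
    (h' : (x + e) % N ≠ 0) : Dv N x = Dv N e := by
  obtain ⟨c, hc⟩ := Nat.dvd_of_mod_eq_zero h
  have hc4 : c < 4 := by
    by_contra h4
    have : N * 4 ≤ N * c := Nat.mul_le_mul_left N (by omega)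
    omega
  have : c = 1 ∨ c = 3 := by
    interval_cases c
    · exfalso; apply h'; rw [show x + e = 0 by omega]; simp
    · simp
    · exfalso; apply h'; rw [show x + e = N by omega]; simp
    · simp
  rw [Dv_eq, Dv_eq]
  rcases this with rfl | rfl <;> split_ifs <;> omega

theorem Cfg.clash {N Q : ℕ} {X : List ℕ} {R : Multiset ℕ} {e : ℕ}
    (h : Cfg N Q X R) (he : e ∈ R) : FiniteBraid.clash N e X = false := by
  rw [← Bool.not_eq_true]
  unfold FiniteBraid.clash
  rw [anyL_iff]
  rintro ⟨x, hx, hxe⟩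
  rw [orB_eq, andB_eq, Bool.or_eq_true, Bool.and_eq_true, beq_iff, beq_iff, Bool.not_eq_true',
    ← Bool.not_eq_true, beq_iff] at hxe
  obtain ⟨R', rfl⟩ := Multiset.exists_cons_of_mem he
  have h1 := h.1.nodup_Dv
  rw [show (X : Multiset ℕ) + e ::ₘ R' = e ::ₘ (↑X + R') from Multiset.add_cons _ _ _, Multiset.map_cons,
    Multiset.nodup_cons] at h1
  apply h1.1
  rw [Multiset.mem_map]
  refine ⟨x, by simp [hx], ?_⟩
  rcases hxe with rfl | ⟨h2, h3⟩
  · rfl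
  · rw [Nat.mod_eq_of_lt (h.2.1 x hx), Nat.mod_eq_of_lt (h.2.2 e he).1]
    exact Dv_eq_of_add (h.2.1 x hx) (h.2.2 e he).1 h2 h3

theorem tbl_bound {g : Multiset ℕ} (h : Bnd g) {t : ℕ} (ht : t ∈ tbl) :
    tlo t ≤ (g.map (bit (tm t))).sum ∧ (g.map (bit (tm t))).sum ≤ thi t := by
  obtain ⟨h1, h2, h3, h4, -, -⟩ := h
  simp only [tbl, List.mem_cons, List.not_mem_nil, or_false] at ht
  rcases ht with rfl | rfl | rfl | rfl
  · exact ⟨h1.ge, h1.le⟩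
  · exact h2
  · exact h3
  · exact h4

theorem mul_mod_of_fixed {N M x h i : ℕ} (hh : h = 1 + i * M) (hx : N ∣ x * M) (hxN : x < N) :
    h * x % N = x := by
  obtain ⟨c, hc⟩ := hx
  rw [hh, show (1 + i * M) * x = x + N * (c * i) by
    rw [add_mul, one_mul, mul_assoc, mul_comm M, hc]; ring, Nat.add_mul_mod_self_left,
    Nat.mod_eq_of_lt hxN]

theorem gcd_mul_mod {N h e : ℕ} (hh : Nat.Coprime h N) : Nat.gcd (h * e % N) N = Nat.gcd e N := by
  rw [← Nat.gcd_rec, Nat.gcd_comm]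
  exact hh.gcd_mul_left_cancel e

theorem Cfg.map {N Q M h : ℕ} {X : List ℕ} {R : Multiset ℕ} (hN : 0 < N) (hc : Cfg N Q X R)
    (hM : ∀ x ∈ X, N ∣ x * M) (hh : h ∈ hsOf N M) : Cfg N Q X (R.map fun e => h * e % N) := by
  obtain ⟨⟨i, -, hi⟩, hcop⟩ := (mem_hsOf _ _ _).1 hh
  refine ⟨?_, hc.2.1, fun e he => ?_⟩
  · have := hc.1.map hcop
    rwa [Multiset.map_add, Multiset.map_congr (s := X) (f := fun x => h * x % N) (g := id) rfl fun x hx =>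
      mul_mod_of_fixed hi (hM x hx) (hc.2.1 x hx), Multiset.map_id] at this
  · obtain ⟨e', he', rfl⟩ := Multiset.mem_map.1 he
    rw [gcd_mul_mod hcop]
    exact ⟨Nat.mod_lt _ hN, (hc.2.2 e' he').2⟩

theorem mul_mem_hsOf {N M h h' : ℕ} (hN : 1 < N) (hM : M ∣ N) (hh : h ∈ hsOf N M)
    (hh' : h' ∈ hsOf N M) : h * h' % N ∈ hsOf N M := by
  rw [mem_hsOf] at *
  obtain ⟨⟨i, -, hi⟩, hc⟩ := hh
  obtain ⟨⟨j, -, hj⟩, hc'⟩ := hh'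
  have hcc : Nat.Coprime (h * h' % N) N := by
    have := gcd_mul_mod (e := h') hc
    exact this.trans hc'
  refine ⟨?_, hcc⟩
  have hlt := Nat.mod_lt (h * h') (by omega : N > 0)
  have hpos : 0 < h * h' % N := by
    refine Nat.pos_of_ne_zero fun h0 => ?_
    rw [h0, Nat.coprime_zero_left] at hcc
    omega
  have hmod : h * h' % N ≡ 1 [MOD M] := by
    have h1 : h * h' % N ≡ h * h' [MOD M] := (Nat.mod_modEq _ _).of_dvd hM
    have h2 : h ≡ 1 [MOD M] := by
      rw [hi]; simp [Nat.ModEq]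
    have h3 : h' ≡ 1 [MOD M] := by
      rw [hj]; simp [Nat.ModEq]
    exact h1.trans (h2.mul h3)
  obtain ⟨c, hc⟩ := (Nat.modEq_iff_dvd' hpos).1 hmod.symm
  have hMpos : 0 < M := Nat.pos_of_dvd_of_pos hM (by omega)
  refine ⟨c, ?_, by rw [mul_comm c]; omega⟩
  rw [Nat.lt_div_iff_mul_lt' hM]
  omega

theorem hsOf_nodup {N M : ℕ} (hM : 0 < M) : (hsOf N M).Nodup := by
  have key : ∀ l : List ℕ, (List.rec [] (fun i _ ih => Nat.add 1 (Nat.mul i M) :: ih) l : List ℕ)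
      = l.map fun i => 1 + i * M := by
    intro l
    induction l with
    | nil => rfl
    | cons a t ih => rw [List.map_cons, ← ih]; rfl
  have hf : ∀ (p : ℕ → Bool) (l : List ℕ), l.Nodup → (filt p l).Nodup := by
    intro p l
    induction l with
    | nil => intro h; exact h
    | cons a t ih =>
      intro h
      rw [List.nodup_cons] at h
      change (Bool.rec (motive := fun _ => List ℕ) (filt p t) (a :: filt p t) (p a)).Nodup
      cases p a
      · exact ih h.2
      · exact List.nodup_cons.2 ⟨fun h' => h.1 ((mem_filt _ _ _).1 h').1, ih h.2⟩
  have hd : ∀ n, (down n).Nodup := by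
    intro n
    induction n with
    | zero => exact List.nodup_nil
    | succ n ih => exact List.nodup_cons.2 ⟨fun h => lt_irrefl _ ((mem_down _ _).1 h), ih⟩
  unfold hsOf
  refine hf _ _ ?_
  rw [key]
  refine (hd _).map fun i j hij => ?_
  have : i * M = j * M := Nat.add_left_cancel hij
  exact Nat.eq_of_mul_eq_mul_right hM this

theorem sum_hsOf_mul {N M h : ℕ} (hN : 1 < N) (hM : M ∣ N) (hh : h ∈ hsOf N M) (f : ℕ → ℕ)
    (hf : ∀ a b, a % N = b % N → f a = f b) :
    sumL (fun a => f (a * h)) (hsOf N M) = sumL f (hsOf N M) := by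
  have hMpos : 0 < M := Nat.pos_of_dvd_of_pos hM (by omega)
  have hnd := hsOf_nodup (N := N) hMpos
  rw [sumL_eq, sumL_eq, ← List.sum_toFinset f hnd, ← List.sum_toFinset _ hnd]
  have hcop := ((mem_hsOf _ _ _).1 hh).2
  have hlt : ∀ a ∈ hsOf N M, a < N := by
    intro a ha
    have := mul_mem_hsOf hN hM ha ha
    obtain ⟨⟨i, hi, rfl⟩, hc⟩ := (mem_hsOf _ _ _).1 ha
    have h1 : (i + 1) * M ≤ N := (Nat.le_div_iff_mul_le hMpos).1 hi
    rw [add_mul] at h1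
    refine lt_of_le_of_ne (by omega) fun h2 => ?_
    rw [h2, Nat.coprime_self] at hc
    omega
  have hinj : Set.InjOn (fun a => a * h % N) ((hsOf N M).toFinset : Set ℕ) := by
    intro a ha b hb hab
    have ha := hlt a (by simpa using ha)
    have hb := hlt b (by simpa using hb)
    have : a ≡ b [MOD N] := Nat.ModEq.cancel_right_of_coprime (by rw [Nat.gcd_comm]; exact hcop) hab
    rwa [Nat.ModEq, Nat.mod_eq_of_lt ha, Nat.mod_eq_of_lt hb] at this
  have himg : (hsOf N M).toFinset.image (fun a => a * h % N) = (hsOf N M).toFinset := by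
    refine Finset.eq_of_subset_of_card_le ?_ (Finset.card_image_of_injOn hinj).ge
    intro a ha
    obtain ⟨b, hb, rfl⟩ := Finset.mem_image.1 ha
    rw [List.mem_toFinset] at *
    exact mul_mem_hsOf hN hM hb hh
  conv_rhs => rw [← himg, Finset.sum_image hinj]
  exact Finset.sum_congr rfl fun a _ => hf _ _ (Nat.mod_mod _ _).symm

/-- the orbit sum of the mask count -/
def orbS (N k m : ℕ) (hs : List ℕ) (e : ℕ) : ℕ :=
  sumL (fun h => bit m (rg N (k * h * e))) hs

theorem orbS_mul {N M h k m e : ℕ} (hN : 1 < N) (hM : M ∣ N) (hh : h ∈ hsOf N M) :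
    orbS N k m (hsOf N M) (h * e % N) = orbS N k m (hsOf N M) e := by
  unfold orbS
  rw [← sum_hsOf_mul hN hM hh fun a => bit m (rg N (k * a * e))]
  · refine sumL_congr _ _ _ fun a _ => ?_
    rw [rg_congr]
    rw [Nat.mul_mod_mod, show k * (a * h) * e = k * a * (h * e) by ring]
  · intro a b hab
    rw [rg_congr]
    have : a ≡ b [MOD N] := hab
    exact (this.mul_left k).mul_right e

theorem evX_eq (N m k : ℕ) (X : List ℕ) :
    evX N m k X = (Multiset.map (fun x => bit m (rg N (k * x))) ↑X).sum := by
  unfold evX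
  rw [sumL_eq]
  simp

theorem Cfg.sum_orbS {N Q M k t : ℕ} {X : List ℕ} {R : Multiset ℕ} (hN : 1 < N)
    (hc : Cfg N Q X R) (hM' : ∀ x ∈ X, N ∣ x * M) (hk : Nat.Coprime k N) (ht : t ∈ tbl) :
    (hsOf N M).length * (tlo t - evX N (tm t) k X) ≤ (R.map (orbS N k (tm t) (hsOf N M))).sum ∧
    (R.map (orbS N k (tm t) (hsOf N M))).sum ≤ (hsOf N M).length * (thi t - evX N (tm t) k X) := by
  have key : ∀ h ∈ hsOf N M,
      tlo t - evX N (tm t) k X ≤ (R.map fun e => bit (tm t) (rg N (k * h * e))).sum ∧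
      (R.map fun e => bit (tm t) (rg N (k * h * e))).sum ≤ thi t - evX N (tm t) k X := by
    intro h hh
    obtain ⟨⟨i, -, hi⟩, hcop⟩ := (mem_hsOf _ _ _).1 hh
    have := tbl_bound (hc.1.bnd (by omega) (Nat.Coprime.mul_left hk hcop)) ht
    rw [Multiset.map_map, Multiset.map_add, Multiset.sum_add] at this
    have h2 : (Multiset.map (bit (tm t) ∘ fun x => rg N (k * h * x)) ↑X).sum = evX N (tm t) k X := by
      rw [evX_eq]
      refine congrArg _ (Multiset.map_congr rfl fun x hx => ?_)
      have hx' := mul_mod_of_fixed hi (hM' x hx) (hc.2.1 x hx)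
      change bit _ (rg N (k * h * x)) = _
      rw [rg_congr]
      rw [mul_assoc, Nat.mul_mod, hx', Nat.mul_mod k x, Nat.mod_eq_of_lt (hc.2.1 x hx)]
    rw [h2] at this
    change _ ≤ _ + (R.map fun e => bit (tm t) (rg N (k * h * e))).sum ∧
      _ + (R.map fun e => bit (tm t) (rg N (k * h * e))).sum ≤ _ at this
    omega
  have hswap : (R.map (orbS N k (tm t) (hsOf N M))).sum =
      (Multiset.map (fun h => (R.map fun e => bit (tm t) (rg N (k * h * e))).sum)
        (hsOf N M : Multiset ℕ)).sum := by
    rw [← Multiset.sum_map_sum_map]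
    refine congrArg _ (Multiset.map_congr rfl fun x hx => ?_)
    unfold orbS
    rw [sumL_eq]
    simp
  rw [hswap]
  constructor
  · have := Multiset.card_nsmul_le_sum (s := Multiset.map (fun h => (R.map fun e =>
      bit (tm t) (rg N (k * h * e))).sum) (hsOf N M : Multiset ℕ))
      (a := tlo t - evX N (tm t) k X) fun x hx => by
        obtain ⟨h, hh, rfl⟩ := Multiset.mem_map.1 hx
        exact (key h hh).1
    simpa using this
  · have := Multiset.sum_le_card_nsmul (Multiset.map (fun h => (R.map fun e =>
      bit (tm t) (rg N (k * h * e))).sum) (hsOf N M : Multiset ℕ))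
      (thi t - evX N (tm t) k X) fun x hx => by
        obtain ⟨h, hh, rfl⟩ := Multiset.mem_map.1 hx
        exact (key h hh).2
    simpa using this

theorem candBad_iff (N r k t side c n : ℕ) (hs : List ℕ) (e : ℕ) :
    candBad N r k t side c n hs e = true ↔ if side = 0 then
      r * orbS N k (tm t) hs e < n * (tlo t - c) else n * (thi t - c) < r * orbS N k (tm t) hs e := by
  unfold candBad
  rw [force_eq]
  change (Bool.rec (motive := fun _ => Bool) (Nat.ble (n * (thi t - c) + 1) (r * orbS N k (tm t) hs e))
    (Nat.ble (r * orbS N k (tm t) hs e + 1) (n * (tlo t - c))) (Nat.beq side 0)) = true ↔ _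
  by_cases h : side = 0
  · rw [if_pos h, (beq_iff _ _).2 h]
    exact ble_iff _ _
  · rw [if_neg h, Bool.eq_false_iff.2 fun h' => h ((beq_iff _ _).1 h')]
    exact ble_iff _ _

theorem exists_not_candBad {N Q M k t r side : ℕ} {X : List ℕ} {R : Multiset ℕ} (hN : 1 < N)
    (hc : Cfg N Q X R) (hM' : ∀ x ∈ X, N ∣ x * M) (hk : Nat.Coprime k N) (ht : t ∈ tbl)
    (hr : R.card = r) (hr0 : 0 < r) :
    ∃ e ∈ R, candBad N r k t side (evX N (tm t) k X) (hsOf N M).length (hsOf N M) e = false := by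
  by_contra hcon
  have hcon : ∀ e ∈ R,
      candBad N r k t side (evX N (tm t) k X) (hsOf N M).length (hsOf N M) e = true := by
    intro e he
    by_contra h
    exact hcon ⟨e, he, by simpa using h⟩
  have hS := hc.sum_orbS hN hM' hk ht
  have hmul : (R.map fun e => r * orbS N k (tm t) (hsOf N M) e).sum =
      r * (R.map (orbS N k (tm t) (hsOf N M))).sum := Multiset.sum_map_mul_left ..
  by_cases h : side = 0
  · have := Multiset.sum_le_card_nsmul (R.map fun e => r * orbS N k (tm t) (hsOf N M) e)
      ((hsOf N M).length * (tlo t - evX N (tm t) k X) - 1) fun x hx => by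
        obtain ⟨e, he, rfl⟩ := Multiset.mem_map.1 hx
        have := hcon e he
        rw [candBad_iff, if_pos h] at this
        omega
    rw [hmul, Multiset.card_map, hr, smul_eq_mul] at this
    have h1 := Nat.le_of_mul_le_mul_left this hr0
    obtain ⟨e, he⟩ := Multiset.card_pos_iff_exists_mem.1 (hr ▸ hr0)
    have h2 := hcon e he
    rw [candBad_iff, if_pos h] at h2
    omega
  · have := Multiset.card_nsmul_le_sum (s := R.map fun e => r * orbS N k (tm t) (hsOf N M) e)
      (a := (hsOf N M).length * (thi t - evX N (tm t) k X) + 1) fun x hx => by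
        obtain ⟨e, he, rfl⟩ := Multiset.mem_map.1 hx
        have := hcon e he
        rw [candBad_iff, if_neg h] at this
        omega
    rw [hmul, Multiset.card_map, hr, smul_eq_mul] at this
    have h1 := Nat.le_of_mul_le_mul_left this hr0
    omega

theorem exists_candidate {N Q M k t r side : ℕ} {X : List ℕ} {R : Multiset ℕ} (hN : 1 < N)
    (hc : Cfg N Q X R) (hM : M ∣ N) (hM' : ∀ x ∈ X, N ∣ x * M) (hk : Nat.Coprime k N)
    (ht : t ∈ tbl) (hr : R.card = r) (hr0 : 0 < r) (hne : ∃ h, h ∈ hsOf N M) :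
    ∃ h ∈ hsOf N M, ∃ e ∈ R.map fun e => h * e % N,
      candBad N r k t side (evX N (tm t) k X) (hsOf N M).length (hsOf N M) e = false ∧
      nonmin N (hsOf N M) e = false := by
  obtain ⟨e, he, hcb⟩ := exists_not_candBad (side := side) hN hc hM' hk ht hr hr0
  obtain ⟨h, hh, hmin⟩ := Finset.exists_min_image (hsOf N M).toFinset (fun h => h * e % N)
    (by obtain ⟨h, hh⟩ := hne; exact ⟨h, by simpa using hh⟩)
  rw [List.mem_toFinset] at hh
  refine ⟨h, hh, h * e % N, Multiset.mem_map_of_mem (fun e => h * e % N) he, ?_, ?_⟩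
  · rw [← Bool.not_eq_true, candBad_iff] at hcb ⊢
    rwa [orbS_mul hN hM hh]
  · rw [← Bool.not_eq_true]
    unfold nonmin
    rw [anyL_iff]
    rintro ⟨h', hh', hlt⟩
    have hlt : h' * (h * e % N) % N < h * e % N := (ble_iff _ _).1 hlt
    have := hmin (h' * h % N) (by rw [List.mem_toFinset]; exact mul_mem_hsOf hN hM hh' hh)
    rw [Nat.mod_mul_mod, mul_assoc] at this
    rw [Nat.mul_mod_mod] at hlt
    omega

theorem expand_sound {N Q M r : ℕ} {ks : List (ℕ × List ℕ)} {X : List ℕ} {R : Multiset ℕ}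
    {go : ℕ → Bool} {B : ℕ} (hN : 1 < N) (hc : Cfg N Q X R) (hM : M ∣ N)
    (hM' : ∀ x ∈ X, N ∣ x * M) (hr : R.card = r) (hr0 : 0 < r)
    (hB : ∀ R', Cfg N Q X R' → R'.card = r → ∀ e ∈ R', B.testBit e = true)
    (h : expand N r ks (hsOf N M) X go B = true) :
    ∃ h, Nat.Coprime h N ∧ (∀ x ∈ X, h * x % N = x) ∧ ∃ e R', R.map (fun e => h * e % N) = e ::ₘ R' ∧
      Cfg N Q X (e ::ₘ R') ∧ go e = true := by
  unfold expand at h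
  simp only [force_eq, andB_eq, orB_eq, Bool.and_eq_true] at h
  obtain ⟨hk, ht, hall⟩ := h
  rw [cop_iff] at hk
  rw [anyL_iff] at ht
  obtain ⟨t, ht, hteq⟩ := ht
  rw [beq_iff] at hteq
  rw [hteq] at hall
  have hlen : sumL (fun _ => 1) (hsOf N M) = (hsOf N M).length := by
    rw [sumL_eq]; simp
  rw [hlen] at hall
  have hMpos : 0 < M := Nat.pos_of_dvd_of_pos hM (by omega)
  have hne : 1 ∈ hsOf N M := by
    rw [mem_hsOf]
    exact ⟨⟨0, Nat.div_pos (Nat.le_of_dvd (by omega) hM) hMpos, by simp⟩, Nat.coprime_one_left N⟩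
  obtain ⟨g, hg, e, he, h1, h2⟩ := exists_candidate hN hc hM hM' hk ht hr hr0 ⟨1, hne⟩
  have hc' := hc.map (by omega) hM' hg
  obtain ⟨R', hR'⟩ := Multiset.exists_cons_of_mem he
  obtain ⟨⟨i, -, hi⟩, hcop⟩ := (mem_hsOf _ _ _).1 hg
  refine ⟨g, hcop, fun x hx => mul_mod_of_fixed hi (hM' x hx) (hc.2.1 x hx), e, R', hR', hR' ▸ hc', ?_⟩
  have := allBits_spec _ _ _ hall e
    (by have := (hc'.2.2 e he).1; change e < 64 * (N / 64 + 1); omega)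
    (hB _ hc' (by simpa using hr) e he)
  rw [h1, h2, hc'.clash he] at this
  simpa using this

theorem sumL_ite (p : ℕ → Prop) [DecidablePred p] (f : ℕ → ℕ) (X : List ℕ)
    (hf : ∀ x, f x = if p x then 1 else 0) : sumL f X = Multiset.countP p ↑X := by
  rw [sumL_eq]
  induction X with
  | nil => rfl
  | cons a t ih =>
    rw [List.map_cons, List.sum_cons, ih, hf, ← Multiset.cons_coe, Multiset.countP_cons, add_comm]

theorem cntLt_eq (N k d : ℕ) (X : List ℕ) :
    cntLt N k d X = Multiset.countP (fun x => Dv N (k * x % N) < d) ↑X := by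
  unfold cntLt
  refine sumL_ite _ _ X fun x => ?_
  change Bool.rec (motive := fun _ => ℕ) 0 1 (Nat.ble (Dv N (k * x % N) + 1) d) = _
  by_cases h : Dv N (k * x % N) < d
  · rw [if_pos h, (ble_iff _ _).2 h]
  · rw [if_neg h, Bool.eq_false_iff.2 fun h' => h ((ble_iff _ _).1 h')]

theorem patBad_eq_false {N k : ℕ} {X : List ℕ} (h : Pat N (Multiset.map (k * ·) ↑X)) :
    patBad N k X = false := by
  rw [← Bool.not_eq_true]
  unfold patBad
  rw [anyL_iff]
  rintro ⟨x, hx, hb⟩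
  have hp := (h.2 (k * x) (Multiset.mem_map_of_mem (k * ·) hx)).2.2
  rw [Multiset.countP_map, ← Multiset.countP_eq_card_filter] at hp
  rw [Bool.not_eq_true', ← Bool.not_eq_true, beq_iff, cntLt_eq] at hb
  apply hb
  change Bool.rec (motive := fun _ => ℕ) 0 1 (isL N (k * x % N)) =
    Multiset.countP (fun y => Dv N (k * y % N) < Dv N (k * x % N)) ↑X % 2
  cases hL : isL N (k * x % N)
  · rw [hL] at hp
    simp only [Bool.false_eq_true, false_iff, Nat.not_odd_iff] at hp
    exact hp.symm
  · rw [hL] at hp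
    simp only [true_iff, Nat.odd_iff] at hp
    exact hp.symm

theorem goodL_sound {N : ℕ} {X : List ℕ} (h : goodL N X = true) : Good N ↑X := by
  unfold goodL at h
  rw [anyL_iff] at h
  obtain ⟨t, ht, h⟩ := h
  refine ⟨t, ht, fun x hx y hy => ?_⟩
  rw [allL_iff] at h
  have h1 := h x hx
  rw [allL_iff] at h1
  exact (beq_iff _ _).1 (h1 y hy)

theorem final_sound {N : ℕ} {us X : List ℕ} (hN : 0 < N) (hus : ∀ k ∈ us, Nat.Coprime k N)
    (hE : Valid N ↑X) (h : final N us X = true) : Good N ↑X := by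
  unfold final at h
  rw [orB_eq, orB_eq, Bool.or_eq_true, Bool.or_eq_true, anyL_iff, anyL_iff] at h
  rcases h with ⟨k, hk, h⟩ | h | ⟨k, hk, h⟩
  · have hb := hE.bnd hN (hus k hk)
    have hf := Bnd.feas_part (Y := Multiset.map (fun x => rg N (k * x)) ↑X) (R := 0) (r := 0)
      (by simpa using hb) rfl (by simpa using hE.1) (by norm_num) (by
        intro g hg
        rw [add_zero] at hg
        obtain ⟨x, -, rfl⟩ := Multiset.mem_map.1 hg
        exact rg_lt _ _ hN)
    rw [← wtX_eq] at hf
    rw [hf] at h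
    simp at h
  · exact goodL_sound h
  · rw [patBad_eq_false (hE.2.2 k (hus k hk))] at h
    simp at h

theorem last_aux {N Q : ℕ} {us X : List ℕ} {B e x : ℕ} (hN : 0 < N)
    (hus : ∀ k ∈ us, Nat.Coprime k N) (hX : X.length = 3) (hc : Cfg N Q X {e, x}) (hlt : e < x)
    (hB : ∀ y ∈ ({e, x} : Multiset ℕ), B.testBit y = true)
    (h : last N us X B = true) : Good N (↑X + {e, x}) := by
  have heN := (hc.2.2 e (by simp)).1
  have hxN := (hc.2.2 x (by simp)).1
  have hperm : (X : Multiset ℕ) + {e, x} = ↑(x :: e :: X) := by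
    rw [← Multiset.cons_coe, ← Multiset.cons_coe, Multiset.insert_eq_cons, Multiset.add_cons,
      ← Multiset.singleton_add, ← Multiset.singleton_add x, ← Multiset.singleton_add e]
    abel
  have hE := hc.1
  rw [hperm] at hE ⊢
  unfold last at h
  rw [force_eq] at h
  have := allBits_spec _ _ _ h e (by change e < 64 * (N / 64 + 1); omega) (hB e (by simp))
  have hsx : sumL (fun x => x) X = X.sum := by rw [sumL_eq]; simp
  have hxeq : Nat.mod (Nat.sub (Nat.mul 5 N) (Nat.add e (sumL (fun x => x) X))) N = x := by
    rw [hsx]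
    change (5 * N - (e + X.sum)) % N = x
    have hsum : N ∣ x + (e + X.sum) := by simpa using hE.2.1
    have hle : X.sum ≤ 3 * N := by
      have := List.sum_le_card_nsmul X N fun y hy => (hc.2.1 y hy).le
      rwa [hX, smul_eq_mul] at this
    have h1 : 5 * N - (e + X.sum) ≡ x [MOD N] := by
      refine Nat.ModEq.add_right_cancel' (e + X.sum) ?_
      rw [Nat.sub_add_cancel (by omega)]
      exact (Nat.mod_eq_zero_of_dvd (Dvd.intro_left 5 rfl)).trans (Nat.mod_eq_zero_of_dvd hsum).symm
    rw [h1, Nat.mod_eq_of_lt hxN]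
  have hc1 : clash N e X = false := hc.clash (by simp)
  have hc2 : clash N x (e :: X) = false := by
    have : Cfg N Q (e :: X) {x} := by
      refine ⟨?_, ?_, ?_⟩
      · rw [show ((e :: X : List ℕ) : Multiset ℕ) + {x} = ↑(x :: e :: X) by
          rw [add_comm, Multiset.singleton_add, Multiset.cons_coe]]
        exact hE
      · intro y hy
        rcases List.mem_cons.1 hy with rfl | hy
        · exact heN
        · exact hc.2.1 y hy
      · intro y hy
        exact hc.2.2 y (by rw [Multiset.mem_singleton.1 hy]; simp)
    exact this.clash (by simp)
  have hbit : Nat.beq (bit B x) 0 = false := by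
    rw [← Bool.not_eq_true, beq_iff, bit_eq, hB x (by simp)]
    simp
  have hble : Nat.ble x e = false := by
    rw [← Bool.not_eq_true, ble_iff]
    omega
  simp only [force_eq, hxeq, hbit, hble, hc1, hc2, orB_eq, Bool.false_or] at this
  exact final_sound hN hus hE this

theorem last_sound {N Q : ℕ} {us X : List ℕ} {R : Multiset ℕ} {B : ℕ} (hN : 0 < N)
    (hus : ∀ k ∈ us, Nat.Coprime k N) (hX : X.length = 3) (hc : Cfg N Q X R) (hR : R.card = 2)
    (hB : ∀ y ∈ R, B.testBit y = true) (h : last N us X B = true) : Good N (↑X + R) := by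
  obtain ⟨a, b, rfl⟩ := Multiset.card_eq_two.1 hR
  rcases lt_trichotomy a b with hab | rfl | hab
  · exact last_aux hN hus hX hc hab hB h
  · exfalso
    have := hc.1.nodup_Dv
    rw [Multiset.map_add] at this
    have := (Multiset.nodup_add.1 this).2.1
    simp at this
  · rw [Multiset.pair_comm] at hc hB ⊢
    exact last_aux hN hus hX hc hab hB h

theorem solve_sound {N Q C al : ℕ} {ks : List (ℕ × List ℕ)} {us : List ℕ} (hN : 1 < N)
    (hal : al = allowed N Q) (hks : ∀ kt ∈ ks, Nat.Coprime kt.1 N ∧ kt.2 = tabs N kt.1)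
    (hus : ∀ k ∈ us, Nat.Coprime k N) (r : ℕ) (X : List ℕ) (R : Multiset ℕ)
    (hR : R.card = r + 2) (hX : X.length + r = 3) (hc : Cfg N Q X R)
    (h : solve N C al ks us r X = true) : Good N (↑X + R) := by
  induction r generalizing X R with
  | zero =>
    change force (cands N 1 al ks X) (fun B => last N us X B) = true at h
    rw [force_eq] at h
    exact last_sound (by omega) hus (by omega) hc hR
      (fun y hy => hc.testBit_cands (by omega) hy (by omega) (by omega) hal hks) h
  | succ r ih =>
    change force (cands N (Nat.add r 2) al ks X) (fun B =>
      forceL (hsOf N (Nat.div N (Nat.gcd C (gcdL N X)))) fun hs =>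
      expand N (Nat.add r 3) ks hs X (fun e => solve N C al ks us r (e :: X)) B) = true at h
    rw [force_eq, forceL_eq] at h
    have hd : Nat.gcd C (gcdL N X) ∣ N := (Nat.gcd_dvd_right _ _).trans (gcdL_dvd N X).1
    obtain ⟨g, hg, hfix, e, R', hR', hc', hgo⟩ := expand_sound (M := N / Nat.gcd C (gcdL N X)) hN hc
      (Nat.div_dvd_of_dvd hd) (fun x hx => by
        have : Nat.gcd C (gcdL N X) ∣ x := (Nat.gcd_dvd_right _ _).trans ((gcdL_dvd N X).2 x hx)
        obtain ⟨c, rfl⟩ := this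
        rw [mul_right_comm, Nat.mul_div_cancel' hd]
        exact Dvd.intro _ rfl) hR (by omega)
      (fun R' hc' hR' e he => hc'.testBit_cands (by omega) he hR' (by omega) hal hks) h
    have hcard : R'.card = r + 2 := by
      have := congrArg Multiset.card hR'
      rw [Multiset.card_map, Multiset.card_cons] at this
      omega
    have hadd : (X : Multiset ℕ) + e ::ₘ R' = ↑(e :: X) + R' := by
      rw [Multiset.add_cons, ← Multiset.cons_coe, Multiset.cons_add]
    have hG : Good N (↑(e :: X) + R') := by
      refine ih (e :: X) R' hcard (by rw [List.length_cons]; omega) ⟨hadd ▸ hc'.1, ?_, ?_⟩ hgo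
      · intro y hy
        rcases List.mem_cons.1 hy with rfl | hy
        · exact (hc'.2.2 y (by simp)).1
        · exact hc'.2.1 y hy
      · exact fun y hy => hc'.2.2 y (by simp [hy])
    refine Good.of_map hg ?_
    rwa [Multiset.map_add, Multiset.map_congr (s := X) (f := fun x => g * x % N) (g := id) rfl hfix,
      Multiset.map_id, hR', hadd]

theorem search_sound {N Q C r kp up : ℕ} {Xs : List (List ℕ)} (hN : 1 < N)
    (h : search N Q C r kp up Xs = true) {X : List ℕ} (hXs : X ∈ Xs) {R : Multiset ℕ}
    (hR : R.card = r + 2) (hX : X.length + r = 3) (hc : Cfg N Q X R) : Good N (↑X + R) := by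
  unfold search at h
  rw [forceL_eq, mkTabs_eq, force_eq, allX_iff] at h
  have hu : ∀ k ∈ takeL up (units N), Nat.Coprime k N :=
    fun k hk => mem_units N k (takeL_subset _ _ k hk)
  refine solve_sound hN rfl ?_ hu r X R hR hX hc (h X hXs)
  intro kt hkt
  obtain ⟨k, hk, rfl⟩ := List.mem_map.1 hkt
  exact ⟨hu k (takeL_subset _ _ k hk), rfl⟩

/-- number of entries of `k • S` whose sextant lies in the mask `m` -/
def cnt (N m k : ℕ) (S : Multiset ℕ) : ℕ := (S.map fun z => bit m (rg N (k * z))).sum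

/-- the number of points of a `q`-division in the mask -/
def col (m q r : ℕ) : ℕ := ∑ t ∈ Finset.range q, bit m ((r + 6 * t) / q)

theorem sum_range_affine {q u v : ℕ} (hq : 0 < q) (hu : Nat.Coprime u q) (G : ℕ → ℕ)
    (hG : ∀ a b, a % q = b % q → G a = G b) :
    ∑ i ∈ Finset.range q, G (v + u * i) = ∑ i ∈ Finset.range q, G i := by
  have hinj : Set.InjOn (fun i => (v + u * i) % q) (Finset.range q : Set ℕ) := by
    intro a ha b hb hab
    have ha : a < q := by simpa using ha
    have hb : b < q := by simpa using hb
    have h1 : u * a ≡ u * b [MOD q] := Nat.ModEq.add_left_cancel' v hab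
    have h2 : a ≡ b [MOD q] :=
      Nat.ModEq.cancel_left_of_coprime (by rw [Nat.gcd_comm]; exact hu) h1
    rwa [Nat.ModEq, Nat.mod_eq_of_lt ha, Nat.mod_eq_of_lt hb] at h2
  have himg : (Finset.range q).image (fun i => (v + u * i) % q) = Finset.range q := by
    refine Finset.eq_of_subset_of_card_le ?_ (Finset.card_image_of_injOn hinj).ge
    intro a ha
    obtain ⟨b, hb, rfl⟩ := Finset.mem_image.1 ha
    exact Finset.mem_range.2 (Nat.mod_lt _ hq)
  conv_rhs => rw [← himg, Finset.sum_image hinj]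
  exact Finset.sum_congr rfl fun a _ => hG _ _ (Nat.mod_mod _ _).symm

theorem sum_range_mul_periodic {q : ℕ} (g : ℕ) (G : ℕ → ℕ)
    (hG : ∀ a b, a % q = b % q → G a = G b) :
    ∑ i ∈ Finset.range (g * q), G i = g * ∑ i ∈ Finset.range q, G i := by
  induction g with
  | zero => simp
  | succ g ih =>
    rw [add_mul, one_mul, Finset.sum_range_add, ih, add_mul, one_mul]
    refine congrArg _ (Finset.sum_congr rfl fun i _ => hG _ _ ?_)
    rw [mul_comm, Nat.mul_add_mod]

/-- sextant counts along an arithmetic progression that divides the circle evenly -/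
theorem sum_rg_progression {b q m a : ℕ} (hb : 0 < b) (hq : 0 < q) :
    ∑ i ∈ Finset.range q, bit m (rg (b * q) (a + b * i)) = col m q (rg (b * q) (q * a)) := by
  have h1 : ∀ i, a + b * i = a % b + b * (a / b + 1 * i) := by
    intro i
    rw [one_mul, mul_add, ← add_assoc, Nat.mod_add_div]
  simp_rw [h1]
  rw [sum_range_affine hq (Nat.coprime_one_left q) (fun i => bit m (rg (b * q) (a % b + b * i)))]
  · have hr : rg (b * q) (q * a) = 6 * (a % b) / b := by
      change 6 * (q * a % (b * q)) / (b * q) = _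
      rw [mul_comm b q, Nat.mul_mod_mul_left, mul_left_comm, Nat.mul_div_mul_left _ _ hq]
    rw [hr]
    refine Finset.sum_congr rfl fun i hi => ?_
    have hi := Finset.mem_range.1 hi
    have hlt : a % b + b * i < b * q := by
      have := Nat.mod_lt a hb
      calc a % b + b * i < b + b * i := by omega
        _ = b * (i + 1) := by ring
        _ ≤ b * q := Nat.mul_le_mul_left _ hi
    change bit m (6 * ((a % b + b * i) % (b * q)) / (b * q)) = _
    rw [Nat.mod_eq_of_lt hlt, ← Nat.div_div_eq_div_mul, mul_add, mul_left_comm,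
      Nat.add_mul_div_left _ _ hb]
  · intro x y hxy
    rw [rg_congr]
    have : x ≡ y [MOD q] := hxy
    exact (this.mul_left' b).add_left _

theorem sum_coset {q n m k g e' q' : ℕ} (hn : 0 < n) (hg : 0 < g) (hq' : 0 < q')
    (hq : q = g * q') (hc : Nat.Coprime e' q') :
    ∑ j ∈ Finset.range q, bit m (rg (q * n) ((k + j * n) * (g * e'))) =
      g * col m q' (rg (q * n) (q' * (k * (g * e')))) := by
  have hN : q * n = (n * g) * q' := by rw [hq]; ring
  rw [hN]
  have h1 : ∀ j, (k + j * n) * (g * e') = k * (g * e') + (n * g) * (e' * j) := by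
    intro j; ring
  simp_rw [h1]
  rw [hq, sum_range_mul_periodic (q := q') g
    (fun j => bit m (rg (n * g * q') (k * (g * e') + n * g * (e' * j))))]
  · congr 1
    rw [← sum_rg_progression (Nat.mul_pos hn hg) hq']
    have := sum_range_affine (v := 0) hq' hc
      (fun j => bit m (rg (n * g * q') (k * (g * e') + n * g * j))) ?_
    · simpa using this
    · intro x y hxy
      rw [rg_congr]
      have : x ≡ y [MOD q'] := hxy
      exact (this.mul_left' (n * g)).add_left _
  · intro x y hxy
    rw [rg_congr]
    have : x ≡ y [MOD q'] := hxy
    exact ((this.mul_left e').mul_left' (n * g)).add_left _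

theorem sum_coset_of_coprime {q n m k e : ℕ} (hn : 0 < n) (hq : 0 < q) (hc : Nat.Coprime e q) :
    ∑ j ∈ Finset.range q, bit m (rg (q * n) ((k + j * n) * e)) =
      col m q (rg (q * n) (q * k * e)) := by
  have := sum_coset (m := m) (k := k) hn one_pos hq (one_mul q).symm hc
  simpa [mul_assoc] using this

theorem coset_of_dvd {q n k e : ℕ} (j : ℕ) (he : q ∣ e) :
    rg (q * n) ((k + j * n) * e) = rg (q * n) (k * e) := by
  obtain ⟨c, rfl⟩ := he
  apply rg_congr
  rw [show (k + j * n) * (q * c) = k * (q * c) + q * n * (j * c) by ring, Nat.add_mul_mod_self_left]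

theorem card_filter_div_lt {q r d : ℕ} (hr : r < 6) (hd : d ≤ 6) (hq : 0 < q) :
    ∑ t ∈ Finset.range q, (if (r + 6 * t) / q < d then 1 else 0) = (d * q + 5 - r) / 6 := by
  rw [← Finset.sum_filter, Finset.sum_const, smul_eq_mul, mul_one]
  have h6 : d * q ≤ 6 * q := Nat.mul_le_mul_right q hd
  have : (Finset.range q).filter (fun t => (r + 6 * t) / q < d) =
      Finset.range ((d * q + 5 - r) / 6) := by
    ext t
    rw [Finset.mem_filter, Finset.mem_range, Finset.mem_range, Nat.div_lt_iff_lt_mul hq]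
    omega
  rw [this, Finset.card_range]

theorem col_combination {m q r : ℕ} (f g : ℕ → ℕ) (h : ∀ x < 6, bit m x + f x = g x)
    (hr : r < 6) (hq : 0 < q) :
    col m q r + ∑ t ∈ Finset.range q, f ((r + 6 * t) / q) =
      ∑ t ∈ Finset.range q, g ((r + 6 * t) / q) := by
  unfold col
  rw [← Finset.sum_add_distrib]
  refine Finset.sum_congr rfl fun t ht => h _ ?_
  have := Finset.mem_range.1 ht
  rw [Nat.div_lt_iff_lt_mul hq]
  omega

theorem col_L {q r : ℕ} (hr : r < 6) (hq : 0 < q) :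
    col 12 q r + (2 * q + 5 - r) / 6 = (4 * q + 5 - r) / 6 := by
  have := col_combination (m := 12) (fun x => if x < 2 then 1 else 0)
    (fun x => if x < 4 then 1 else 0) (by decide) hr hq
  rwa [card_filter_div_lt hr (by norm_num) hq, card_filter_div_lt hr (by norm_num) hq] at this

theorem col_H {q r : ℕ} (hr : r < 6) (hq : 0 < q) :
    col 14 q r + (1 * q + 5 - r) / 6 = (4 * q + 5 - r) / 6 := by
  have := col_combination (m := 14) (fun x => if x < 1 then 1 else 0)
    (fun x => if x < 4 then 1 else 0) (by decide) hr hq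
  rwa [card_filter_div_lt hr (by norm_num) hq, card_filter_div_lt hr (by norm_num) hq] at this

theorem col_V {q r : ℕ} (hr : r < 6) (hq : 0 < q) :
    col 11 q r + (3 * q + 5 - r) / 6 = (2 * q + 5 - r) / 6 + (4 * q + 5 - r) / 6 := by
  have := col_combination (m := 11) (fun x => if x < 3 then 1 else 0)
    (fun x => (if x < 2 then 1 else 0) + if x < 4 then 1 else 0) (by decide) hr hq
  rwa [Finset.sum_add_distrib, card_filter_div_lt hr (by norm_num) hq,
    card_filter_div_lt hr (by norm_num) hq, card_filter_div_lt hr (by norm_num) hq] at this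

theorem cnt_zero (N m k : ℕ) : cnt N m k 0 = 0 := rfl

theorem cnt_cons (N m k e : ℕ) (S : Multiset ℕ) :
    cnt N m k (e ::ₘ S) = bit m (rg N (k * e)) + cnt N m k S := by
  simp [cnt]

theorem cnt_add (N m k : ℕ) (S T : Multiset ℕ) :
    cnt N m k (S + T) = cnt N m k S + cnt N m k T := by
  simp [cnt]

theorem bit_le_one (m i : ℕ) : bit m i ≤ 1 := Nat.lt_succ_iff.1 (Nat.mod_lt _ (by norm_num))

theorem cnt_le (N m k : ℕ) (S : Multiset ℕ) : cnt N m k S ≤ S.card := by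
  induction S using Multiset.induction with
  | empty => simp [cnt]
  | cons a S ih =>
    rw [cnt_cons, Multiset.card_cons]
    have := bit_le_one m (rg N (k * a))
    omega

theorem cnt_congr {N m k k' : ℕ} {S : Multiset ℕ} (h : ∀ e ∈ S, k * e % N = k' * e % N) :
    cnt N m k S = cnt N m k' S := by
  unfold cnt
  exact congrArg _ (Multiset.map_congr rfl fun e he => by rw [rg_congr (h e he)])

theorem sum_coset_fixed {q n m k : ℕ} {F : Multiset ℕ} (hF : ∀ e ∈ F, q ∣ e) (s : Finset ℕ) :
    ∑ j ∈ s, cnt (q * n) m (k + j * n) F = s.card * cnt (q * n) m k F := by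
  have : ∀ j ∈ s, cnt (q * n) m (k + j * n) F = cnt (q * n) m k F := by
    intro j _
    unfold cnt
    exact congrArg _ (Multiset.map_congr rfl fun e he => by rw [coset_of_dvd j (hF e he)])
  rw [Finset.sum_congr rfl this, Finset.sum_const, smul_eq_mul]

theorem sum_coset_cnt {q n m k : ℕ} (M : Multiset ℕ) :
    ∑ j ∈ Finset.range q, cnt (q * n) m (k + j * n) M =
      (M.map fun e => ∑ j ∈ Finset.range q, bit m (rg (q * n) ((k + j * n) * e))).sum := by
  induction M using Multiset.induction with
  | empty => simp [cnt]
  | cons a M ih =>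
    simp_rw [cnt_cons]
    rw [Finset.sum_add_distrib, ih, Multiset.map_cons, Multiset.sum_cons]

theorem col_L_one {p r : ℕ} (hp : p % 6 = 1) (hr : r < 6) : col 12 p r = p / 3 + bit 12 r := by
  have := col_L hr (q := p) (by omega)
  have hb : bit 12 r = if r = 2 ∨ r = 3 then 1 else 0 := by interval_cases r <;> rfl
  rw [hb]
  interval_cases r <;> simp <;> omega

theorem col_L_five {p r : ℕ} (hp : p % 6 = 5) (hr : r < 6) :
    col 12 p r + bit 12 r = p / 3 + 1 := by
  have := col_L hr (q := p) (by omega)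
  have hb : bit 12 r = if r = 2 ∨ r = 3 then 1 else 0 := by interval_cases r <;> rfl
  rw [hb]
  interval_cases r <;> simp <;> omega

theorem sum_movers_one {p n k : ℕ} {M : Multiset ℕ} (hn : 0 < n) (hp : p % 6 = 1)
    (hM : ∀ e ∈ M, Nat.Coprime e p) :
    ∑ j ∈ Finset.range p, cnt (p * n) 12 (k + j * n) M =
      M.card * (p / 3) + cnt (p * n) 12 (p * k) M := by
  rw [sum_coset_cnt]
  induction M using Multiset.induction with
  | empty => simp [cnt]
  | cons a M ih =>
    rw [Multiset.map_cons, Multiset.sum_cons, ih fun e he => hM e (by simp [he]), cnt_cons,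
      sum_coset_of_coprime hn (by omega) (hM a (by simp)),
      col_L_one hp (rg_lt _ _ (Nat.mul_pos (by omega) hn)), Multiset.card_cons]
    ring

theorem sum_movers_five {p n k : ℕ} {M : Multiset ℕ} (hn : 0 < n) (hp : p % 6 = 5)
    (hM : ∀ e ∈ M, Nat.Coprime e p) :
    (∑ j ∈ Finset.range p, cnt (p * n) 12 (k + j * n) M) + cnt (p * n) 12 (p * k) M =
      M.card * (p / 3 + 1) := by
  rw [sum_coset_cnt]
  induction M using Multiset.induction with
  | empty => simp [cnt]
  | cons a M ih =>
    have h1 := ih fun e he => hM e (by simp [he])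
    have h2 := col_L_five hp (rg_lt (p * n) (p * k * a) (Nat.mul_pos (by omega) hn))
    rw [Multiset.map_cons, Multiset.sum_cons, cnt_cons,
      sum_coset_of_coprime hn (by omega) (hM a (by simp)), Multiset.card_cons, add_mul, ← h1, one_mul,
      ← h2]
    ring

/-- the number of big-real-part conjugates is constant -/
def LSum (N : ℕ) (S : Multiset ℕ) (T : ℕ) : Prop := ∀ k, Nat.Coprime k N → cnt N 12 k S = T

theorem coprime_add_mul {q n k : ℕ} (j : ℕ) (h : ∀ p, p.Prime → p ∣ q → p ∣ n)
    (hk : Nat.Coprime k (q * n)) : Nat.Coprime (k + j * n) (q * n) := by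
  refine Nat.Coprime.symm (Nat.coprime_of_dvd fun p hp hd hd' => ?_)
  have hpn : p ∣ n := by
    rcases (hp.dvd_mul).1 hd with h1 | h1
    · exact h p hp h1
    · exact h1
  have : p ∣ k := (Nat.dvd_add_left (hpn.mul_left j)).1 hd'
  exact hp.one_lt.ne' (Nat.eq_one_of_dvd_coprimes hk this (hpn.mul_left q))

theorem LSum.ramified_sum {q n k T : ℕ} {S : Multiset ℕ}
    (h : ∀ p, p.Prime → p ∣ q → p ∣ n) (hS : LSum (q * n) S T) (hk : Nat.Coprime k (q * n)) :
    ∑ j ∈ Finset.range q, cnt (q * n) 12 (k + j * n) S = q * T := by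
  rw [Finset.sum_congr rfl fun j _ => hS _ (coprime_add_mul j h hk)]
  simp

theorem coprime_add_mul_tame {p n k j : ℕ} (hp : p.Prime) (hpn : ¬ p ∣ n) (hpk : p ∣ k)
    (hk : Nat.Coprime k n) (hj0 : 0 < j) (hj : j < p) : Nat.Coprime (k + j * n) (p * n) := by
  refine Nat.Coprime.mul_right ?_ ?_
  · refine Nat.Coprime.symm ((Nat.Prime.coprime_iff_not_dvd hp).2 fun hd => ?_)
    have := (Nat.dvd_add_right hpk).1 hd
    rcases hp.dvd_mul.1 this with h1 | h1
    · exact absurd (Nat.le_of_dvd hj0 h1) (by omega)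
    · exact hpn h1
  · simpa using hk

theorem LSum.tame_sum {p n k T : ℕ} {S : Multiset ℕ} (hp : p.Prime) (hpn : ¬ p ∣ n)
    (hS : LSum (p * n) S T) (hpk : p ∣ k) (hk : Nat.Coprime k n) :
    ∑ j ∈ Finset.range p, cnt (p * n) 12 (k + j * n) S = (p - 1) * T + cnt (p * n) 12 k S := by
  obtain ⟨p', rfl⟩ : ∃ p', p = p' + 1 := ⟨p - 1, by have := hp.pos; omega⟩
  rw [Finset.sum_range_succ', Finset.sum_congr rfl fun j hj => hS _ (coprime_add_mul_tame hp hpn hpk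
    hk (Nat.succ_pos j) (by have := Finset.mem_range.1 hj; omega))]
  simp

theorem exists_coprime_add_mul {n N x : ℕ} (hN : 0 < N) (hx : Nat.Coprime x n) :
    ∃ k, Nat.Coprime (x + k * n) N := by
  let ps : Finset ℕ := {p ∈ N.primeFactors | ¬p ∣ x}
  refine ⟨ps.prod id, Nat.coprime_of_dvd fun p pp hp hpn => ?_⟩
  by_cases hpx : p ∣ x
  · have h := (Nat.dvd_add_right hpx).1 hp
    rcases pp.dvd_mul.mp h with h | h
    · obtain ⟨q, hq, hq'⟩ := (pp.prime.dvd_finsetProd_iff id).mp h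
      rw [Finset.mem_filter, Nat.mem_primeFactors,
        ← (Nat.prime_dvd_prime_iff_eq pp hq.1.1).mp hq'] at hq
      exact hq.2 hpx
    · exact Nat.Prime.not_coprime_iff_dvd.mpr ⟨p, pp, hpx, h⟩ hx
  · have pps : p ∈ ps := Finset.mem_filter.mpr ⟨Nat.mem_primeFactors.mpr ⟨pp, hpn, hN.ne'⟩, hpx⟩
    exact hpx ((Nat.dvd_add_left ((Finset.dvd_prod_of_mem id pps).mul_right n)).1 hp)

theorem exists_mul_mod_one {m a : ℕ} (hm : 0 < m) (ha : Nat.Coprime a m) :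
    ∃ w, Nat.Coprime w m ∧ w * a % m = 1 % m := by
  obtain ⟨w, -, hw⟩ := Nat.exists_mul_mod_eq_of_coprime 1 ha hm.ne'
  refine ⟨w, ?_, by rw [mul_comm]; exact hw⟩
  have : Nat.Coprime (a * w) m := by
    rw [Nat.Coprime, Nat.ModEq.gcd_eq (show a * w ≡ 1 [MOD m] from hw), Nat.gcd_one_left]
  exact Nat.Coprime.coprime_mul_left this

/-- every exponent is, up to Galois conjugation, a divisor of `N` -/
theorem exists_order {N : ℕ} (hN : 0 < N) (e : ℕ) : ∃ g m e', N = g * m ∧ e = g * e' ∧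
    Nat.Coprime e' m ∧ 0 < g ∧ 0 < m ∧
    ∀ k, Nat.Coprime k m → ∃ k', Nat.Coprime k' N ∧ k' * e % N = g * k % N := by
  have hg : 0 < Nat.gcd e N := Nat.gcd_pos_of_pos_right _ hN
  obtain ⟨e', m, hc, he, hm⟩ := Nat.exists_coprime e N
  have hm0 : 0 < m := by
    rcases Nat.eq_zero_or_pos m with rfl | h
    · simp at hm; omega
    · exact h
  refine ⟨Nat.gcd e N, m, e', by rw [mul_comm]; exact hm, by rw [mul_comm]; exact he, hc, hg, hm0,
    fun k hk => ?_⟩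
  obtain ⟨w, hw, hwe⟩ := exists_mul_mod_one hm0 hc
  obtain ⟨j, hj⟩ := exists_coprime_add_mul hN (Nat.Coprime.mul_left hk hw)
  refine ⟨_, hj, ?_⟩
  generalize Nat.gcd e N = g at *
  subst he hm
  have : (k * w + j * m) * e' ≡ k [MOD m] := by
    have h1 : w * e' ≡ 1 [MOD m] := hwe
    calc (k * w + j * m) * e' = k * (w * e') + m * (j * e') := by ring
      _ ≡ k * 1 + 0 [MOD m] := (h1.mul_left k).add (Nat.modEq_zero_iff_dvd.2 ⟨_, rfl⟩)
      _ = k := by ring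
  have := this.mul_left' g
  rw [mul_comm m g]
  rw [show (k * w + j * m) * (e' * g) = g * ((k * w + j * m) * e') by ring]
  exact this

theorem rg_scale {g : ℕ} (hg : 0 < g) (m z : ℕ) : rg (g * m) (g * z) = rg m z := by
  change 6 * (g * z % (g * m)) / (g * m) = 6 * (z % m) / m
  rw [Nat.mul_mod_mul_left, mul_left_comm, Nat.mul_div_mul_left _ _ hg]

theorem Dv_scale {s : ℕ} (hs : 0 < s) (N z : ℕ) : Dv (s * N) (s * z) = s * Dv N z := by
  rw [Dv_eq, Dv_eq, show 4 * (s * z) = s * (4 * z) by ring, show 3 * (s * N) = s * (3 * N) by ring,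
    show 5 * (s * N) = s * (5 * N) by ring]
  simp only [Nat.mul_lt_mul_left hs, Nat.mul_le_mul_left_iff hs]
  split_ifs <;> rw [Nat.mul_sub]

theorem isL_scale {s : ℕ} (hs : 0 < s) (N z : ℕ) : isL (s * N) (s * z) = true ↔ isL N z = true := by
  rw [isL_iff, isL_iff, show 3 * (s * z) = s * (3 * z) by ring,
    show 2 * (s * N) = s * (2 * N) by ring]
  simp only [Nat.mul_lt_mul_left hs]

theorem pat_scale {s : ℕ} (hs : 0 < s) (N : ℕ) (Z : Multiset ℕ) :
    Pat (s * N) (Z.map (s * ·)) ↔ Pat N Z := by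
  have hinj : Function.Injective (s * ·) := fun a b h => Nat.eq_of_mul_eq_mul_left hs h
  unfold Pat
  refine and_congr ?_ ?_
  · rw [Multiset.map_map]
    have : (fun z => Dv (s * N) (z % (s * N))) ∘ (s * ·) = (s * ·) ∘ fun z => Dv N (z % N) := by
      funext z
      simp [Nat.mul_mod_mul_left, Dv_scale hs]
    rw [this, ← Multiset.map_map, Multiset.nodup_map_iff_of_injective hinj]
  · rw [Multiset.forall_mem_map_iff]
    refine forall₂_congr fun z _ => ?_
    rw [Multiset.countP_map, ← Multiset.countP_eq_card_filter]
    simp only [Nat.mul_mod_mul_left, Dv_scale hs, Nat.mul_lt_mul_left hs, isL_scale hs]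
    refine and_congr (not_congr ?_) (and_congr (not_congr ?_) Iff.rfl)
    · rw [mul_left_comm]; exact hinj.eq_iff
    · rw [mul_left_comm, mul_left_comm 2]; exact hinj.eq_iff

theorem valid_scale {s N : ℕ} (hs : 0 < s) (hN : 0 < N) (E : Multiset ℕ) :
    Valid (s * N) (E.map (s * ·)) ↔ Valid N E := by
  unfold Valid
  have hsum : (E.map (s * ·)).sum = s * E.sum := by
    simpa using Multiset.sum_map_mul_left (s := E) (a := s) (f := id)
  have hmap : ∀ k, (E.map (s * ·)).map (k * ·) = (E.map (k * ·)).map (s * ·) := by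
    intro k
    rw [Multiset.map_map, Multiset.map_map]
    exact Multiset.map_congr rfl fun x _ => by simp [mul_left_comm]
  refine and_congr (by simp) (and_congr (by rw [hsum]; exact Nat.mul_dvd_mul_iff_left hs) ?_)
  simp_rw [hmap, pat_scale hs]
  constructor
  · intro h k hk
    obtain ⟨j, hj⟩ := exists_coprime_add_mul (Nat.mul_pos hs hN) hk
    refine (pat_map_congr fun x _ => ?_).1 (h _ hj)
    rw [show (k + j * N) * x = k * x + N * (j * x) by ring, Nat.add_mul_mod_self_left]
  · exact fun h k hk => h k (Nat.Coprime.coprime_mul_left_right hk)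

theorem good_scale {s N : ℕ} (hs : 0 < s) (E : Multiset ℕ) :
    Good (s * N) (E.map (s * ·)) ↔ Good N E := by
  unfold Good
  simp only [Multiset.forall_mem_map_iff]
  refine exists_congr fun t => and_congr_right fun _ => forall₂_congr fun x _ =>
    forall₂_congr fun y _ => ?_
  rw [mul_left_comm, mul_left_comm t, Nat.mul_mod_mul_left, Nat.mul_mod_mul_left]
  exact ⟨fun h => Nat.eq_of_mul_eq_mul_left hs h, fun h => by rw [h]⟩

theorem cnt_scale {s : ℕ} (hs : 0 < s) (N m k : ℕ) (S : Multiset ℕ) :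
    cnt (s * N) m k (S.map (s * ·)) = cnt N m k S := by
  unfold cnt
  rw [Multiset.map_map]
  exact congrArg _ (Multiset.map_congr rfl fun x _ => by
    simp only [Function.comp]; rw [mul_left_comm, rg_scale hs])

theorem lsum_scale {s N T : ℕ} (hs : 0 < s) (hN : 0 < N) (S : Multiset ℕ) :
    LSum (s * N) (S.map (s * ·)) T ↔ LSum N S T := by
  unfold LSum
  simp_rw [cnt_scale hs]
  constructor
  · intro h k hk
    obtain ⟨j, hj⟩ := exists_coprime_add_mul (Nat.mul_pos hs hN) hk
    rw [← h _ hj]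
    refine cnt_congr fun x _ => ?_
    rw [show (k + j * N) * x = k * x + N * (j * x) by ring, Nat.add_mul_mod_self_left]
  · exact fun h k hk => h k (Nat.Coprime.coprime_mul_left_right hk)

/-- an exponent none of whose conjugates has big real part -/
theorem order_of_never {N e : ℕ} (hN : 0 < N)
    (h : ∀ k, Nat.Coprime k N → bit 12 (rg N (k * e)) = 0) :
    4 * e % N = 0 ∨ 6 * e % N = 0 ∨ 10 * e % N = 0 := by
  obtain ⟨g, m, e', rfl, rfl, -, hg, hm, hk⟩ := exists_order hN e
  have h1 : ∀ k, Nat.Coprime k m → bit 12 (rg m k) = 0 := by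
    intro k hkm
    obtain ⟨k', h2, h3⟩ := hk k hkm
    rw [← rg_scale hg m k, ← rg_congr h3]
    exact h _ h2
  have h2 : ∀ u, 3 * u ≥ m → 2 * u < m → ¬ Nat.Coprime u m := by
    intro u h3 h4 h5
    have h6 := h1 u h5
    have : rg m u = 2 := by
      change 6 * (u % m) / m = 2
      rw [Nat.mod_eq_of_lt (by omega)]
      refine (Nat.div_eq_iff hm).2 ⟨by omega, by omega⟩
    rw [this] at h6
    exact absurd h6 (by decide)
  have odd_add : ∀ u j, Odd u → ¬ Nat.Coprime u (2 * u + 2 ^ j) → False := by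
    intro u j hu h
    refine h ?_
    rw [Nat.coprime_mul_right_add_right]
    exact Nat.Coprime.pow_right _ hu.coprime_two_right
  have key : m ∣ 4 ∨ m ∣ 6 ∨ m ∣ 10 := by
    by_contra hne
    have hne' : m ≠ 1 ∧ m ≠ 2 ∧ m ≠ 4 ∧ m ≠ 6 ∧ m ≠ 10 := by
      refine ⟨?_, ?_, ?_, ?_, ?_⟩ <;> rintro rfl <;> revert hne <;> decide
    rcases Nat.even_or_odd' m with ⟨c, rfl | rfl⟩
    · rcases Nat.even_or_odd' c with ⟨d, rfl | rfl⟩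
      · refine odd_add (2 * d - 1) 1 ⟨d - 1, by omega⟩ ?_
        rw [show 2 * (2 * d - 1) + 2 ^ 1 = 2 * (2 * d) by omega]
        exact h2 _ (by omega) (by omega)
      · refine odd_add (2 * d - 1) 2 ⟨d - 1, by omega⟩ ?_
        rw [show 2 * (2 * d - 1) + 2 ^ 2 = 2 * (2 * d + 1) by omega]
        exact h2 _ (by omega) (by omega)
    · refine h2 c (by omega) (by omega) ?_
      rw [Nat.coprime_mul_right_add_right]
      exact Nat.coprime_one_right c
  have fin : ∀ x, m ∣ x → x * (g * e') % (g * m) = 0 := by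
    rintro x ⟨c, rfl⟩
    rw [show m * c * (g * e') = g * m * (c * e') by ring]
    exact Nat.mul_mod_right _ _
  exact key.imp (fin 4) (Or.imp (fin 6) (fin 10))

theorem order_of_always {N e : ℕ} (hN : 0 < N)
    (h : ∀ k, Nat.Coprime k N → bit 12 (rg N (k * e)) = 1) :
    2 * e % N = 0 ∧ e % N ≠ 0 := by
  obtain ⟨g, m, e', rfl, rfl, hc, hg, hm, hk⟩ := exists_order hN e
  have h1 : ∀ k, Nat.Coprime k m → bit 12 (rg m k) = 1 := by
    intro k hkm
    obtain ⟨k', h2, h3⟩ := hk k hkm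
    rw [← rg_scale hg m k, ← rg_congr h3]
    exact h _ h2
  have hm2 : m = 2 := by
    by_contra hne
    rcases Nat.lt_or_ge m 4 with h4 | h4
    · interval_cases m
      · exact absurd (h1 1 (by decide)) (by decide)
      · exact hne rfl
      · exact absurd (h1 2 (by decide)) (by decide)
    · have h6 := h1 1 (Nat.coprime_one_left m)
      have : rg m 1 < 2 := by
        change 6 * (1 % m) / m < 2
        rw [Nat.mod_eq_of_lt (by omega), Nat.div_lt_iff_lt_mul hm]
        omega
      interval_cases rg m 1 <;> exact absurd h6 (by decide)
  subst hm2
  have : e' % 2 = 1 := Nat.odd_iff.1 ((Nat.coprime_two_right).1 hc)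
  rw [show 2 * (g * e') = g * (2 * e') by ring, Nat.mul_mod_mul_left, Nat.mul_mod_mul_left, this]
  simp; omega

/-- a decomposition into exponents divisible by `q` and exponents coprime to `q` -/
structure Split (q : ℕ) (S F M : Multiset ℕ) : Prop where
  eq : S = F + M
  fixed : ∀ e ∈ F, q ∣ e
  moved : ∀ e ∈ M, Nat.Coprime e q

theorem split_prime {p : ℕ} (hp : p.Prime) (S : Multiset ℕ) :
    Split p S (S.filter (p ∣ ·)) (S.filter fun e => ¬ p ∣ e) where
  eq := (Multiset.filter_add_not _ _).symm
  fixed e he := (Multiset.mem_filter.1 he).2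
  moved e he := ((hp.coprime_iff_not_dvd).2 (Multiset.mem_filter.1 he).2).symm

theorem prime_dvd_of_dvd_self {p n : ℕ} (hp : p.Prime) (hpn : p ∣ n) :
    ∀ r, r.Prime → r ∣ p → r ∣ n := fun r hr h => by
  rwa [(Nat.prime_dvd_prime_iff_eq hr hp).1 h]

theorem Split.sum {q n m k : ℕ} {S F M : Multiset ℕ} (h : Split q S F M) :
    ∑ j ∈ Finset.range q, cnt (q * n) m (k + j * n) S = q * cnt (q * n) m k F +
      ∑ j ∈ Finset.range q, cnt (q * n) m (k + j * n) M := by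
  rw [h.eq]
  simp_rw [cnt_add]
  rw [Finset.sum_add_distrib, sum_coset_fixed h.fixed, Finset.card_range]

theorem Split.ramified_one {p n k T : ℕ} {S F M : Multiset ℕ} (h : Split p S F M) (hp : p.Prime)
    (h6 : p % 6 = 1) (hpn : p ∣ n) (hn : 0 < n) (hS : LSum (p * n) S T)
    (hk : Nat.Coprime k (p * n)) :
    p * T = p * cnt (p * n) 12 k F + (M.card * (p / 3) + cnt (p * n) 12 (p * k) M) := by
  rw [← hS.ramified_sum (prime_dvd_of_dvd_self hp hpn) hk, h.sum, sum_movers_one hn h6 h.moved]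

theorem Split.ramified_five {p n k T : ℕ} {S F M : Multiset ℕ} (h : Split p S F M) (hp : p.Prime)
    (h6 : p % 6 = 5) (hpn : p ∣ n) (hn : 0 < n) (hS : LSum (p * n) S T)
    (hk : Nat.Coprime k (p * n)) :
    p * T + cnt (p * n) 12 (p * k) M = p * cnt (p * n) 12 k F + M.card * (p / 3 + 1) := by
  rw [← hS.ramified_sum (prime_dvd_of_dvd_self hp hpn) hk, h.sum,
    ← sum_movers_five hn h6 h.moved, add_assoc]

theorem Split.tame_one {p n k T : ℕ} {S F M : Multiset ℕ} (h : Split p S F M) (hp : p.Prime)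
    (h6 : p % 6 = 1) (hpn : ¬ p ∣ n) (hn : 0 < n) (hS : LSum (p * n) S T) (hpk : p ∣ k)
    (hk : Nat.Coprime k n) :
    (p - 1) * T + (cnt (p * n) 12 k F + cnt (p * n) 12 k M) =
      p * cnt (p * n) 12 k F + (M.card * (p / 3) + cnt (p * n) 12 (p * k) M) := by
  rw [← cnt_add, ← h.eq, ← hS.tame_sum hp hpn hpk hk, h.sum, sum_movers_one hn h6 h.moved]

theorem Split.tame_five {p n k T : ℕ} {S F M : Multiset ℕ} (h : Split p S F M) (hp : p.Prime)
    (h6 : p % 6 = 5) (hpn : ¬ p ∣ n) (hn : 0 < n) (hS : LSum (p * n) S T) (hpk : p ∣ k)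
    (hk : Nat.Coprime k n) :
    (p - 1) * T + (cnt (p * n) 12 k F + cnt (p * n) 12 k M) + cnt (p * n) 12 (p * k) M =
      p * cnt (p * n) 12 k F + M.card * (p / 3 + 1) := by
  rw [← cnt_add, ← h.eq, ← hS.tame_sum hp hpn hpk hk, h.sum, ← sum_movers_five hn h6 h.moved,
    add_assoc]

/-- the chain of tame equations for `p % 6 = 1` -/
theorem tame_one_arith {p f μ : ℕ} (h6 : p % 6 = 1) (h7 : 7 ≤ p) (hμ : 1 ≤ μ) (hf : μ + f = 5)
    (F s : ℕ → ℕ) (hF : ∀ i, F i ≤ f) (hs : ∀ i, s i ≤ μ)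
    (h : ∀ i, (p - 1) * 2 + (F i + s i) = p * F i + (μ * (p / 3) + s (i + 1))) :
    (μ = 3 ∧ F 0 = 1) ∨ (p = 7 ∧ μ = 4 ∧ F 0 + F 1 + F 2 = 2) := by
  obtain ⟨m, rfl⟩ : ∃ m, p = 6 * m + 1 := ⟨p / 6, by omega⟩
  have hm : (6 * m + 1) / 3 = 2 * m := by omega
  rw [hm] at h
  have hm1 : 1 ≤ m := by omega
  have a0 := h 0
  have a1 := h 1
  have a2 := h 2
  have b0 := hs 0
  have b1 := hs 1
  have b2 := hs 2
  have b3 := hs 3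
  have c0 := hF 0
  have c1 := hF 1
  have c2 := hF 2
  simp only [Nat.reduceAdd] at a0 a1 a2
  generalize F 0 = x0 at *
  generalize F 1 = x1 at *
  generalize F 2 = x2 at *
  generalize s 0 = y0 at *
  generalize s 1 = y1 at *
  generalize s 2 = y2 at *
  generalize s 3 = y3 at *
  have hf : f = 5 - μ := by omega
  subst hf
  have : μ ≤ 5 := by omega
  clear h hs hF
  interval_cases μ
  · interval_cases x0 <;> omega
  · interval_cases x0 <;> interval_cases x1 <;> omega
  · interval_cases x0 <;> omega
  · interval_cases x0 <;> interval_cases x1 <;> interval_cases x2 <;> omega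
  · interval_cases x0 <;> interval_cases x1 <;> interval_cases x2 <;> omega

theorem tame_five_arith {p f μ x a b : ℕ} (h6 : p % 6 = 5) (h7 : 11 ≤ p) (hμ : 1 ≤ μ)
    (hf : μ + f = 5) (hF : x ≤ f) (ha : a ≤ μ) (hb : b ≤ μ)
    (h : (p - 1) * 2 + (x + a) + b = p * x + μ * (p / 3 + 1)) :
    (μ = 3 ∧ x = 1) ∨ (p = 11 ∧ μ = 5 ∧ a = 0) ∨ (p = 11 ∧ μ = 4 ∧ x = 1) ∨
      (p = 17 ∧ μ = 4 ∧ x = 1 ∧ a = 4) := by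
  obtain ⟨m, rfl⟩ : ∃ m, p = 6 * m + 5 := ⟨p / 6, by omega⟩
  have hm : (6 * m + 5) / 3 = 2 * m + 1 := by omega
  rw [hm] at h
  have hf : f = 5 - μ := by omega
  subst hf
  have : μ ≤ 5 := by omega
  interval_cases μ <;> interval_cases x <;> omega

theorem ramified_one_arith {p f μ x b : ℕ} (h6 : p % 6 = 1) (h7 : 7 ≤ p) (hμ : 1 ≤ μ)
    (hf : μ + f = 5) (hF : x ≤ f) (hb : b ≤ μ)
    (h : p * 2 = p * x + (μ * (p / 3) + b)) :
    (μ = 3 ∧ x = 1) ∨ (p = 7 ∧ μ = 5 ∧ b = 4) := by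
  obtain ⟨m, rfl⟩ : ∃ m, p = 6 * m + 1 := ⟨p / 6, by omega⟩
  have hm : (6 * m + 1) / 3 = 2 * m := by omega
  rw [hm] at h
  have hf : f = 5 - μ := by omega
  subst hf
  have : μ ≤ 5 := by omega
  interval_cases μ <;> interval_cases x <;> omega

theorem ramified_five_arith {p f μ x b : ℕ} (h6 : p % 6 = 5) (h7 : 5 ≤ p) (hμ : 1 ≤ μ)
    (hf : μ + f = 5) (hF : x ≤ f) (hb : b ≤ μ)
    (h : p * 2 + b = p * x + μ * (p / 3 + 1)) :
    (μ = 3 ∧ x = 1) ∨ (p = 5 ∧ μ = 5 ∧ b = 0) ∨ (p = 5 ∧ μ = 4 ∧ b = 3) := by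
  obtain ⟨m, rfl⟩ : ∃ m, p = 6 * m + 5 := ⟨p / 6, by omega⟩
  have hm : (6 * m + 5) / 3 = 2 * m + 1 := by omega
  rw [hm] at h
  have hf : f = 5 - μ := by omega
  subst hf
  have : μ ≤ 5 := by omega
  interval_cases μ <;> interval_cases x <;> omega

theorem dvd_of_caps {N a b c d e : ℕ} (h2 : ¬ 2 ^ (a + 1) ∣ N) (h3 : ¬ 3 ^ (b + 1) ∣ N)
    (h5 : ¬ 5 ^ (c + 1) ∣ N) (h7 : ¬ 7 ^ (d + 1) ∣ N) (h11 : ¬ 11 ^ (e + 1) ∣ N)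
    (h : ∀ p, p.Prime → 13 ≤ p → ¬ p ∣ N) : N ∣ 2 ^ a * 3 ^ b * 5 ^ c * 7 ^ d * 11 ^ e := by
  rw [Nat.dvd_iff_prime_pow_dvd_dvd]
  intro p k hp hk
  have cap : ∀ {q a : ℕ}, ¬ q ^ (a + 1) ∣ N → q ^ k ∣ N → q ^ k ∣ q ^ a := fun {q a} h1 h2 =>
    pow_dvd_pow _ (Nat.lt_succ_iff.1 (lt_of_not_ge fun h3 => h1 ((pow_dvd_pow q h3).trans h2)))
  rcases Nat.lt_or_ge p 13 with h13 | h13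
  · interval_cases p <;> first | (exfalso; revert hp; decide) | skip
    · exact ((((cap h2 hk).mul_right _).mul_right _).mul_right _).mul_right _
    · exact ((((cap h3 hk).mul_left _).mul_right _).mul_right _).mul_right _
    · exact (((cap h5 hk).mul_left _).mul_right _).mul_right _
    · exact ((cap h7 hk).mul_left _).mul_right _
    · exact (cap h11 hk).mul_left _
  · rcases Nat.eq_zero_or_pos k with rfl | hk0
    · simp
    · exact absurd ((dvd_pow_self p hk0.ne').trans hk) (h p hp h13)

theorem prime_mod_six {p : ℕ} (hp : p.Prime) (h5 : 5 ≤ p) : p % 6 = 1 ∨ p % 6 = 5 := by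
  have h2 : ¬ 2 ∣ p := fun h => by have := (Nat.prime_dvd_prime_iff_eq Nat.prime_two hp).1 h; omega
  have h3 : ¬ 3 ∣ p := fun h => by
    have := (Nat.prime_dvd_prime_iff_eq Nat.prime_three hp).1 h; omega
  omega

theorem exists_tame {p n k : ℕ} (hp : p.Prime) (hpn : ¬ p ∣ n) (hk : Nat.Coprime k n) :
    ∃ k0, p ∣ k0 ∧ Nat.Coprime k0 n ∧ k0 ≡ k [MOD n] := by
  obtain ⟨k0, h1, h2⟩ := Nat.chineseRemainder ((hp.coprime_iff_not_dvd).2 hpn) 0 k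
  refine ⟨k0, (Nat.modEq_zero_iff_dvd).1 h1, ?_, h2⟩
  rw [Nat.Coprime, h2.gcd_eq]
  exact hk

theorem cnt_fixed_congr {p n m k k' : ℕ} {F : Multiset ℕ} (hF : ∀ e ∈ F, p ∣ e)
    (h : k ≡ k' [MOD n]) : cnt (p * n) m k F = cnt (p * n) m k' F := by
  refine cnt_congr fun e he => ?_
  obtain ⟨c, rfl⟩ := hF e he
  have := (h.mul_right c).mul_left' p
  rwa [show p * (k * c) = k * (p * c) by ring, show p * (k' * c) = k' * (p * c) by ring] at this

theorem sum_movers_three {n k : ℕ} {M : Multiset ℕ} (hn : 0 < n)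
    (hM : ∀ e ∈ M, Nat.Coprime e 3) :
    ∑ j ∈ Finset.range 3, cnt (3 * n) 12 (k + j * n) M = M.card := by
  rw [sum_coset_cnt]
  induction M using Multiset.induction with
  | empty => simp
  | cons a M ih =>
    have h3 : ∀ r < 6, col 12 3 r = 1 := by decide
    rw [Multiset.map_cons, Multiset.sum_cons, ih fun e he => hM e (by simp [he]),
      sum_coset_of_coprime hn (by omega) (hM a (by simp)), h3 _ (rg_lt _ _ (by omega)),
      Multiset.card_cons, add_comm]

theorem Split.ramified_three {n k T : ℕ} {S F M : Multiset ℕ} (h : Split 3 S F M)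
    (hpn : 3 ∣ n) (hn : 0 < n) (hS : LSum (3 * n) S T) (hk : Nat.Coprime k (3 * n)) :
    3 * T = 3 * cnt (3 * n) 12 k F + M.card := by
  rw [← hS.ramified_sum (prime_dvd_of_dvd_self Nat.prime_three hpn) hk, h.sum,
    sum_movers_three hn h.moved]

theorem two_power_sum {s v n m k e : ℕ} (hn : 0 < n) (hv : v < s) (he : e % 2 ^ (v + 1) = 2 ^ v) :
    ∃ r < 6, ∑ j ∈ Finset.range (2 ^ s), bit m (rg (2 ^ s * n) ((k + j * n) * e)) =
      2 ^ v * col m (2 ^ (s - v)) r := by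
  obtain ⟨e', rfl, he'⟩ : ∃ e', e = 2 ^ v * e' ∧ Odd e' := by
    refine ⟨2 * (e / 2 ^ (v + 1)) + 1, ?_, odd_two_mul_add_one _⟩
    conv_lhs => rw [← Nat.div_add_mod e (2 ^ (v + 1)), he]
    ring
  refine ⟨_, rg_lt _ _ (by positivity), sum_coset hn (by positivity) (by positivity) ?_
    (he'.coprime_two_right.pow_right _)⟩
  rw [← pow_add, Nat.add_sub_cancel' hv.le]

theorem two_power_sum_fixed {s n m k e : ℕ} (he : e % 2 ^ s = 0) :
    ∃ b < 2, ∑ j ∈ Finset.range (2 ^ s), bit m (rg (2 ^ s * n) ((k + j * n) * e)) = 2 ^ s * b := by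
  refine ⟨bit m (rg (2 ^ s * n) (k * e)), Nat.mod_lt _ (by norm_num), ?_⟩
  rw [Finset.sum_congr rfl fun j _ => by rw [coset_of_dvd j (Nat.dvd_of_mod_eq_zero he)]]
  simp

/-- a pair with exactly one conjugate of big real part at a time -/
structure Pair (N : ℕ) (S : Multiset ℕ) : Prop where
  card : S.card = 2
  lsum : LSum N S 1

theorem card_split {p : ℕ} (S : Multiset ℕ) :
    (S.filter fun e => ¬ p ∣ e).card + (S.filter (p ∣ ·)).card = S.card := by
  rw [add_comm, ← Multiset.card_add, Multiset.filter_add_not]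

theorem forall_dvd_of_card {p : ℕ} {S : Multiset ℕ}
    (h : ¬ 1 ≤ (S.filter fun e => ¬ p ∣ e).card) : ∀ e ∈ S, p ∣ e := by
  have h0 : (S.filter fun e => ¬ p ∣ e) = 0 := Multiset.card_eq_zero.1 (by omega)
  intro e he
  by_contra hne
  have := (Multiset.mem_filter (p := fun e => ¬ p ∣ e)).2 ⟨he, hne⟩
  rw [h0] at this
  exact absurd this (Multiset.notMem_zero e)

theorem Pair.ramified {p n : ℕ} {S : Multiset ℕ} (hS : Pair (p * n) S) (hn : 0 < n)
    (hp : p.Prime) (h5 : 5 ≤ p) (hpn : p ∣ n) : ∀ e ∈ S, p ∣ e := by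
  apply forall_dvd_of_card
  intro h1
  have hs := split_prime hp S
  have hc := (card_split (p := p) S).trans hS.card
  have hF := cnt_le (p * n) 12 1 (S.filter (p ∣ ·))
  have hM := cnt_le (p * n) 12 (p * 1) (S.filter fun e => ¬ p ∣ e)
  generalize S.filter (p ∣ ·) = F at *
  generalize (S.filter fun e => ¬ p ∣ e) = M at *
  rcases prime_mod_six hp h5 with h6 | h6
  · have h := hs.ramified_one hp h6 hpn hn hS.lsum (Nat.coprime_one_left _)
    generalize cnt (p * n) 12 1 F = x at *
    generalize cnt (p * n) 12 (p * 1) M = y at *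
    generalize M.card = μ at *
    generalize F.card = f at *
    have hf : f = 2 - μ := by omega
    subst hf
    have : μ ≤ 2 := by omega
    interval_cases μ <;> interval_cases x <;> omega
  · have h := hs.ramified_five hp h6 hpn hn hS.lsum (Nat.coprime_one_left _)
    generalize cnt (p * n) 12 1 F = x at *
    generalize cnt (p * n) 12 (p * 1) M = y at *
    generalize M.card = μ at *
    generalize F.card = f at *
    have hf : f = 2 - μ := by omega
    subst hf
    have : μ ≤ 2 := by omega
    interval_cases μ <;> interval_cases x <;> omega

theorem Pair.tame {p n : ℕ} {S : Multiset ℕ} (hS : Pair (p * n) S) (hn : 0 < n)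
    (hp : p.Prime) (h5 : 7 ≤ p) (hpn : ¬ p ∣ n) : ∀ e ∈ S, p ∣ e := by
  apply forall_dvd_of_card
  intro h1
  have hs := split_prime hp S
  have hc := (card_split (p := p) S).trans hS.card
  have hF := (cnt_le (p * n) 12 · (S.filter (p ∣ ·)))
  have hM := (cnt_le (p * n) 12 · (S.filter fun e => ¬ p ∣ e))
  generalize S.filter (p ∣ ·) = F at *
  generalize (S.filter fun e => ¬ p ∣ e) = M at *
  obtain ⟨k, hk1, hk2, -⟩ := exists_tame hp hpn (Nat.coprime_one_left n)
  have hpk : Nat.Coprime (p * k) n := Nat.Coprime.mul_left ((hp.coprime_iff_not_dvd).2 hpn) hk2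
  have hF0 := hF k
  have hF1 := hF (p * k)
  have hM0 := hM k
  have hM1 := hM (p * k)
  have hM2 := hM (p * (p * k))
  clear hF hM
  rcases prime_mod_six hp (by omega) with h6 | h6
  · have h := hs.tame_one hp h6 hpn hn hS.lsum hk1 hk2
    have h' := hs.tame_one hp h6 hpn hn hS.lsum (Dvd.intro _ rfl) hpk
    generalize cnt (p * n) 12 k F = x at *
    generalize cnt (p * n) 12 k M = y at *
    generalize cnt (p * n) 12 (p * k) F = x' at *
    generalize cnt (p * n) 12 (p * k) M = y' at *
    generalize cnt (p * n) 12 (p * (p * k)) M = y'' at *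
    generalize M.card = μ at *
    generalize F.card = f at *
    have hf : f = 2 - μ := by omega
    subst hf
    have : μ ≤ 2 := by omega
    interval_cases μ <;> interval_cases x <;> interval_cases x' <;> omega
  · have h := hs.tame_five hp h6 hpn hn hS.lsum hk1 hk2
    generalize cnt (p * n) 12 k F = x at *
    generalize cnt (p * n) 12 k M = y at *
    generalize cnt (p * n) 12 (p * k) M = y' at *
    generalize M.card = μ at *
    generalize F.card = f at *
    have hf : f = 2 - μ := by omega
    subst hf
    have : μ ≤ 2 := by omega
    interval_cases μ <;> interval_cases x <;> omega

theorem Pair.three {n : ℕ} {S : Multiset ℕ} (hS : Pair (3 * n) S) (hn : 0 < n) (hpn : 3 ∣ n) :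
    ∀ e ∈ S, 3 ∣ e := by
  apply forall_dvd_of_card
  intro h1
  have h := (split_prime Nat.prime_three S).ramified_three hpn hn hS.lsum (Nat.coprime_one_left _)
  have hc := (card_split (p := 3) S).trans hS.card
  omega

theorem Pair.two {n : ℕ} {S : Multiset ℕ} (hS : Pair (8 * n) S) (hn : 0 < n) (hpn : 2 ∣ n) :
    ∀ e ∈ S, 2 ∣ e := by
  have h8 : ∀ p, p.Prime → p ∣ 8 → p ∣ n := fun p hp h => by
    have : p ∣ 2 ^ 3 := h
    rwa [(Nat.prime_dvd_prime_iff_eq hp Nat.prime_two).1 (hp.dvd_of_dvd_pow this)]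
  have h := hS.lsum.ramified_sum h8 (Nat.coprime_one_left _)
  obtain ⟨a, b, rfl⟩ := Multiset.card_eq_two.1 hS.card
  rw [sum_coset_cnt] at h
  have h : (∑ j ∈ Finset.range (2 ^ 3), bit 12 (rg (2 ^ 3 * n) ((1 + j * n) * a))) +
    ∑ j ∈ Finset.range (2 ^ 3), bit 12 (rg (2 ^ 3 * n) ((1 + j * n) * b)) = 8 := by simpa using h
  have c0 : ∀ r < 6, 2 ≤ 2 ^ 0 * col 12 (2 ^ (3 - 0)) r ∧ 2 ^ 0 * col 12 (2 ^ (3 - 0)) r ≤ 3 := by decide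
  have c1 : ∀ r < 6, 2 ≤ 2 ^ 1 * col 12 (2 ^ (3 - 1)) r ∧ 2 ^ 1 * col 12 (2 ^ (3 - 1)) r ≤ 4 := by decide
  have c2 : ∀ r < 6, 2 ^ 2 * col 12 (2 ^ (3 - 2)) r ≤ 4 := by decide
  have key : ∀ e, ∃ c, ∑ j ∈ Finset.range (2 ^ 3), bit 12 (rg (2 ^ 3 * n) ((1 + j * n) * e)) = c ∧
      ((e % 2 = 1 ∧ 2 ≤ c ∧ c ≤ 3) ∨ (e % 2 = 0 ∧ (c ≤ 4 ∨ c = 8))) := by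
    intro e
    refine ⟨_, rfl, ?_⟩
    have : e % 2 = 1 ∨ e % 4 = 2 ∨ e % 8 = 4 ∨ e % 8 = 0 := by omega
    rcases this with h0 | h0 | h0 | h0
    · obtain ⟨r, hr, h1⟩ := two_power_sum (s := 3) (v := 0) (m := 12) (k := 1) hn (by omega) h0
      rw [h1]
      exact Or.inl ⟨h0, c0 r hr⟩
    · obtain ⟨r, hr, h1⟩ := two_power_sum (s := 3) (v := 1) (m := 12) (k := 1) hn (by omega) h0
      rw [h1]
      exact Or.inr ⟨by omega, Or.inl (c1 r hr).2⟩
    · obtain ⟨r, hr, h1⟩ := two_power_sum (s := 3) (v := 2) (m := 12) (k := 1) hn (by omega) h0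
      rw [h1]
      exact Or.inr ⟨by omega, Or.inl (c2 r hr)⟩
    · obtain ⟨b, hb, h1⟩ := two_power_sum_fixed (s := 3) (n := n) (m := 12) (k := 1) h0
      rw [h1]
      exact Or.inr ⟨by omega, by omega⟩
  obtain ⟨c, hc, hc'⟩ := key a
  obtain ⟨d, hd, hd'⟩ := key b
  rw [hc, hd] at h
  simp only [Multiset.insert_eq_cons, Multiset.mem_cons, Multiset.mem_singleton, forall_eq_or_imp,
    forall_eq]
  omega

theorem exists_eq_map_mul {p : ℕ} {S : Multiset ℕ} (h : ∀ e ∈ S, p ∣ e) :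
    ∃ S' : Multiset ℕ, S = S'.map (p * ·) := by
  refine ⟨S.map (· / p), ?_⟩
  rw [Multiset.map_map]
  conv_lhs => rw [← Multiset.map_id S]
  exact Multiset.map_congr rfl fun e he => (Nat.mul_div_cancel' (h e he)).symm

theorem Pair.order {N : ℕ} {S : Multiset ℕ} (hN : 0 < N) (hS : Pair N S) :
    ∀ e ∈ S, N ∣ 120 * e := by
  induction N using Nat.strong_induction_on generalizing S with
  | _ N ih =>
  by_cases hp : ∃ p, p.Prime ∧ p ∣ N ∧ ∀ e ∈ S, p ∣ e
  · obtain ⟨p, hp, ⟨n, rfl⟩, hd⟩ := hp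
    have hn : 0 < n := Nat.pos_of_mul_pos_left hN
    obtain ⟨S', rfl⟩ := exists_eq_map_mul hd
    have := ih n (by have := hp.two_le; nlinarith) (S := S') hn
      ⟨by simpa using hS.card, (lsum_scale hp.pos hn _).1 hS.lsum⟩
    simp only [Multiset.forall_mem_map_iff]
    intro e he
    rw [mul_left_comm]
    exact Nat.mul_dvd_mul_left p (this e he)
  · push Not at hp
    have npos : ∀ {q n : ℕ}, 0 < q * n → 0 < n := fun h => Nat.pos_of_mul_pos_left h
    have big : ∀ p, p.Prime → 7 ≤ p → ¬ p ∣ N := by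
      rintro p h1 h7 ⟨n, rfl⟩
      obtain ⟨e, he, h3⟩ := hp p h1 (Dvd.intro _ rfl)
      by_cases hpn : p ∣ n
      · exact h3 (hS.ramified (npos hN) h1 (by omega) hpn e he)
      · exact h3 (hS.tame (npos hN) h1 h7 hpn e he)
    have : N ∣ 2 ^ 3 * 3 ^ 1 * 5 ^ 1 * 7 ^ 0 * 11 ^ 0 := by
      refine dvd_of_caps ?_ ?_ ?_ (big 7 (by norm_num) (by norm_num))
        (big 11 (by norm_num) (by norm_num)) fun p h1 h2 => big p h1 (by omega)
      · rintro ⟨n, rfl⟩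
        obtain ⟨e, he, h3⟩ := hp 2 Nat.prime_two ((by norm_num : 2 ∣ 2 ^ (3 + 1)).mul_right n)
        have hS' : Pair (8 * (2 * n)) S := by rwa [show 8 * (2 * n) = 2 ^ (3 + 1) * n by ring]
        exact h3 (hS'.two (by have := npos hN; omega) (Dvd.intro _ rfl) e he)
      · rintro ⟨n, rfl⟩
        obtain ⟨e, he, h3⟩ := hp 3 Nat.prime_three ((by norm_num : 3 ∣ 3 ^ (1 + 1)).mul_right n)
        have hS' : Pair (3 * (3 * n)) S := by rwa [show 3 * (3 * n) = 3 ^ (1 + 1) * n by ring]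
        exact h3 (hS'.three (by have := npos hN; omega) (Dvd.intro _ rfl) e he)
      · rintro ⟨n, rfl⟩
        obtain ⟨e, he, h3⟩ := hp 5 Nat.prime_five ((by norm_num : 5 ∣ 5 ^ (1 + 1)).mul_right n)
        have hS' : Pair (5 * (5 * n)) S := by rwa [show 5 * (5 * n) = 5 ^ (1 + 1) * n by ring]
        exact h3 (hS'.ramified (by have := npos hN; omega) Nat.prime_five le_rfl
          (Dvd.intro _ rfl) e he)
    exact fun e _ => (this.trans (by norm_num)).mul_right e

/-- exactly one conjugate of big real part at a time -/
def pairOK (a b : ℕ) : Bool := allL (fun k => orB (Bool.not (cop 120 k))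
  (Nat.beq (Nat.add (bit 12 (rg 120 (Nat.mul k a))) (bit 12 (rg 120 (Nat.mul k b)))) 1)) (down 120)

def reps : List (ℕ × ℕ) := [(4, 44), (4, 76), (6, 66), (10, 70), (15, 75), (24, 48), (24, 72),
  (12, 60), (20, 60), (30, 60)]

def pairRep (a b : ℕ) : Bool := anyL (fun k => andB (cop 120 k)
  (reps.rec false fun r _ ih => orB (andB (Nat.beq (Nat.mod (Nat.mul k a) 120) r.1)
    (Nat.beq (Nat.mod (Nat.mul k b) 120) r.2)) ih)) (down 120)

def pairClash (a b : ℕ) : Bool := andB (Nat.beq (Nat.mod (Nat.mul 2 (Nat.add a b)) 120) 0)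
  (Bool.not (Nat.beq (Nat.mod (Nat.add a b) 120) 0))

def isThird (a : ℕ) : Bool := andB (Nat.beq (Nat.mod (Nat.mul 3 a) 120) 0)
  (Bool.not (Nat.beq (Nat.mod a 120) 0))

def pairUneven (a b : ℕ) : Bool := anyL (fun k => andB (cop 120 k)
  (orB (Bool.not (Nat.beq (Nat.add (bit 14 (rg 120 (Nat.mul k a))) (bit 14 (rg 120 (Nat.mul k b)))) 1))
    (Bool.not (Nat.beq (Nat.add (bit 11 (rg 120 (Nat.mul k a))) (bit 11 (rg 120 (Nat.mul k b)))) 1))))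
  (down 120)

set_option maxHeartbeats 0 in
theorem pair_check : allL (fun a => allL (fun b => orB (Bool.not (pairOK a b))
    (orB (pairClash a b) (orB (isThird a)
      (andB (pairUneven a b) (orB (pairRep a b) (pairRep b a)))))) (down 120)) (down 120) = true := by
  decide +kernel

theorem pair_table {a b : ℕ}
    (h : ∀ u, Nat.Coprime u 120 → bit 12 (rg 120 (u * a)) + bit 12 (rg 120 (u * b)) = 1) :
    (2 * (a + b) % 120 = 0 ∧ (a + b) % 120 ≠ 0) ∨ (3 * a % 120 = 0 ∧ a % 120 ≠ 0) ∨
    ((∃ u, Nat.Coprime u 120 ∧ (bit 14 (rg 120 (u * a)) + bit 14 (rg 120 (u * b)) ≠ 1 ∨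
        bit 11 (rg 120 (u * a)) + bit 11 (rg 120 (u * b)) ≠ 1)) ∧
      ∃ u, Nat.Coprime u 120 ∧ ∃ r ∈ reps, (u * a % 120 = r.1 ∧ u * b % 120 = r.2) ∨
        (u * b % 120 = r.1 ∧ u * a % 120 = r.2)) := by
  have hred : ∀ u z, rg 120 (u * (z % 120)) = rg 120 (u * z) := fun u z =>
    rg_congr (by rw [Nat.mul_mod_mod])
  have hrep : ∀ x y : ℕ, (∃ u ∈ down 120, andB (cop 120 u)
      (List.rec (motive := fun _ => Bool) false (fun r _ ih => orB (andB
        (Nat.beq (Nat.mod (Nat.mul u x) 120) r.1) (Nat.beq (Nat.mod (Nat.mul u y) 120) r.2)) ih) reps)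
      = true) → ∃ u, Nat.Coprime u 120 ∧ ∃ r ∈ reps, u * x % 120 = r.1 ∧ u * y % 120 = r.2 := by
    rintro x y ⟨u, -, hu⟩
    rw [andB_eq, Bool.and_eq_true, cop_iff] at hu
    obtain ⟨hu, this⟩ := hu
    refine ⟨u, hu, ?_⟩
    generalize reps = l at this ⊢
    induction l with
    | nil => simp at this
    | cons r l ih =>
      change orB _ (List.rec (motive := fun _ => Bool) false _ l) = true at this
      rw [orB_eq, andB_eq, Bool.or_eq_true, Bool.and_eq_true, beq_iff, beq_iff] at this
      rcases this with h | h
      · exact ⟨r, by simp, h⟩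
      · obtain ⟨r, h1, h2⟩ := ih h
        exact ⟨r, by simp [h1], h2⟩
  have := (allL_iff _ _).1 pair_check (a % 120) ((mem_down _ _).2 (Nat.mod_lt _ (by norm_num)))
  have := (allL_iff _ _).1 this (b % 120) ((mem_down _ _).2 (Nat.mod_lt _ (by norm_num)))
  rw [orB_eq, orB_eq, orB_eq, andB_eq, orB_eq] at this
  simp only [Bool.or_eq_true, Bool.and_eq_true] at this
  rcases this with h1 | h1 | h1 | ⟨h1, h2⟩
  · exfalso
    rw [Bool.not_eq_true', ← Bool.not_eq_true] at h1
    apply h1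
    rw [pairOK, allL_iff]
    intro u hu
    rw [orB_eq, Bool.or_eq_true]
    by_cases hc : cop 120 u = true
    · right
      rw [beq_iff]
      have := h u ((cop_iff _ _).1 hc)
      rw [← hred u a, ← hred u b] at this
      exact this
    · left; simpa using hc
  · left
    rw [pairClash, andB_eq, Bool.and_eq_true, beq_iff, Bool.not_eq_true', ← Bool.not_eq_true,
      beq_iff] at h1
    have h2 : 2 * (a % 120 + b % 120) % 120 = 0 := h1.1
    have h3 : (a % 120 + b % 120) % 120 ≠ 0 := h1.2
    omega
  · right; left
    rw [isThird, andB_eq, Bool.and_eq_true, beq_iff, Bool.not_eq_true', ← Bool.not_eq_true,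
      beq_iff] at h1
    have h2 : 3 * (a % 120) % 120 = 0 := h1.1
    have h3 : (a % 120) % 120 ≠ 0 := h1.2
    omega
  · right; right
    constructor
    · rw [pairUneven, anyL_iff] at h1
      obtain ⟨u, -, hu⟩ := h1
      rw [andB_eq, orB_eq, Bool.and_eq_true, Bool.or_eq_true, cop_iff, Bool.not_eq_true',
        ← Bool.not_eq_true, beq_iff, Bool.not_eq_true', ← Bool.not_eq_true, beq_iff] at hu
      refine ⟨u, hu.1, ?_⟩
      rw [← hred u a, ← hred u b]
      exact hu.2
    · rw [pairRep, pairRep, anyL_iff, anyL_iff] at h2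
      rcases h2 with h2 | h2
      · obtain ⟨u, hu, r, hr, h3⟩ := hrep _ _ h2
        exact ⟨u, hu, r, hr, Or.inl (by simpa using h3)⟩
      · obtain ⟨u, hu, r, hr, h3⟩ := hrep _ _ h2
        exact ⟨u, hu, r, hr, Or.inr (by simpa using h3)⟩

/-- the classification of pairs inside a valid configuration -/
theorem Pair.shape {N : ℕ} {S R : Multiset ℕ} (hN : 0 < N) (hS : Pair N S) (hE : Valid N (S + R)) :
    (∃ k, Nat.Coprime k N ∧ (cnt N 14 k S ≠ 1 ∨ cnt N 11 k S ≠ 1)) ∧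
    ∃ k, Nat.Coprime k N ∧ ∃ a b, S = {a, b} ∧ ∃ r ∈ reps,
      120 * (k * a % N) = N * r.1 ∧ 120 * (k * b % N) = N * r.2 := by
  obtain ⟨a, b, rfl⟩ := Multiset.card_eq_two.1 hS.card
  obtain ⟨a', ha⟩ := hS.order hN a (by simp)
  obtain ⟨b', hb⟩ := hS.order hN b (by simp)
  have tr : ∀ {z z' : ℕ}, 120 * z = N * z' → ∀ k, rg N (k * z) = rg 120 (k * z') := by
    intro z z' h k
    rw [← rg_scale (by norm_num : 0 < 120) N, mul_left_comm, h, mul_left_comm, mul_comm 120 N,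
      rg_scale hN]
  have lift : ∀ u, Nat.Coprime u 120 → ∃ k, Nat.Coprime k N ∧ ∀ z, k * z % 120 = u * z % 120 := by
    intro u hu
    obtain ⟨j, hj⟩ := exists_coprime_add_mul hN hu
    refine ⟨_, hj, fun z => ?_⟩
    rw [Nat.add_mul, mul_right_comm, Nat.add_mul_mod_self_right]
  have div : ∀ {x x' : ℕ}, 120 * x = N * x' → (N ∣ x ↔ 120 ∣ x') := by
    intro x x' h
    rw [← Nat.mul_dvd_mul_iff_left (by norm_num : 0 < 120), h, mul_comm, Nat.mul_dvd_mul_iff_left hN]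
  have modEq : ∀ {z z' : ℕ}, 120 * z = N * z' → ∀ k, 120 * (k * z % N) = N * (k * z' % 120) := by
    intro z z' h k
    rw [← Nat.mul_mod_mul_left, ← Nat.mul_mod_mul_left, mul_left_comm, h, mul_left_comm,
      mul_comm 120 N]
  have hok : ∀ u, Nat.Coprime u 120 →
      bit 12 (rg 120 (u * a')) + bit 12 (rg 120 (u * b')) = 1 := by
    intro u hu
    obtain ⟨k, hk, h⟩ := lift u hu
    have := hS.lsum k hk
    simp only [cnt, Multiset.insert_eq_cons, Multiset.map_cons, Multiset.map_singleton,
      Multiset.sum_cons, Multiset.sum_singleton, tr ha, tr hb] at this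
    rwa [rg_congr (h a'), rg_congr (h b')] at this
  rcases pair_table hok with ⟨h1, h2⟩ | ⟨h1, h2⟩ | ⟨⟨u, hu, h1⟩, v, hv, r, hr, h2⟩
  · exfalso
    have e1 : N ∣ 2 * (a + b) :=
      (div (x' := 2 * (a' + b')) (by rw [mul_left_comm, mul_add, ha, hb]; ring)).2
        (Nat.dvd_of_mod_eq_zero h1)
    have e2 : ¬ N ∣ a + b := fun h => h2 (Nat.mod_eq_zero_of_dvd
      ((div (x := a + b) (x' := a' + b') (by rw [mul_add, ha, hb]; ring)).1 h))
    have := hE.nodup_Dv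
    simp only [Multiset.insert_eq_cons, Multiset.map_add, Multiset.map_cons,
      Multiset.map_singleton] at this
    have h3 := (Multiset.nodup_cons.1 (Multiset.nodup_of_le (Multiset.le_add_right _ _) this)).1
    rw [Multiset.mem_singleton] at h3
    refine h3 (Dv_eq_of_add (Nat.mod_lt _ hN) (Nat.mod_lt _ hN) ?_ ?_)
    · rw [← Nat.mul_mod_mod, ← Nat.add_mod, Nat.mul_mod_mod]
      exact Nat.mod_eq_zero_of_dvd e1
    · rw [← Nat.add_mod]
      exact fun h => e2 (Nat.dvd_of_mod_eq_zero h)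
  · exfalso
    have e1 : N ∣ 3 * a :=
      (div (x' := 3 * a') (by rw [mul_left_comm, ha]; ring)).2 (Nat.dvd_of_mod_eq_zero h1)
    have e2 : ¬ N ∣ a := fun h => h2 (Nat.mod_eq_zero_of_dvd ((div ha).1 h))
    obtain ⟨h3, h4⟩ := hE.ne_third (e := a) (by simp)
    have h5 : N ∣ 3 * (a % N) := Nat.dvd_of_mod_eq_zero (by
      rw [Nat.mul_mod_mod]; exact Nat.mod_eq_zero_of_dvd e1)
    have h6 := Nat.mod_lt a hN
    have h7 : a % N ≠ 0 := fun h => e2 (Nat.dvd_of_mod_eq_zero h)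
    obtain ⟨c, hc⟩ := h5
    have : c < 3 := by
      by_contra h
      have := Nat.mul_le_mul_left N (not_lt.1 h)
      omega
    interval_cases c <;> omega
  · constructor
    · obtain ⟨k, hk, h⟩ := lift u hu
      refine ⟨k, hk, ?_⟩
      simpa only [cnt, Multiset.insert_eq_cons, Multiset.map_cons, Multiset.map_singleton,
        Multiset.sum_cons, Multiset.sum_singleton, tr ha, tr hb, rg_congr (h a'),
        rg_congr (h b')] using h1
    · obtain ⟨k, hk, h⟩ := lift v hv
      refine ⟨k, hk, ?_⟩
      rcases h2 with ⟨h2, h3⟩ | ⟨h2, h3⟩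
      · exact ⟨a, b, rfl, r, hr, by rw [modEq ha, h, h2], by rw [modEq hb, h, h3]⟩
      · exact ⟨b, a, Multiset.pair_comm _ _, r, hr, by rw [modEq hb, h, h2],
          by rw [modEq ha, h, h3]⟩

theorem Valid.cnt_bounds {N k : ℕ} {E : Multiset ℕ} (hN : 0 < N) (hE : Valid N E)
    (hk : Nat.Coprime k N) : cnt N 12 k E = 2 ∧ (2 ≤ cnt N 11 k E ∧ cnt N 11 k E ≤ 3) ∧
      (2 ≤ cnt N 14 k E ∧ cnt N 14 k E ≤ 3) := by
  obtain ⟨h1, h2, h3, -⟩ := hE.bnd hN hk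
  simp only [Multiset.map_map, Function.comp_def] at h1 h2 h3
  exact ⟨h1, h2, h3⟩

theorem Valid.lsum {N : ℕ} {E : Multiset ℕ} (hN : 0 < N) (hE : Valid N E) : LSum N E 2 :=
  fun _ hk => (hE.cnt_bounds hN hk).1

theorem col_half {m q r : ℕ} (hm : m = 11 ∨ m = 14) (hq : q % 2 = 1) (hr : r < 6) :
    q ≤ 2 * col m q r + 1 ∧ 2 * col m q r ≤ q + 1 := by
  rcases hm with rfl | rfl
  · have := col_V hr (q := q) (by omega)
    omega
  · have := col_H hr (q := q) (by omega)
    omega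

theorem movers_half {m q n k : ℕ} {M : Multiset ℕ} (hm : m = 11 ∨ m = 14) (hq : q % 2 = 1)
    (hn : 0 < n) (hM : ∀ e ∈ M, Nat.Coprime e q) :
    q * M.card ≤ 2 * (∑ j ∈ Finset.range q, cnt (q * n) m (k + j * n) M) + M.card ∧
    2 * (∑ j ∈ Finset.range q, cnt (q * n) m (k + j * n) M) ≤ (q + 1) * M.card := by
  rw [sum_coset_cnt]
  induction M using Multiset.induction with
  | empty => simp
  | cons e M ih =>
    have h1 := ih fun e he => hM e (Multiset.mem_cons_of_mem he)
    have h2 := sum_coset_of_coprime (m := m) (k := k) hn (by omega) (hM e (by simp))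
    have h3 := col_half hm hq (rg_lt (q * n) (q * k * e) (Nat.mul_pos (by omega) hn))
    rw [Multiset.map_cons, Multiset.sum_cons, Multiset.card_cons, h2]
    constructor <;> nlinarith

theorem Pair.uneven {N : ℕ} {S R : Multiset ℕ} (hN : 0 < N) (hS : Pair N S) (hE : Valid N (S + R)) :
    ∃ k m, Nat.Coprime k N ∧ (m = 11 ∨ m = 14) ∧ (cnt N m k S = 0 ∨ cnt N m k S = 2) := by
  obtain ⟨k, hk, h⟩ := (hS.shape hN hE).1
  have h1 := cnt_le N 14 k S
  have h2 := cnt_le N 11 k S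
  rw [hS.card] at h1 h2
  rcases h with h | h
  · exact ⟨k, 14, hk, Or.inr rfl, by omega⟩
  · exact ⟨k, 11, hk, Or.inl rfl, by omega⟩

theorem Valid.cnt_half {N m k : ℕ} {E : Multiset ℕ} (hN : 0 < N) (hE : Valid N E)
    (hk : Nat.Coprime k N) (hm : m = 11 ∨ m = 14) : 2 ≤ cnt N m k E ∧ cnt N m k E ≤ 3 := by
  obtain ⟨-, h1, h2⟩ := hE.cnt_bounds hN hk
  rcases hm with rfl | rfl
  exacts [h1, h2]

theorem Valid.no_balanced_movers {q n : ℕ} {F M : Multiset ℕ} (hq : 0 < q) (hn : 0 < n)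
    (h : ∀ p, p.Prime → p ∣ q → p ∣ n) (hE : Valid (q * n) (F + M)) (hF : ∀ e ∈ F, q ∣ e)
    (hP : Pair (q * n) F)
    (hM : ∀ m k, m = 11 ∨ m = 14 → q < ∑ j ∈ Finset.range q, cnt (q * n) m (k + j * n) M ∧
      ∑ j ∈ Finset.range q, cnt (q * n) m (k + j * n) M < 2 * q) : False := by
  have hN : 0 < q * n := Nat.mul_pos hq hn
  obtain ⟨k, m, hk, hm, h0⟩ := hP.uneven hN hE
  have hb := fun j => hE.cnt_half hN (coprime_add_mul j h hk) hm
  have h1 : ∑ j ∈ Finset.range q, cnt (q * n) m (k + j * n) (F + M) ≤ q * 3 := by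
    simpa using Finset.sum_le_sum fun j (_ : j ∈ Finset.range q) => (hb j).2
  have h2 : q * 2 ≤ ∑ j ∈ Finset.range q, cnt (q * n) m (k + j * n) (F + M) := by
    simpa using Finset.sum_le_sum fun j (_ : j ∈ Finset.range q) => (hb j).1
  simp_rw [cnt_add] at h1 h2
  rw [Finset.sum_add_distrib, sum_coset_fixed hF, Finset.card_range] at h1 h2
  have := hM m k hm
  rcases h0 with h0 | h0 <;> rw [h0] at h1 h2 <;> omega

theorem Valid.not_ramified_pair {q n : ℕ} {F M : Multiset ℕ} (hq : q % 2 = 1) (hq3 : 3 < q)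
    (hn : 0 < n)
    (h : ∀ p, p.Prime → p ∣ q → p ∣ n) (hE : Valid (q * n) (F + M)) (hF : ∀ e ∈ F, q ∣ e)
    (hM : ∀ e ∈ M, Nat.Coprime e q) (hP : Pair (q * n) F) : False := by
  refine hE.no_balanced_movers (by omega) hn h hF hP fun m k hm => ?_
  have := movers_half (k := k) hm hq hn hM
  have hc := hE.1
  rw [Multiset.card_add, hP.card] at hc
  rw [show M.card = 3 by omega] at this
  omega

theorem Valid.not_tame_pair {p n : ℕ} {F M : Multiset ℕ} (hp : p.Prime) (h11 : 11 ≤ p) (hn : 0 < n)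
    (hpn : ¬ p ∣ n) (hE : Valid (p * n) (F + M)) (hF : ∀ e ∈ F, p ∣ e)
    (hM : ∀ e ∈ M, Nat.Coprime e p) (hP : Pair (p * n) F) : False := by
  have hN : 0 < p * n := Nat.mul_pos hp.pos hn
  obtain ⟨k, m, hk, hm, h0⟩ := hP.uneven hN hE
  obtain ⟨k0, hpk, hk0, hkk⟩ := exists_tame hp hpn (Nat.Coprime.coprime_mul_left_right hk)
  rw [← cnt_fixed_congr hF hkk] at h0
  have hodd : p % 2 = 1 := hp.eq_two_or_odd.resolve_left (by omega)
  have hmv := movers_half (k := k0) hm hodd hn hM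
  have hc := hE.1
  rw [Multiset.card_add, hP.card] at hc
  rw [show M.card = 3 by omega] at hmv
  have hb : ∀ j ∈ Finset.range (p - 1), 2 ≤ cnt (p * n) m (k0 + (j + 1) * n) (F + M) ∧
      cnt (p * n) m (k0 + (j + 1) * n) (F + M) ≤ 3 := fun j hj =>
    hE.cnt_half hN (coprime_add_mul_tame hp hpn hpk hk0 (by omega)
      (by have := Finset.mem_range.1 hj; omega)) hm
  have h1 : ∑ j ∈ Finset.range (p - 1), cnt (p * n) m (k0 + (j + 1) * n) (F + M) ≤ (p - 1) * 3 := by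
    simpa using Finset.sum_le_sum fun j hj => (hb j hj).2
  have h2 : (p - 1) * 2 ≤ ∑ j ∈ Finset.range (p - 1), cnt (p * n) m (k0 + (j + 1) * n) (F + M) := by
    simpa using Finset.sum_le_sum fun j hj => (hb j hj).1
  have h3 : ∑ j ∈ Finset.range p, cnt (p * n) m (k0 + j * n) (F + M) =
      ∑ j ∈ Finset.range (p - 1), cnt (p * n) m (k0 + (j + 1) * n) (F + M) +
        cnt (p * n) m k0 (F + M) := by
    conv_lhs => rw [show p = p - 1 + 1 by omega, Finset.sum_range_succ']
    simp [show p - 1 + 1 = p by omega]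
  have h4 := cnt_le (p * n) m k0 M
  rw [show M.card = 3 by omega] at h4
  rw [cnt_add (p * n) m k0] at h3
  simp_rw [cnt_add] at h3
  rw [Finset.sum_add_distrib, sum_coset_fixed hF, Finset.card_range] at h3
  simp_rw [cnt_add] at h1 h2
  rcases h0 with h0 | h0 <;> rw [h0] at h3 <;> omega

theorem cnt_mul_left {p : ℕ} (hp : 0 < p) (n m k : ℕ) (S : Multiset ℕ) :
    cnt (p * n) m (p * k) S = cnt n m k S := by
  simp only [cnt, mul_assoc, rg_scale hp]

theorem bit_of_cnt {N m k : ℕ} {S : Multiset ℕ} (h : cnt N m k S = 0) :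
    ∀ e ∈ S, bit m (rg N (k * e)) = 0 := by
  intro e he
  rw [cnt, Multiset.sum_eq_zero_iff] at h
  exact h _ (Multiset.mem_map_of_mem _ he)

theorem bit_of_cnt_card {N m k : ℕ} {S : Multiset ℕ} (h : cnt N m k S = S.card) :
    ∀ e ∈ S, bit m (rg N (k * e)) = 1 := by
  intro e he
  obtain ⟨T, rfl⟩ := Multiset.exists_cons_of_mem he
  rw [cnt_cons, Multiset.card_cons] at h
  have := cnt_le N m k T
  have := bit_le_one m (rg N (k * e))
  omega

theorem coprime_prime_mul {p n k : ℕ} (hpn : p ∣ n) (hk : Nat.Coprime k n) :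
    Nat.Coprime k (p * n) :=
  Nat.Coprime.mul_right (Nat.Coprime.coprime_dvd_right hpn hk) hk

theorem split_self {p : ℕ} {S : Multiset ℕ} (h : ∀ e ∈ S, Nat.Coprime e p) : Split p S 0 S :=
  ⟨by simp, by simp, h⟩

theorem odd_sum {n : ℕ} {S : Multiset ℕ} (h : ∀ e ∈ S, 2 * e % n = 0 ∧ e % n ≠ 0) :
    ∃ c, 2 * S.sum = n * (2 * c + S.card) := by
  induction S using Multiset.induction with
  | empty => exact ⟨0, by simp⟩
  | cons e S ih =>
    obtain ⟨c, hc⟩ := ih fun e he => h e (Multiset.mem_cons_of_mem he)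
    obtain ⟨h1, h2⟩ := h e (by simp)
    obtain ⟨d, hd⟩ := Nat.dvd_of_mod_eq_zero h1
    obtain ⟨a, rfl⟩ | ⟨a, rfl⟩ : (∃ a, d = 2 * a) ∨ ∃ a, d = 2 * a + 1 := by
      rcases Nat.even_or_odd' d with ⟨a, h | h⟩
      exacts [Or.inl ⟨a, h⟩, Or.inr ⟨a, h⟩]
    · exact absurd (Nat.mod_eq_zero_of_dvd ⟨a, by nlinarith⟩) h2
    · refine ⟨c + a, ?_⟩
      rw [Multiset.sum_cons, Multiset.card_cons, mul_add, hc, hd]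
      ring

theorem Valid.ramified_one {p n : ℕ} {F M : Multiset ℕ} (hn : 0 < n) (hp : p.Prime)
    (hE : Valid (p * n) (F + M)) (hs : Split p (F + M) F M) (hM : 1 ≤ M.card)
    (h6 : p % 6 = 1) (h7 : 7 ≤ p) (hpn : p ∣ n) : False := by
  have hN : 0 < p * n := Nat.mul_pos hp.pos hn
  have hc : M.card + F.card = 5 := by have := hE.1; rw [Multiset.card_add] at this; omega
  have key := fun k (hk : Nat.Coprime k (p * n)) => ramified_one_arith h6 h7 hM hc (cnt_le _ _ k F)
    (cnt_le _ _ (p * k) M) (hs.ramified_one hp h6 hpn hn (hE.lsum hN) hk)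
  by_cases h3 : M.card = 3
  · refine hE.not_ramified_pair (hp.eq_two_or_odd.resolve_left (by omega)) (by omega) hn
      (prime_dvd_of_dvd_self hp hpn) hs.fixed hs.moved ⟨by omega, fun k hk => ?_⟩
    exact ((key k hk).resolve_right fun h => by omega).2
  · have key' := fun k hk => (key k hk).resolve_left fun h => h3 h.1
    obtain ⟨rfl, h5, -⟩ := key' 1 (Nat.coprime_one_left _)
    have hL : LSum n M 4 := fun k hk => by
      rw [← cnt_mul_left (by norm_num : 0 < 7)]
      exact (key' k (coprime_prime_mul hpn hk)).2.2
    obtain ⟨n, rfl⟩ := hpn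
    have hn' : 0 < n := Nat.pos_of_mul_pos_left hn
    by_cases h7n : 7 ∣ n
    · have := (split_self hs.moved).ramified_one hp h6 h7n hn' hL (Nat.coprime_one_left _)
      have h := cnt_le (7 * n) 12 (7 * 1) M
      rw [cnt_zero] at this
      omega
    · obtain ⟨k, hk1, hk2, -⟩ := exists_tame hp h7n (Nat.coprime_one_left n)
      have := (split_self hs.moved).tame_one hp h6 h7n hn' hL hk1 hk2
      have h := cnt_le (7 * n) 12 (7 * k) M
      rw [cnt_zero] at this
      omega

theorem Valid.ramified_five {p n : ℕ} {F M : Multiset ℕ} (hn : 0 < n) (hp : p.Prime)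
    (hE : Valid (p * n) (F + M)) (hs : Split p (F + M) F M) (hM : 1 ≤ M.card)
    (h6 : p % 6 = 5) (hpn : p ∣ n) : p = 5 ∧ F = 0 ∧
    ∀ k, Nat.Coprime k n → cnt n 12 k M = 0 := by
  have hN : 0 < p * n := Nat.mul_pos hp.pos hn
  have hc : M.card + F.card = 5 := by have := hE.1; rw [Multiset.card_add] at this; omega
  have key := fun k (hk : Nat.Coprime k (p * n)) => ramified_five_arith h6 (by omega) hM hc
    (cnt_le _ _ k F)
    (cnt_le _ _ (p * k) M) (hs.ramified_five hp h6 hpn hn (hE.lsum hN) hk)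
  by_cases h3 : M.card = 3
  · refine (hE.not_ramified_pair (hp.eq_two_or_odd.resolve_left (by omega)) (by omega) hn
      (prime_dvd_of_dvd_self hp hpn) hs.fixed hs.moved ⟨by omega, fun k hk => ?_⟩).elim
    exact ((key k hk).resolve_right fun h => by omega).2
  have key' := fun k hk => (key k hk).resolve_left fun h => h3 h.1
  have h5 : p = 5 := by rcases key' 1 (Nat.coprime_one_left _) with h | h <;> exact h.1
  subst h5
  by_cases h4 : M.card = 5
  · refine ⟨rfl, Multiset.card_eq_zero.1 (by omega), fun k hk => ?_⟩
    rw [← cnt_mul_left (by norm_num : 0 < 5)]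
    exact ((key' k (coprime_prime_mul hpn hk)).resolve_right fun h => by omega).2.2
  · exfalso
    have key'' := fun k hk => (key' k hk).resolve_left fun h => h4 h.2.1
    have hL : LSum n M 3 := fun k hk => by
      rw [← cnt_mul_left (by norm_num : 0 < 5)]
      exact (key'' k (coprime_prime_mul hpn hk)).2.2
    have h4 := (key'' 1 (Nat.coprime_one_left _)).2.1
    obtain ⟨n, rfl⟩ := hpn
    have hn' : 0 < n := Nat.pos_of_mul_pos_left hn
    by_cases h7n : 5 ∣ n
    · have := (split_self hs.moved).ramified_five hp h6 h7n hn' hL (Nat.coprime_one_left _)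
      rw [cnt_zero] at this
      omega
    · obtain ⟨k, hk1, hk2, -⟩ := exists_tame hp h7n (Nat.coprime_one_left n)
      have := (split_self hs.moved).tame_five hp h6 h7n hn' hL hk1 hk2
      rw [cnt_zero] at this
      omega

theorem chain_seven_table : ∀ m < 148, m % 7 = 0 ∨ m = 0 ∨ ∃ k < 148, Nat.gcd k m = 1 ∧
    bit 12 (rg m k) + bit 12 (rg m (7 * k)) + bit 12 (rg m (49 * k)) ≠ 2 := by
  decide +kernel

theorem chain_seven {m : ℕ} (h7 : ¬ 7 ∣ m) (hm : 0 < m) : ∃ k, Nat.Coprime k m ∧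
    bit 12 (rg m k) + bit 12 (rg m (7 * k)) + bit 12 (rg m (49 * k)) ≠ 2 := by
  by_cases h : m < 148
  · rcases chain_seven_table m h with h1 | h1 | ⟨k, -, h2, h3⟩
    · exact absurd (Nat.dvd_of_mod_eq_zero h1) h7
    · omega
    · exact ⟨k, h2, h3⟩
  · have key : ∀ z, 3 * z < m → bit 12 (rg m z) = 0 := by
      intro z hz
      have : rg m z < 2 := by
        change 6 * (z % m) / m < 2
        rw [Nat.mod_eq_of_lt (by omega), Nat.div_lt_iff_lt_mul hm]
        omega
      interval_cases rg m z <;> rfl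
    refine ⟨1, Nat.coprime_one_left _, ?_⟩
    rw [key _ (by omega), key _ (by omega), key _ (by omega)]
    norm_num

theorem no_seven_chain {n x : ℕ} (h7 : ¬ 7 ∣ n) (hn : 0 < n) (h : ∀ k, Nat.Coprime k n →
    bit 12 (rg n (k * x)) + bit 12 (rg n (7 * k * x)) + bit 12 (rg n (49 * k * x)) = 2) : False := by
  obtain ⟨g, m, e', rfl, rfl, -, hg, hm, hk⟩ := exists_order hn x
  obtain ⟨k, hkm, hne⟩ := chain_seven (fun h => h7 (h.mul_left g)) hm
  obtain ⟨k', h1, h2⟩ := hk k hkm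
  have tr : ∀ c, rg (g * m) (c * (k' * (g * e'))) = rg m (c * k) := fun c => by
    rw [rg_congr (b := g * (c * k)) (by rw [Nat.mul_mod, h2, ← Nat.mul_mod, mul_left_comm]),
      rg_scale hg]
  have := h k' h1
  rw [mul_assoc 7, mul_assoc 49, tr, tr, ← one_mul (k' * _), tr, one_mul] at this
  exact hne this

theorem Valid.tame_one {p n : ℕ} {F M : Multiset ℕ} (hn : 0 < n) (hp : p.Prime)
    (hE : Valid (p * n) (F + M)) (hs : Split p (F + M) F M) (hM : 1 ≤ M.card)
    (h6 : p % 6 = 1) (h7 : 7 ≤ p) (hpn : ¬ p ∣ n) : p = 7 ∧ Pair (p * n) F := by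
  have hN : 0 < p * n := Nat.mul_pos hp.pos hn
  have hc : M.card + F.card = 5 := by have := hE.1; rw [Multiset.card_add] at this; omega
  have hpow : ∀ k i, Nat.Coprime k n → Nat.Coprime (p ^ i * k) n := fun k i hk =>
    Nat.Coprime.mul_left (Nat.Coprime.pow_left i ((hp.coprime_iff_not_dvd).2 hpn)) hk
  have key := fun k (hpk : p ∣ k) (hk : Nat.Coprime k n) =>
    tame_one_arith h6 h7 hM hc (fun i => cnt (p * n) 12 (p ^ i * k) F)
      (fun i => cnt (p * n) 12 (p ^ i * k) M) (fun i => cnt_le _ _ _ F) (fun i => cnt_le _ _ _ M)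
      (fun i => by
        have := hs.tame_one hp h6 hpn hn (hE.lsum hN) (hpk.mul_left (p ^ i)) (hpow k i hk)
        rwa [← mul_assoc p (p ^ i), ← pow_succ'] at this)
  by_cases h3 : M.card = 3
  · have hP : Pair (p * n) F := ⟨by omega, fun k hk => by
      obtain ⟨k0, hpk, hk0, hkk⟩ := exists_tame hp hpn (Nat.Coprime.coprime_mul_left_right hk)
      rw [← cnt_fixed_congr hs.fixed hkk]
      simpa using ((key k0 hpk hk0).resolve_right fun h => by omega).2⟩
    by_cases h11 : 11 ≤ p
    · exact (hE.not_tame_pair hp h11 hn hpn hs.fixed hs.moved hP).elim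
    · exact ⟨by omega, hP⟩
  · exfalso
    have key' := fun k hpk hk => (key k hpk hk).resolve_left fun h => h3 h.1
    obtain ⟨k0, hpk, hk0, -⟩ := exists_tame hp hpn (Nat.coprime_one_left n)
    obtain ⟨rfl, h4, -⟩ := key' k0 hpk hk0
    obtain ⟨x, rfl⟩ := Multiset.card_eq_one.1 (show F.card = 1 by omega)
    obtain ⟨y, rfl⟩ := hs.fixed x (by simp)
    refine no_seven_chain (x := y) hpn hn fun k hk => ?_
    obtain ⟨k0, hpk, hk0, hkk⟩ := exists_tame hp hpn hk
    have := (key' k0 hpk hk0).2.2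
    simp only [cnt, Multiset.map_singleton, Multiset.sum_singleton, mul_left_comm _ 7 y,
      rg_scale (by norm_num : 0 < 7)] at this
    have tr : ∀ c, rg n (c * k0 * y) = rg n (c * k * y) := fun c =>
      rg_congr ((hkk.mul_left c).mul_right y)
    rw [tr, tr, tr] at this
    simpa using this

theorem Valid.tame_five {p n : ℕ} {F M : Multiset ℕ} (hn : 0 < n) (hp : p.Prime)
    (hE : Valid (p * n) (F + M)) (hs : Split p (F + M) F M) (hM : 1 ≤ M.card)
    (h6 : p % 6 = 5) (h7 : 11 ≤ p) (hpn : ¬ p ∣ n) :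
    p = 11 ∧ ((F = 0 ∧ ∀ e ∈ M, p * n ∣ 660 * e) ∨
      ∃ x, F = {x} ∧ 2 * x % (p * n) = 0 ∧ x % (p * n) ≠ 0) := by
  have hN : 0 < p * n := Nat.mul_pos hp.pos hn
  have hc : M.card + F.card = 5 := by have := hE.1; rw [Multiset.card_add] at this; omega
  have key := fun k (hpk : p ∣ k) (hk : Nat.Coprime k n) => tame_five_arith h6 h7 hM hc
    (cnt_le _ _ k F) (cnt_le _ _ k M) (cnt_le _ _ (p * k) M)
    (hs.tame_five hp h6 hpn hn (hE.lsum hN) hpk hk)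
  have hmul : ∀ k, Nat.Coprime k n → Nat.Coprime (p * k) n := fun k hk =>
    Nat.Coprime.mul_left ((hp.coprime_iff_not_dvd).2 hpn) hk
  have key2 := fun k (hk : Nat.Coprime k n) => key (p * k) (Dvd.intro _ rfl) (hmul k hk)
  simp only [cnt_mul_left hp.pos] at key2
  by_cases h3 : M.card = 3
  · refine (hE.not_tame_pair hp h7 hn hpn hs.fixed hs.moved ⟨by omega, fun k hk => ?_⟩).elim
    obtain ⟨k0, hpk, hk0, hkk⟩ := exists_tame hp hpn (Nat.Coprime.coprime_mul_left_right hk)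
    rw [← cnt_fixed_congr hs.fixed hkk]
    exact ((key k0 hpk hk0).resolve_right fun h => by omega).2
  by_cases h5 : M.card = 5
  · have key3 := fun k hk => ((key2 k hk).resolve_left fun h => by omega).resolve_right fun h => by
      omega
    obtain rfl := (key3 1 (Nat.coprime_one_left _)).1
    have hF : F = 0 := Multiset.card_eq_zero.1 (by omega)
    refine ⟨rfl, Or.inl ⟨hF, fun e he => ?_⟩⟩
    rw [show 660 * e = 11 * (60 * e) by ring]
    refine Nat.mul_dvd_mul_left 11 ?_
    rcases order_of_never hn fun k hk => bit_of_cnt (key3 k hk).2.2 e he with h | h | h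
    · exact (Nat.dvd_of_mod_eq_zero h).trans ⟨15, by ring⟩
    · exact (Nat.dvd_of_mod_eq_zero h).trans ⟨10, by ring⟩
    · exact (Nat.dvd_of_mod_eq_zero h).trans ⟨6, by ring⟩
  · have key3 := fun k (hpk : p ∣ k) hk => ((key k hpk hk).resolve_left fun h => by omega).resolve_left fun h => by
      omega
    have h4 : M.card = 4 := by
      rcases key3 p (dvd_refl _) ((hp.coprime_iff_not_dvd).2 hpn) with h | h <;> exact h.2.1
    obtain ⟨x, rfl⟩ := Multiset.card_eq_one.1 (show F.card = 1 by omega)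
    have hx : 2 * x % (p * n) = 0 ∧ x % (p * n) ≠ 0 := by
      refine order_of_always hN fun k hk => ?_
      obtain ⟨k0, hpk, hk0, hkk⟩ := exists_tame hp hpn (Nat.Coprime.coprime_mul_left_right hk)
      have h1 : cnt (p * n) 12 k0 {x} = 1 := by
        rcases key3 k0 hpk hk0 with h | h
        exacts [h.2.2, h.2.2.1]
      rw [cnt_fixed_congr hs.fixed hkk] at h1
      simpa [cnt] using h1
    have key4 := fun k hk => (key2 k hk).resolve_left fun h => by omega
    by_cases h17 : p = 17
    · exfalso
      have hall : ∀ e ∈ {x} + M, 2 * e % n = 0 ∧ e % n ≠ 0 := by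
        intro e he
        rcases Multiset.mem_add.1 he with he | he
        · rw [Multiset.mem_singleton] at he
          subst he
          refine ⟨Nat.mod_eq_zero_of_dvd ((Dvd.intro_left p rfl).trans
            (Nat.dvd_of_mod_eq_zero hx.1)), fun h => hx.2 (Nat.mod_eq_zero_of_dvd ?_)⟩
          exact Nat.Coprime.mul_dvd_of_dvd_of_dvd ((hp.coprime_iff_not_dvd).2 hpn)
            (hs.fixed e (by simp)) (Nat.dvd_of_mod_eq_zero h)
        · refine order_of_always hn fun k hk => bit_of_cnt_card ?_ e he
          rw [h4]
          rcases key4 k hk with h | h | h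
          · omega
          · omega
          · exact h.2.2.2
      obtain ⟨c, hc'⟩ := odd_sum hall
      obtain ⟨d, hd⟩ := (Dvd.intro_left p rfl).trans hE.2.1
      rw [hd, hE.1, show 2 * (n * d) = n * (2 * d) by ring] at hc'
      have := Nat.eq_of_mul_eq_mul_left hn hc'
      omega
    · refine ⟨?_, Or.inr ⟨x, rfl, hx⟩⟩
      rcases key3 p (dvd_refl _) ((hp.coprime_iff_not_dvd).2 hpn) with h | h
      exacts [h.1, absurd h.1 h17]

theorem Valid.large_prime {N p : ℕ} {E : Multiset ℕ} (hN : 0 < N) (hE : Valid N E) (hp : p.Prime)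
    (h13 : 13 ≤ p) (hpN : p ∣ N) : ∀ e ∈ E, p ∣ e := by
  obtain ⟨n, rfl⟩ := hpN
  have hn : 0 < n := Nat.pos_of_mul_pos_left hN
  apply forall_dvd_of_card
  intro hM
  have hs := split_prime hp E
  rw [hs.eq] at hE
  generalize E.filter (p ∣ ·) = F at *
  generalize (E.filter fun e => ¬ p ∣ e) = M at *
  rw [hs.eq] at hs
  by_cases hpn : p ∣ n
  · rcases prime_mod_six hp (by omega) with h6 | h6
    · exact hE.ramified_one hn hp hs hM h6 (by omega) hpn
    · have := (hE.ramified_five hn hp hs hM h6 hpn).1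
      omega
  · rcases prime_mod_six hp (by omega) with h6 | h6
    · have := (hE.tame_one hn hp hs hM h6 (by omega) hpn).1
      omega
    · have := (hE.tame_five hn hp hs hM h6 (by omega) hpn).1
      omega

theorem Valid.pair_of_three {n : ℕ} {F M : Multiset ℕ} (hn : 0 < n) (hE : Valid (3 * n) (F + M))
    (hs : Split 3 (F + M) F M) (hM : 1 ≤ M.card) (h3 : 3 ∣ n) : Pair (3 * n) F := by
  have hN : 0 < 3 * n := by omega
  have hc : F.card + M.card = 5 := by rw [← Multiset.card_add]; exact hE.1
  have key := fun k hk => hs.ramified_three h3 hn (hE.lsum hN) (k := k) hk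
  have := key 1 (Nat.coprime_one_left _)
  have hM3 : M.card = 3 := by omega
  exact ⟨by omega, fun k hk => by have := key k hk; omega⟩

theorem Valid.twenty_seven {N : ℕ} {E : Multiset ℕ} (hN : 0 < N) (hE : Valid N E) (h : 27 ∣ N) :
    ∀ e ∈ E, 3 ∣ e := by
  obtain ⟨n, rfl⟩ := h
  have hn : 0 < n := Nat.pos_of_mul_pos_left hN
  apply forall_dvd_of_card
  intro hM
  have hs := split_prime Nat.prime_three E
  rw [hs.eq] at hE
  generalize E.filter (3 ∣ ·) = F at *
  generalize (E.filter fun e => ¬ 3 ∣ e) = M at *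
  rw [hs.eq] at hs
  have hE' : Valid (3 * (9 * n)) (F + M) := by rwa [← mul_assoc]
  have hE'' : Valid (9 * (3 * n)) (F + M) := by rwa [← mul_assoc]
  have hP : Pair (9 * (3 * n)) F := by
    have := hE'.pair_of_three (by omega) hs hM ((by norm_num : 3 ∣ 9).mul_right n)
    rwa [show 3 * (9 * n) = 9 * (3 * n) by ring] at this
  refine hE''.not_ramified_pair (by norm_num) (by norm_num) (by omega) (fun p hp hd => ?_)
    (fun e he => ?_) (fun e he => ?_) hP
  · have : p ∣ 3 ^ 2 := hd
    rw [(Nat.prime_dvd_prime_iff_eq hp Nat.prime_three).1 (hp.dvd_of_dvd_pow this)]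
    exact Dvd.intro _ rfl
  · have := (Dvd.intro n rfl : 27 ∣ 27 * n).trans
      ((by rw [show 27 * n = 9 * (3 * n) by ring]; exact hP.order (by omega) e he :
        27 * n ∣ 120 * e))
    omega
  · exact Nat.Coprime.pow_right 2 (hs.moved e he)

theorem sum_mod_two (S : Multiset ℕ) :
    S.sum % 2 = (S.filter fun e => ¬ 2 ∣ e).card % 2 := by
  induction S using Multiset.induction with
  | empty => rfl
  | cons a S ih =>
    rw [Multiset.sum_cons]
    by_cases h : 2 ∣ a
    · rw [Multiset.filter_cons_of_neg (p := fun e => ¬ 2 ∣ e) _ (not_not.2 h)]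
      omega
    · rw [Multiset.filter_cons_of_pos (p := fun e => ¬ 2 ∣ e) _ h, Multiset.card_cons]
      omega

theorem sum_bounds {S : Multiset ℕ} {G : ℕ → ℕ} {a b : ℕ} (h : ∀ e ∈ S, a ≤ G e ∧ G e ≤ b) :
    a * S.card ≤ (S.map G).sum ∧ (S.map G).sum ≤ b * S.card := by
  induction S using Multiset.induction with
  | empty => simp
  | cons e S ih =>
    have h1 := ih fun e he => h e (Multiset.mem_cons_of_mem he)
    have h2 := h e (by simp)
    rw [Multiset.map_cons, Multiset.sum_cons, Multiset.card_cons]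
    constructor <;> nlinarith

theorem dvd_sum {S : Multiset ℕ} {G : ℕ → ℕ} {a : ℕ} (h : ∀ e ∈ S, a ∣ G e) :
    a ∣ (S.map G).sum :=
  Multiset.dvd_sum fun x hx => by
    obtain ⟨e, he, rfl⟩ := Multiset.mem_map.1 hx
    exact h e he

theorem two_power_profile {n : ℕ} (hn : 0 < n) (e : ℕ) :
    ∃ G, ∑ j ∈ Finset.range 64, bit 12 (rg (64 * n) ((1 + j * n) * e)) = G ∧
      (¬ 2 ∣ e → 21 ≤ G ∧ G ≤ 22) ∧ (2 ∣ e → ¬ 8 ∣ e → 20 ≤ G ∧ G ≤ 24) ∧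
      (8 ∣ e → ¬ 16 ∣ e → 16 ≤ G ∧ G ≤ 24 ∧ 8 ∣ G) ∧
      (16 ∣ e → G = 0 ∨ G = 16 ∨ G = 32 ∨ G = 64) := by
  refine ⟨∑ j ∈ Finset.range (2 ^ 6), bit 12 (rg (2 ^ 6 * n) ((1 + j * n) * e)),
    by norm_num, ?_⟩
  have c0 : ∀ r < 6, 21 ≤ 2 ^ 0 * col 12 (2 ^ (6 - 0)) r ∧ 2 ^ 0 * col 12 (2 ^ (6 - 0)) r ≤ 22 := by
    decide +kernel
  have c1 : ∀ r < 6, 20 ≤ 2 ^ 1 * col 12 (2 ^ (6 - 1)) r ∧ 2 ^ 1 * col 12 (2 ^ (6 - 1)) r ≤ 22 := by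
    decide +kernel
  have c2 : ∀ r < 6, 20 ≤ 2 ^ 2 * col 12 (2 ^ (6 - 2)) r ∧ 2 ^ 2 * col 12 (2 ^ (6 - 2)) r ≤ 24 := by
    decide +kernel
  have c3 : ∀ r < 6, 16 ≤ 2 ^ 3 * col 12 (2 ^ (6 - 3)) r ∧ 2 ^ 3 * col 12 (2 ^ (6 - 3)) r ≤ 24 := by
    decide +kernel
  have c4 : ∀ r < 6, 2 ^ 4 * col 12 (2 ^ (6 - 4)) r = 16 ∨ 2 ^ 4 * col 12 (2 ^ (6 - 4)) r = 32 := by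
    decide +kernel
  have c5 : ∀ r < 6, 2 ^ 5 * col 12 (2 ^ (6 - 5)) r = 0 ∨ 2 ^ 5 * col 12 (2 ^ (6 - 5)) r = 32 ∨
      2 ^ 5 * col 12 (2 ^ (6 - 5)) r = 64 := by
    decide +kernel
  have s : ∀ v < 6, e % 2 ^ (v + 1) = 2 ^ v → _ := fun v hv h =>
    two_power_sum (s := 6) (v := v) (n := n) (m := 12) (k := 1) hn hv h
  have : e % 2 ^ (0 + 1) = 2 ^ 0 ∨ e % 2 ^ (1 + 1) = 2 ^ 1 ∨ e % 2 ^ (2 + 1) = 2 ^ 2 ∨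
    e % 2 ^ (3 + 1) = 2 ^ 3 ∨ e % 2 ^ (4 + 1) = 2 ^ 4 ∨ e % 2 ^ (5 + 1) = 2 ^ 5 ∨ e % 2 ^ 6 = 0 := by
    omega
  rcases this with h | h | h | h | h | h | h
  · obtain ⟨r, hr, h1⟩ := s 0 (by omega) h
    rw [h1]
    exact ⟨fun _ => c0 r hr, by omega, by omega, by omega⟩
  · obtain ⟨r, hr, h1⟩ := s 1 (by omega) h
    rw [h1]
    have := c1 r hr
    exact ⟨by omega, fun _ _ => by omega, by omega, by omega⟩
  · obtain ⟨r, hr, h1⟩ := s 2 (by omega) h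
    rw [h1]
    have := c2 r hr
    exact ⟨by omega, fun _ _ => by omega, by omega, by omega⟩
  · obtain ⟨r, hr, h1⟩ := s 3 (by omega) h
    rw [h1]
    have := c3 r hr
    exact ⟨by omega, by omega, fun _ _ => ⟨this.1, this.2, Dvd.intro _ rfl⟩, by omega⟩
  · obtain ⟨r, hr, h1⟩ := s 4 (by omega) h
    rw [h1]
    have := c4 r hr
    exact ⟨by omega, by omega, by omega, fun _ => by omega⟩
  · obtain ⟨r, hr, h1⟩ := s 5 (by omega) h
    rw [h1]
    have := c5 r hr
    exact ⟨by omega, by omega, by omega, fun _ => by omega⟩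
  · obtain ⟨b, hb, h1⟩ := two_power_sum_fixed (s := 6) (n := n) (m := 12) (k := 1) h
    rw [h1]
    exact ⟨by omega, by omega, by omega, fun _ => by omega⟩

theorem two_power_table {o w t f SO SW ST SF : ℕ} (ho : 1 ≤ o) (ho2 : o % 2 = 0)
    (hc : o + w + t + f = 5) (hO : 21 * o ≤ SO ∧ SO ≤ 22 * o) (hW : 20 * w ≤ SW ∧ SW ≤ 24 * w)
    (hT : 16 * t ≤ ST ∧ ST ≤ 24 * t) (hT8 : 8 ∣ ST) (hF : SF ≤ 64 * f) (hF16 : 16 ∣ SF)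
    (hF3 : f = 1 → SF ≠ 48) (h : SO + SW + ST + SF = 128) : o = 2 ∧ w = 1 ∧ t = 0 ∧ f = 2 := by
  obtain ⟨T, rfl⟩ := hT8
  obtain ⟨D, rfl⟩ := hF16
  have : o = 2 ∨ o = 4 := by omega
  have hw : w ≤ 3 := by omega
  have ht : t ≤ 3 := by omega
  obtain rfl : f = 5 - o - w - t := by omega
  rcases this with rfl | rfl <;> interval_cases w <;> interval_cases t <;> omega

theorem sixteen_odd {m n k e : ℕ} (hn : 0 < n) (he : ¬ 2 ∣ e) :
    ∃ r < 6, ∑ j ∈ Finset.range 16, bit m (rg (16 * n) ((k + j * n) * e)) = col m 16 r := by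
  obtain ⟨r, hr, h⟩ := two_power_sum (s := 4) (v := 0) (m := m) (k := k) hn (by omega)
    (show e % 2 ^ (0 + 1) = 2 ^ 0 by omega)
  exact ⟨r, hr, by simpa using h⟩

theorem sixteen_even {m n k e : ℕ} (hn : 0 < n) (he : 2 ∣ e) (he8 : ¬ 8 ∣ e) :
    ∃ r < 6, ∑ j ∈ Finset.range 16, bit m (rg (16 * n) ((k + j * n) * e)) = 2 * col m 8 r ∨
      ∑ j ∈ Finset.range 16, bit m (rg (16 * n) ((k + j * n) * e)) = 4 * col m 4 r := by
  have : e % 2 ^ (1 + 1) = 2 ^ 1 ∨ e % 2 ^ (2 + 1) = 2 ^ 2 := by omega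
  rcases this with h | h
  · obtain ⟨r, hr, h⟩ := two_power_sum (s := 4) (v := 1) (m := m) (k := k) hn (by omega) h
    exact ⟨r, hr, Or.inl (by simpa using h)⟩
  · obtain ⟨r, hr, h⟩ := two_power_sum (s := 4) (v := 2) (m := m) (k := k) hn (by omega) h
    exact ⟨r, hr, Or.inr (by simpa using h)⟩

theorem Valid.two_power {N : ℕ} {E : Multiset ℕ} (hN : 0 < N) (hE : Valid N E) (h : 128 ∣ N) :
    ∀ e ∈ E, 2 ∣ e := by
  obtain ⟨n, rfl⟩ : ∃ n, N = 64 * n := (by norm_num : 64 ∣ 128).trans h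
  have hn : 0 < n := Nat.pos_of_mul_pos_left hN
  have h2n : 2 ∣ n := by omega
  have pow2 : ∀ s : ℕ, ∀ p, p.Prime → p ∣ 2 ^ s → p ∣ n := fun s p hp hd => by
    rwa [(Nat.prime_dvd_prime_iff_eq hp Nat.prime_two).1 (hp.dvd_of_dvd_pow hd)]
  apply forall_dvd_of_card
  intro hM
  have h64 : ∀ p, p.Prime → p ∣ 64 → p ∣ n := fun p hp hd => pow2 6 p hp hd
  have hL := (hE.lsum hN).ramified_sum h64 (Nat.coprime_one_left _)
  rw [sum_coset_cnt] at hL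
  have hpar := sum_mod_two E
  rw [Nat.mod_eq_zero_of_dvd (((by norm_num : 2 ∣ 64).mul_right n).trans hE.2.1)] at hpar
  have e1 := Multiset.filter_add_not (2 ∣ ·) E
  have e2 := Multiset.filter_add_not (8 ∣ ·) (E.filter (2 ∣ ·))
  have e3 := Multiset.filter_add_not (16 ∣ ·) ((E.filter (2 ∣ ·)).filter (8 ∣ ·))
  have mO : ∀ e ∈ E.filter fun e => ¬ 2 ∣ e, ¬ 2 ∣ e := fun e he => (Multiset.mem_filter.1 he).2
  have mW : ∀ e ∈ (E.filter (2 ∣ ·)).filter fun e => ¬ 8 ∣ e, 2 ∣ e ∧ ¬ 8 ∣ e := fun e he =>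
    ⟨(Multiset.mem_filter.1 (Multiset.mem_filter.1 he).1).2, (Multiset.mem_filter.1 he).2⟩
  have mT : ∀ e ∈ ((E.filter (2 ∣ ·)).filter (8 ∣ ·)).filter fun e => ¬ 16 ∣ e, 8 ∣ e ∧ ¬ 16 ∣ e :=
    fun e he => ⟨(Multiset.mem_filter.1 (Multiset.mem_filter.1 he).1).2, (Multiset.mem_filter.1 he).2⟩
  have mF : ∀ e ∈ ((E.filter (2 ∣ ·)).filter (8 ∣ ·)).filter (16 ∣ ·), 16 ∣ e := fun e he =>
    (Multiset.mem_filter.1 he).2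
  rw [← e3] at e2
  rw [← e2] at e1
  generalize (E.filter fun e => ¬ 2 ∣ e) = O at *
  generalize ((E.filter (2 ∣ ·)).filter fun e => ¬ 8 ∣ e) = W at *
  generalize (((E.filter (2 ∣ ·)).filter (8 ∣ ·)).filter fun e => ¬ 16 ∣ e) = T at *
  generalize (((E.filter (2 ∣ ·)).filter (8 ∣ ·)).filter (16 ∣ ·)) = F at *
  clear e2 e3
  subst e1
  have hc := hE.1
  simp only [Multiset.map_add, Multiset.sum_add, Multiset.card_add] at hL hc
  obtain ⟨G, hG⟩ : ∃ G : ℕ → ℕ, G = fun e => ∑ j ∈ Finset.range 64,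
    bit 12 (rg (64 * n) ((1 + j * n) * e)) := ⟨_, rfl⟩
  have hprof : ∀ e, (¬ 2 ∣ e → 21 ≤ G e ∧ G e ≤ 22) ∧ (2 ∣ e → ¬ 8 ∣ e → 20 ≤ G e ∧ G e ≤ 24) ∧
      (8 ∣ e → ¬ 16 ∣ e → 16 ≤ G e ∧ G e ≤ 24 ∧ 8 ∣ G e) ∧
      (16 ∣ e → G e = 0 ∨ G e = 16 ∨ G e = 32 ∨ G e = 64) := fun e => by
    obtain ⟨g, h1, h2⟩ := two_power_profile hn e
    rw [hG]
    rwa [← h1] at h2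
  rw [← hG] at hL
  have bO := sum_bounds fun e he => (hprof e).1 (mO e he)
  have bW := sum_bounds fun e he => (hprof e).2.1 (mW e he).1 (mW e he).2
  have bT := sum_bounds fun e he => ⟨((hprof e).2.2.1 (mT e he).1 (mT e he).2).1,
    ((hprof e).2.2.1 (mT e he).1 (mT e he).2).2.1⟩
  have dT := dvd_sum fun e he => ((hprof e).2.2.1 (mT e he).1 (mT e he).2).2.2
  have bF := sum_bounds (S := F) (G := G) (a := 0) (b := 64) fun e he => by
    have := (hprof e).2.2.2 (mF e he)
    omega
  have dF := dvd_sum (S := F) (G := G) (a := 16) fun e he => by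
    have := (hprof e).2.2.2 (mF e he)
    omega
  have hF3 : F.card = 1 → (F.map G).sum ≠ 48 := by
    intro h1
    obtain ⟨x, rfl⟩ := Multiset.card_eq_one.1 h1
    rw [Multiset.map_singleton, Multiset.sum_singleton]
    have := (hprof x).2.2.2 (mF x (by simp))
    omega
  obtain ⟨ho, hw, ht, hf⟩ := two_power_table hM hpar.symm (by omega) bO bW bT dT bF.2 dF hF3
    (by omega)
  clear bO bW bT dT bF dF hF3 hprof hG hL hpar hM hc mT
  obtain rfl := Multiset.card_eq_zero.1 ht
  obtain ⟨w, rfl⟩ := Multiset.card_eq_one.1 hw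
  have hE' : Valid (16 * (4 * n)) (F + (O + {w})) := by
    rw [← mul_assoc]
    rwa [add_zero, add_assoc, add_comm {w} O] at hE
  have h16 : ∀ p, p.Prime → p ∣ 16 → p ∣ 4 * n := fun p hp hd => (pow2 4 p hp hd).mul_left 4
  have movers : ∀ m k a b c d, (∀ r < 6, a ≤ col m 16 r ∧ col m 16 r ≤ b) →
      (∀ r < 6, c ≤ 2 * col m 8 r ∧ 2 * col m 8 r ≤ d) →
      (∀ r < 6, c ≤ 4 * col m 4 r ∧ 4 * col m 4 r ≤ d) →
      2 * a + c ≤ ∑ j ∈ Finset.range 16, cnt (16 * (4 * n)) m (k + j * (4 * n)) (O + {w}) ∧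
      ∑ j ∈ Finset.range 16, cnt (16 * (4 * n)) m (k + j * (4 * n)) (O + {w}) ≤ 2 * b + d := by
    intro m k a b c d h1 h2 h3
    rw [sum_coset_cnt, Multiset.map_add, Multiset.sum_add, Multiset.map_singleton,
      Multiset.sum_singleton]
    have b1 := sum_bounds (S := O) (a := a) (b := b)
      (G := fun e => ∑ j ∈ Finset.range 16, bit m (rg (16 * (4 * n)) ((k + j * (4 * n)) * e)))
      fun e he => by
        obtain ⟨r, hr, h⟩ := sixteen_odd (m := m) (k := k) (n := 4 * n) (by omega) (mO e he)
        rw [h]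
        exact h1 r hr
    have b2 : c ≤ ∑ j ∈ Finset.range 16, bit m (rg (16 * (4 * n)) ((k + j * (4 * n)) * w)) ∧
        ∑ j ∈ Finset.range 16, bit m (rg (16 * (4 * n)) ((k + j * (4 * n)) * w)) ≤ d := by
      obtain ⟨h4, h5⟩ := mW w (by simp)
      obtain ⟨r, hr, h | h⟩ := sixteen_even (m := m) (k := k) (n := 4 * n) (by omega) h4 h5
      · rw [h]
        exact h2 r hr
      · rw [h]
        exact h3 r hr
    rw [ho] at b1
    omega
  have hP : Pair (16 * (4 * n)) F := by
    refine ⟨hf, fun k hk => ?_⟩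
    have h1 := (hE'.lsum (by omega)).ramified_sum h16 hk
    simp_rw [cnt_add _ _ _ F] at h1
    rw [Finset.sum_add_distrib, sum_coset_fixed mF, Finset.card_range] at h1
    have h2 := movers 12 k 5 6 4 8 (by decide +kernel) (by decide +kernel) (by decide +kernel)
    omega
  refine hE'.no_balanced_movers (by norm_num) (by omega) h16 mF hP fun m k hm => ?_
  rcases hm with rfl | rfl
  · have := movers 11 k 7 9 4 12 (by decide +kernel) (by decide +kernel) (by decide +kernel)
    omega
  · have := movers 14 k 7 9 4 12 (by decide +kernel) (by decide +kernel) (by decide +kernel)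
    omega

theorem dvd_div_gcd {N q e : ℕ} (hq : q ∣ N) (he : Nat.Coprime e q) : q ∣ N / Nat.gcd e N := by
  refine (Nat.Coprime.coprime_dvd_left (Nat.gcd_dvd_left e N) he).symm.dvd_of_dvd_mul_left ?_
  rwa [Nat.mul_div_cancel' (Nat.gcd_dvd_right e N)]

theorem good_of_search {s N N₀ Q C r kp up k : ℕ} {Xs : List (List ℕ)} {X : List ℕ} {F M : Multiset ℕ}
    (h : search N₀ Q C r kp up Xs = true) (hN₀ : N₀ = s * N) (hN : 1 < N₀) (hX : X ∈ Xs)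
    (hk : Nat.Coprime k N) (hE : Valid N (F + M))
    (hF : F.map (fun x => s * (k * x % N)) = ↑X) (hM : M.card = r + 2) (hr : F.card + r = 3)
    (hQ : ∀ e ∈ M, Q ∣ N / Nat.gcd e N) : Good N (F + M) := by
  subst hN₀
  have hs : 0 < s := Nat.pos_of_mul_pos_right (by omega : 0 < s * N)
  have hN' : 0 < N := Nat.pos_of_mul_pos_left (by omega : 0 < s * N)
  have hlt : ∀ x, s * (k * x % N) < s * N := fun x => Nat.mul_lt_mul_of_pos_left (Nat.mod_lt _ hN') hs
  have hmap : ((F + M).map fun x => k * x % N).map (s * ·) =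
      ↑X + M.map fun x => s * (k * x % N) := by
    rw [Multiset.map_map, Multiset.map_add, ← hF]
    rfl
  have hv := (valid_scale hs hN' _).2 (hE.map hk)
  rw [hmap] at hv
  refine Good.of_map hk ((good_scale hs _).1 ?_)
  rw [hmap]
  refine search_sound hN h hX (by simpa using hM) (by rw [← hr, ← Multiset.coe_card, ← hF]; simp)
    ⟨hv, fun x hx => ?_, fun e he => ?_⟩
  · rw [← Multiset.mem_coe, ← hF] at hx
    obtain ⟨y, -, rfl⟩ := Multiset.mem_map.1 hx
    exact hlt y
  · obtain ⟨y, hy, rfl⟩ := Multiset.mem_map.1 he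
    refine ⟨hlt y, ?_⟩
    rw [Nat.gcd_mul_left, Nat.mul_div_mul_left _ _ hs, ← Nat.gcd_rec, Nat.gcd_comm,
      Nat.Coprime.gcd_mul_left_cancel y hk]
    exact hQ y hy

theorem dvd_of_primitive {N c : ℕ} {E : Multiset ℕ} (hN : 0 < N)
    (hprim : ∀ p, p.Prime → p ∣ N → ¬ ∀ e ∈ E, p ∣ e) (h : ∀ e ∈ E, N ∣ c * e) : N ∣ c := by
  obtain ⟨g, N', c', hg, hc, rfl, rfl⟩ := Nat.exists_coprime' (Nat.gcd_pos_of_pos_left c hN)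
  by_cases h1 : N' = 1
  · simp [h1]
  · obtain ⟨p, hp, hpN⟩ := Nat.exists_prime_and_dvd h1
    refine absurd (fun e he => hpN.trans (hc.dvd_of_dvd_mul_left ?_)) (hprim p hp (hpN.mul_right g))
    have := h e he
    rw [mul_right_comm] at this
    exact Nat.dvd_of_mul_dvd_mul_right hg this

theorem odd_of_never_ten : ∀ e < 10, e % 5 ≠ 0 →
    (∀ k < 10, Nat.gcd k 10 = 1 → bit 12 (rg 10 (k * e)) = 0) → e % 2 = 1 := by
  decide +kernel

theorem hit_five : ∀ e < 5, e ≠ 0 → ∃ k < 5, Nat.gcd k 5 = 1 ∧ bit 12 (rg 5 (k * e)) = 1 := by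
  decide +kernel

set_option maxHeartbeats 0 in
theorem search_150 : search 150 50 150 3 20 100 [[]] = true := by
  decide +kernel

set_option maxHeartbeats 0 in
theorem search_660 : search 660 11 660 3 20 100 [[]] = true := by
  decide +kernel

set_option maxHeartbeats 0 in
theorem search_10560 : search 10560 11 660 2 12 100 [[5280]] = true := by
  decide +kernel

set_option maxHeartbeats 0 in
theorem search_960 : search 960 1 960 3 20 100 [[]] = true := by
  decide +kernel

set_option maxHeartbeats 0 in
theorem search_20160 : search 20160 7 336 1 12 100 (reps.map fun r => [168 * r.1, 168 * r.2]) = true := by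
  decide +kernel

set_option maxHeartbeats 0 in
theorem search_2880 : search 2880 9 720 1 10 100 (reps.map fun r => [24 * r.1, 24 * r.2]) = true := by
  decide +kernel

theorem good_of_pair {N N₀ Q C kp up d : ℕ} {F M : Multiset ℕ}
    (h : search N₀ Q C 1 kp up (reps.map fun r => [d * r.1, d * r.2]) = true) (hd : N₀ = 120 * d)
    (hN₀ : N ∣ N₀) (hN : 0 < N) (hd0 : 0 < d) (hF : Pair N F) (hE : Valid N (F + M))
    (hQ : ∀ e ∈ M, Q ∣ N / Nat.gcd e N) : Good N (F + M) := by
  obtain ⟨k, hk, a, b, rfl, r, hr, ha, hb⟩ := (hF.shape hN hE).2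
  obtain ⟨s, hs⟩ := hN₀
  have tr : ∀ {x y}, 120 * (k * x % N) = N * y → s * (k * x % N) = d * y := fun {x y} hx => by
    have h1 : 120 * (s * (k * x % N)) = 120 * (d * y) := by
      rw [mul_left_comm, hx, ← mul_assoc, ← mul_assoc, ← hd, hs, mul_comm s]
    omega
  have hc := hE.1
  rw [Multiset.card_add, hF.card] at hc
  refine good_of_search (s := s) (k := k) h (by rw [hs, mul_comm]) (by omega)
    (List.mem_map.2 ⟨r, hr, rfl⟩) hk hE ?_ (by omega) (by rw [hF.card]) hQ
  simp [tr ha, tr hb]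
  rfl

section
variable {N : ℕ} {E : Multiset ℕ}

theorem good_of_search_empty {N₀ Q C kp up : ℕ} (h : search N₀ Q C 3 kp up [[]] = true) (hN : N ∣ N₀)
    (h1 : 1 < N₀) (hE : Valid N E) (hQ : ∀ e ∈ E, Q ∣ N / Nat.gcd e N) : Good N E := by
  obtain ⟨s, hs⟩ := hN
  have := good_of_search (s := s) (k := 1) (F := 0) (M := E) h (by rw [hs, mul_comm]) h1
    (List.mem_singleton_self _) (Nat.coprime_one_left _) (by rwa [zero_add]) rfl hE.1 rfl hQ
  rwa [zero_add] at this

theorem good_of_twenty_five (hN : 0 < N) (hE : Valid N E)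
    (hprim : ∀ p, p.Prime → p ∣ N → ¬ ∀ e ∈ E, p ∣ e) (h : 25 ∣ N) : Good N E := by
  obtain ⟨n, rfl⟩ : 5 ∣ N := (by norm_num : 5 ∣ 25).trans h
  have hn : 0 < n := by omega
  have h5 : 5 ∣ n := by omega
  have e1 := Multiset.filter_add_not (5 ∣ ·) E
  have hs := split_prime Nat.prime_five E
  have hM := not_imp_comm.1 forall_dvd_of_card (hprim 5 Nat.prime_five ⟨n, rfl⟩)
  rw [← e1] at hE
  obtain ⟨-, hF, hk⟩ := hE.ramified_five hn Nat.prime_five (e1.symm ▸ hs) hM (by norm_num) h5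
  rw [hF, zero_add] at e1 hE
  rw [e1] at hE hk
  have h5e : ∀ e ∈ E, ¬ 5 ∣ e := fun e he => by
    rw [← e1] at he
    exact (Multiset.mem_filter.1 he).2
  have hdvd : 5 * n ∣ 50 := dvd_of_primitive hN hprim fun e he => by
    have h5' := h5e e he
    have : 10 * e % n = 0 := by
      rcases order_of_never hn fun k hkn => bit_of_cnt (hk k hkn) e he with h | h | h
      · have := h5.trans (Nat.dvd_of_mod_eq_zero h)
        omega
      · have := h5.trans (Nat.dvd_of_mod_eq_zero h)
        omega
      · exact h
    obtain ⟨c, hc⟩ := Nat.dvd_of_mod_eq_zero this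
    exact ⟨c, by rw [mul_assoc, ← hc]; ring⟩
  have hn10 : n ≤ 10 := by
    have := Nat.le_of_dvd (by norm_num) hdvd
    omega
  obtain ⟨e0, he0⟩ : ∃ e, e ∈ E := Multiset.card_pos_iff_exists_mem.1 (by rw [hE.1]; norm_num)
  have hcase : n = 5 ∨ n = 10 := by omega
  rcases hcase with rfl | rfl
  · obtain ⟨k, -, h1, h2⟩ := hit_five (e0 % 5) (Nat.mod_lt _ (by norm_num))
      fun h => h5e e0 he0 (Nat.dvd_of_mod_eq_zero h)
    have := bit_of_cnt (hk k h1) e0 he0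
    rw [rg_congr (b := k * (e0 % 5)) (by simp [Nat.mul_mod]), h2] at this
    omega
  · refine good_of_search_empty search_150 (by norm_num) (by norm_num) hE fun e he =>
      dvd_div_gcd (by norm_num) ?_
    have h2 : e % 10 % 2 = 1 := odd_of_never_ten (e % 10) (Nat.mod_lt _ (by norm_num))
      (fun h => h5e e he (by omega)) fun k _ hk10 => by
        rw [rg_congr (b := k * e) (by simp [Nat.mul_mod])]
        exact bit_of_cnt (hk k hk10) e he
    have c2 : Nat.Coprime e 2 := ((Nat.Prime.coprime_iff_not_dvd Nat.prime_two).2 (by omega)).symm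
    have c5 : Nat.Coprime e 5 := ((Nat.Prime.coprime_iff_not_dvd Nat.prime_five).2 (h5e e he)).symm
    exact (c2.mul_right c5).mul_right c5

theorem Pair.dvd_eleven {F : Multiset ℕ} (hN : 0 < N) (h11 : 11 ∣ N) (hF : Pair N F) :
    ∀ e ∈ F, 11 ∣ e := fun e he => by
  have := h11.trans (hF.order hN e he)
  omega

theorem good_of_primitive (hN : 0 < N) (hE : Valid N E)
    (hprim : ∀ p, p.Prime → p ∣ N → ¬ ∀ e ∈ E, p ∣ e) : Good N E := by
  have hM : ∀ p, p.Prime → p ∣ N → 1 ≤ (E.filter fun e => ¬ p ∣ e).card := fun p hp hd =>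
    not_imp_comm.1 forall_dvd_of_card (hprim p hp hd)
  have e1 : ∀ p, E.filter (p ∣ ·) + E.filter (fun e => ¬ p ∣ e) = E := fun p =>
    Multiset.filter_add_not _ _
  have hv : ∀ p, Valid N (E.filter (p ∣ ·) + E.filter fun e => ¬ p ∣ e) := fun p => by rwa [e1]
  have hsp : ∀ p, p.Prime → Split p (E.filter (p ∣ ·) + E.filter fun e => ¬ p ∣ e)
      (E.filter (p ∣ ·)) (E.filter fun e => ¬ p ∣ e) := fun p hp => by
    rw [e1]
    exact split_prime hp E
  have p7 : Nat.Prime 7 := by norm_num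
  have p11 : Nat.Prime 11 := by norm_num
  have cop : ∀ p, p.Prime → ∀ e ∈ E.filter (fun e => ¬ p ∣ e), Nat.Coprime e p := fun p hp =>
    (hsp p hp).moved
  have c2 : ¬ 2 ^ (6 + 1) ∣ N := fun h =>
    hprim 2 Nat.prime_two (((by norm_num : 2 ∣ 2 ^ (6 + 1))).trans h) (hE.two_power hN h)
  have c3 : ¬ 3 ^ (2 + 1) ∣ N := fun h =>
    hprim 3 Nat.prime_three (((by norm_num : 3 ∣ 3 ^ (2 + 1))).trans h) (hE.twenty_seven hN h)
  have c13 : ∀ p, p.Prime → 13 ≤ p → ¬ p ∣ N := fun p hp h13 h =>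
    hprim p hp h (hE.large_prime hN hp h13 h)
  by_cases c25 : 25 ∣ N
  · exact good_of_twenty_five hN hE hprim c25
  have c5 : ¬ 5 ^ (1 + 1) ∣ N := c25
  have c49 : ¬ 49 ∣ N := fun h => by
    have hd : 7 ∣ N := (by norm_num : 7 ∣ 49).trans h
    have hM7 := hM 7 p7 hd
    obtain ⟨n, rfl⟩ := hd
    exact (hv 7).ramified_one (by omega) p7 (hsp 7 p7) hM7 (by norm_num) le_rfl (by omega)
  have c121 : ¬ 121 ∣ N := fun h => by
    have hd : 11 ∣ N := (by norm_num : 11 ∣ 121).trans h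
    have hM11 := hM 11 p11 hd
    obtain ⟨n, rfl⟩ := hd
    have := ((hv 11).ramified_five (by omega) p11 (hsp 11 p11) hM11 (by norm_num) (by omega)).1
    omega
  have seven : 7 ∣ N → Pair N (E.filter (7 ∣ ·)) := fun hd => by
    have hM7 := hM 7 p7 hd
    obtain ⟨n, rfl⟩ := hd
    exact ((hv 7).tame_one (by omega) p7 (hsp 7 p7) hM7 (by norm_num) le_rfl (by omega)).2
  have nine : 9 ∣ N → Pair N (E.filter (3 ∣ ·)) := fun h => by
    have hd : 3 ∣ N := (by norm_num : 3 ∣ 9).trans h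
    have hM3 := hM 3 Nat.prime_three hd
    obtain ⟨n, rfl⟩ := hd
    exact (hv 3).pair_of_three (by omega) (hsp 3 Nat.prime_three) hM3 (by omega)
  by_cases h11 : 11 ∣ N
  · have cop11 : ∀ e ∈ E.filter (fun e => ¬ 11 ∣ e), 11 ∣ N / Nat.gcd e N := fun e he =>
      dvd_div_gcd h11 (cop 11 p11 e he)
    have hM11 := hM 11 p11 h11
    have key : (E.filter (11 ∣ ·) = 0 ∧ ∀ e ∈ E.filter (fun e => ¬ 11 ∣ e), N ∣ 660 * e) ∨
        ∃ x, E.filter (11 ∣ ·) = {x} ∧ 2 * x % N = 0 ∧ x % N ≠ 0 := by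
      obtain ⟨n, rfl⟩ := h11
      exact ((hv 11).tame_five (by omega) p11 (hsp 11 p11) hM11 (by norm_num) le_rfl (by omega)).2
    rcases key with ⟨hF, h⟩ | ⟨x, hF, hx1, hx2⟩
    · have hEM := e1 11
      rw [hF, zero_add] at hEM
      rw [hEM] at h cop11
      exact good_of_search_empty search_660 (dvd_of_primitive hN hprim h) (by norm_num) hE cop11
    · have nopair : ∀ p, ¬ Pair N (E.filter (p ∣ ·)) := fun p hp => by
        have h1 := hp.dvd_eleven hN h11
        have h2 : E.filter (p ∣ ·) ≤ E.filter (11 ∣ ·) := by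
          rw [← Multiset.filter_eq_self.2 h1]
          exact Multiset.filter_le_filter _ (Multiset.filter_le _ _)
        have h3 := Multiset.card_le_card h2
        rw [hp.card, hF, Multiset.card_singleton] at h3
        omega
      have c7 : ¬ 7 ^ (0 + 1) ∣ N := fun h => nopair 7 (seven h)
      have c9 : ¬ 3 ^ (1 + 1) ∣ N := fun h => nopair 3 (nine h)
      obtain ⟨s, hs⟩ : N ∣ 10560 := dvd_of_caps c2 c9 c5 c7 (e := 1) c121 c13
      have hv11 := hv 11
      have hc := hv11.1
      rw [Multiset.card_add, hF, Multiset.card_singleton] at hc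
      rw [← e1 11]
      refine good_of_search (s := s) (k := 1) search_10560 (by rw [hs, mul_comm]) (by norm_num)
        (List.mem_singleton_self _) (Nat.coprime_one_left _) hv11 ?_ (by omega)
        (by rw [hF, Multiset.card_singleton]) cop11
      have h2 : 2 * (x % N) = N := by
        have h3 := Nat.mod_lt x hN
        obtain ⟨c, hc⟩ : N ∣ 2 * (x % N) := Nat.dvd_of_mod_eq_zero (by rw [Nat.mul_mod_mod, hx1])
        have : c = 1 := by nlinarith [Nat.pos_of_ne_zero hx2]
        rw [hc, this, mul_one]
      have h3 : s * (x % N) = 5280 := by nlinarith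
      rw [hF]
      simp [h3]
  have c11 : ¬ 11 ^ (0 + 1) ∣ N := h11
  by_cases h7 : 7 ∣ N
  · rw [← e1 7]
    exact good_of_pair search_20160 (by norm_num) (dvd_of_caps c2 c3 c5 (d := 1) c49 c11 c13) hN
      (by norm_num) (seven h7) (hv 7) fun e he => dvd_div_gcd h7 (cop 7 p7 e he)
  have c7 : ¬ 7 ^ (0 + 1) ∣ N := h7
  by_cases h9 : 9 ∣ N
  · rw [← e1 3]
    exact good_of_pair search_2880 (by norm_num) (dvd_of_caps c2 c3 c5 c7 c11 c13) hN
      (by norm_num) (nine h9) (hv 3) fun e he => dvd_div_gcd h9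
        ((cop 3 Nat.prime_three e he).pow_right 2)
  exact good_of_search_empty search_960 (dvd_of_caps c2 (b := 1) h9 c5 c7 c11 c13) (by norm_num) hE
    fun e _ => one_dvd _

theorem Valid.good (hN : 0 < N) (hE : Valid N E) : Good N E := by
  induction N using Nat.strong_induction_on generalizing E with
  | _ N ih =>
  by_cases h : ∀ p, p.Prime → p ∣ N → ¬ ∀ e ∈ E, p ∣ e
  · exact good_of_primitive hN hE h
  · push Not at h
    obtain ⟨p, hp, ⟨n, rfl⟩, hd⟩ := h
    obtain ⟨E', rfl⟩ := exists_eq_map_mul hd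
    have hn : 0 < n := Nat.pos_of_mul_pos_left hN
    exact (good_scale hp.pos E').2 (ih n (by nlinarith [hp.two_le]) hn
      ((valid_scale hp.pos hn E').1 hE))

end

theorem exists_ringEquiv_extend {F : Type} [Field F] [Algebra F ℂ] (τ : F ≃+* F) :
    ∃ σ : ℂ ≃+* ℂ, ∀ x, σ (algebraMap F ℂ x) = algebraMap F ℂ (τ x) := by
  obtain ⟨ι, v, hv⟩ := exists_isTranscendenceBasis' F ℂ
  let _ := IsAlgClosed.isAlgClosure_of_transcendence_basis v hv
  let R := Algebra.adjoin F (Set.range v)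
  let e : R ≃+* R := hv.1.aevalEquiv.symm.toRingEquiv.trans
    ((MvPolynomial.mapEquiv ι τ).trans hv.1.aevalEquiv.toRingEquiv)
  refine ⟨IsAlgClosure.equivOfEquiv ℂ ℂ e, fun x => ?_⟩
  have he : e (algebraMap F R x) = algebraMap F R (τ x) := by
    simp only [e, RingEquiv.trans_apply, AlgEquiv.coe_ringEquiv,
      AlgEquiv.commutes, MvPolynomial.algebraMap_eq, MvPolynomial.mapEquiv_apply,
      MvPolynomial.map_C]
    rw [← MvPolynomial.algebraMap_eq, AlgEquiv.commutes]
    rfl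
  rw [IsScalarTower.algebraMap_apply F R ℂ, IsAlgClosure.equivOfEquiv_algebraMap, he,
    ← IsScalarTower.algebraMap_apply]

theorem exists_ringEquiv_pow_aux {N k : ℕ} [NeZero N] (hk : Nat.Coprime k N)
    (F : Type) [Field F] [NumberField F] [IsCyclotomicExtension {N} ℚ F] [Algebra F ℂ] :
    ∃ σ : ℂ ≃+* ℂ, ∀ x : ℂ, x ^ N = 1 → σ x = x ^ k := by
  let u := ZMod.unitOfCoprime k hk
  let τ : Gal(F/ℚ) := (IsCyclotomicExtension.Rat.galEquivZMod N F).symm u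
  obtain ⟨σ, hσ⟩ := exists_ringEquiv_extend (τ : F ≃+* F)
  refine ⟨σ, fun x hx => ?_⟩
  have hζ := (IsCyclotomicExtension.zeta_spec N ℚ F).map_of_injective (algebraMap F ℂ).injective
  obtain ⟨j, -, rfl⟩ := hζ.eq_pow_of_pow_eq_one hx
  have h1 : τ (IsCyclotomicExtension.zeta N ℚ F) = IsCyclotomicExtension.zeta N ℚ F ^ k := by
    rw [IsCyclotomicExtension.Rat.galEquivZMod_apply_of_pow_eq N F τ
      (IsCyclotomicExtension.zeta_spec N ℚ F).pow_eq_one]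
    rw [MulEquiv.apply_symm_apply, ZMod.coe_unitOfCoprime, ZMod.val_natCast]
    exact (pow_eq_pow_mod _ (IsCyclotomicExtension.zeta_spec N ℚ F).pow_eq_one).symm
  rw [map_pow, hσ]
  change algebraMap F ℂ (τ _) ^ j = _
  rw [h1, map_pow, ← pow_mul, ← pow_mul, mul_comm]

theorem exists_ringEquiv_pow {N k : ℕ} (hN : 0 < N) (hk : Nat.Coprime k N) :
    ∃ σ : ℂ ≃+* ℂ, ∀ x : ℂ, x ^ N = 1 → σ x = x ^ k := by
  have : NeZero N := ⟨hN.ne'⟩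
  let _ : Algebra (CyclotomicField N ℚ) ℂ :=
    (IsAlgClosed.lift : CyclotomicField N ℚ →ₐ[ℚ] ℂ).toRingHom.toAlgebra
  have : IsCyclotomicExtension {N} ℚ (CyclotomicField N ℚ) := by
    have h : CyclotomicField.algebra N ℚ = DivisionRing.toRatAlgebra := Subsingleton.elim _ _
    have := CyclotomicField.isCyclotomicExtension N ℚ
    rw [h] at this
    exact this
  exact exists_ringEquiv_pow_aux hk (CyclotomicField N ℚ)

theorem prod_sign {ι : Type*} (s : Finset ι) (f : ι → ℝ) (hf : ∀ i ∈ s, f i ≠ 0) :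
    (0 < ∏ i ∈ s, f i ∧ Even (s.filter fun i => f i < 0).card) ∨
      (∏ i ∈ s, f i < 0 ∧ Odd (s.filter fun i => f i < 0).card) := by
  classical
  induction s using Finset.induction_on with
  | empty => simp
  | insert a s ha ih =>
    have h := ih fun i hi => hf i (Finset.mem_insert_of_mem hi)
    rw [Finset.prod_insert ha, Finset.filter_insert]
    rcases lt_or_gt_of_ne (hf a (Finset.mem_insert_self a s)) with h1 | h1
    · rw [if_pos h1, Finset.card_insert_of_notMem (by simp [ha])]
      rcases h with ⟨h2, h3⟩ | ⟨h2, h3⟩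
      · exact Or.inr ⟨mul_neg_of_neg_of_pos h1 h2, h3.add_one⟩
      · exact Or.inl ⟨mul_pos_of_neg_of_neg h1 h2, h3.add_one⟩
    · rw [if_neg h1.not_gt]
      rcases h with ⟨h2, h3⟩ | ⟨h2, h3⟩
      · exact Or.inl ⟨mul_pos h1 h2, h3⟩
      · exact Or.inr ⟨mul_neg_of_pos_of_neg h1 h2, h3⟩

theorem Dv_le {N z : ℕ} (hz : z < N) : Dv N z ≤ 2 * N := by
  rw [Dv_eq]
  split_ifs <;> omega

theorem sin_eq_cos_Dv {N z : ℕ} (hz : z < N) :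
    Real.sin (2 * Real.pi * z / N) = Real.cos (Real.pi * Dv N z / (2 * N)) := by
  have hN : (N : ℝ) ≠ 0 := by
    have : 0 < N := by omega
    positivity
  rw [Dv_eq, ← Real.cos_pi_div_two_sub]
  split_ifs with h1 h2
  · rw [Nat.cast_sub h1.le]
    congr 1
    field_simp
    push_cast
    ring
  · rw [Nat.cast_sub (by omega), ← Real.cos_neg]
    congr 1
    field_simp
    push_cast
    ring
  · rw [Nat.cast_sub (by omega), ← Real.cos_add_two_pi]
    congr 1
    field_simp
    push_cast
    ring

theorem sin_lt_sin_iff {N z w : ℕ} (hz : z < N) (hw : w < N) :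
    Real.sin (2 * Real.pi * z / N) < Real.sin (2 * Real.pi * w / N) ↔ Dv N w < Dv N z := by
  rw [sin_eq_cos_Dv hz, sin_eq_cos_Dv hw]
  have hN : (0 : ℝ) < N := by
    have : 0 < N := by omega
    positivity
  have key : ∀ v < N, Real.pi * Dv N v / (2 * N) ∈ Set.Icc 0 Real.pi := fun v hv => by
    have h : (Dv N v : ℝ) ≤ 2 * N := by exact_mod_cast Dv_le hv
    refine ⟨by positivity, ?_⟩
    rw [div_le_iff₀ (by positivity)]
    exact mul_le_mul_of_nonneg_left h Real.pi_pos.le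
  rw [Real.strictAntiOn_cos.lt_iff_gt (key z hz) (key w hw),
    div_lt_div_iff_of_pos_right (by positivity), mul_lt_mul_iff_right₀ Real.pi_pos, Nat.cast_lt]

theorem cos_lt_iff {t : ℝ} (h0 : 0 ≤ t) (h1 : t ≤ 2 * Real.pi) :
    1 + 2 * Real.cos t < 0 ↔ 2 * Real.pi / 3 < t ∧ t < 4 * Real.pi / 3 := by
  have hpi := Real.pi_pos
  have hc : Real.cos (2 * Real.pi / 3) = -(1 / 2) := by
    rw [← Real.cos_pi_div_three, ← Real.cos_pi_sub]
    congr 1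
    ring
  have key : ∀ s, 0 ≤ s → s ≤ Real.pi → (1 + 2 * Real.cos s < 0 ↔ 2 * Real.pi / 3 < s) := by
    intro s hs0 hs1
    rw [← Real.strictAntiOn_cos.lt_iff_gt ⟨hs0, hs1⟩
      (⟨by positivity, by linarith⟩ : 2 * Real.pi / 3 ∈ Set.Icc 0 Real.pi), hc]
    constructor <;> intro h <;> linarith
  rcases le_total t Real.pi with h | h
  · rw [key t h0 h]
    exact ⟨fun h => ⟨h, by linarith⟩, fun h => h.1⟩
  · rw [← Real.cos_two_pi_sub, key _ (by linarith) (by linarith)]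
    exact ⟨fun h => ⟨by linarith, by linarith⟩, fun h => by linarith [h.2]⟩

theorem cos_eq_zero_of {t : ℝ} (h : t = 2 * Real.pi / 3 ∨ t = 4 * Real.pi / 3) :
    1 + 2 * Real.cos t = 0 := by
  have hc : Real.cos (2 * Real.pi / 3) = -(1 / 2) := by
    rw [← Real.cos_pi_div_three, ← Real.cos_pi_sub]
    congr 1
    ring
  rcases h with rfl | rfl
  · rw [hc]; norm_num
  · rw [← Real.cos_two_pi_sub, show 2 * Real.pi - 4 * Real.pi / 3 = 2 * Real.pi / 3 by ring, hc]
    norm_num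

theorem root_mod {N : ℕ} (hN : 0 < N) (z : ℕ) :
    Complex.exp (2 * Real.pi * Complex.I * z / N) =
      Complex.exp ((2 * Real.pi * (z % N : ℕ) / N : ℝ) * Complex.I) := by
  have hN' : (N : ℂ) ≠ 0 := by exact_mod_cast hN.ne'
  rw [Complex.exp_eq_exp_iff_exists_int]
  obtain ⟨q, hq⟩ : ∃ q : ℕ, z = N * q + z % N := ⟨z / N, (Nat.div_add_mod z N).symm⟩
  refine ⟨q, ?_⟩
  have h : (z : ℂ) = (N : ℂ) * q + (z % N : ℕ) := by exact_mod_cast hq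
  generalize z % N = r at h
  push_cast
  rw [h]
  field_simp
  ring

theorem pat_of_pos {N : ℕ} (hN : 0 < N) (e : Fin 5 → ℕ) (x : Fin 5 → ℂ)
    (hx : ∀ i, x i = Complex.exp (2 * Real.pi * Complex.I * e i / N))
    (hpos : ∀ i, 0 < (1 + 2 * (x i).re) * ∏ j ∈ Finset.univ.erase i, ((x i).im - (x j).im)) :
    Pat N (Finset.univ.val.map e) := by
  have hmod : ∀ i, e i % N < N := fun i => Nat.mod_lt _ hN
  have him : ∀ i, (x i).im = Real.sin (2 * Real.pi * (e i % N : ℕ) / N) := fun i => by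
    rw [hx, root_mod hN, Complex.exp_ofReal_mul_I_im]
  have hre : ∀ i, (x i).re = Real.cos (2 * Real.pi * (e i % N : ℕ) / N) := fun i => by
    rw [hx, root_mod hN, Complex.exp_ofReal_mul_I_re]
  have hNR : (0 : ℝ) < N := by exact_mod_cast hN
  have hne : ∀ i j, i ≠ j → (x i).im - (x j).im ≠ 0 := fun i j hij h0 => by
    have := hpos i
    rw [Finset.prod_eq_zero (Finset.mem_erase.2 ⟨hij.symm, Finset.mem_univ j⟩) h0, mul_zero] at this
    exact this.false
  have hlt : ∀ i j, (x i).im < (x j).im ↔ Dv N (e j % N) < Dv N (e i % N) := fun i j => by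
    rw [him, him, sin_lt_sin_iff (hmod i) (hmod j)]
  refine ⟨?_, ?_⟩
  · rw [Multiset.map_map]
    refine Multiset.Nodup.map ?_ Finset.univ.nodup
    intro i j hij
    by_contra hne'
    rcases lt_or_gt_of_ne (sub_ne_zero.1 (hne i j hne')) with h | h <;> rw [hlt] at h <;>
      exact absurd hij (by simp only [Function.comp_apply]; omega)
  · intro z hz
    obtain ⟨i, -, rfl⟩ := Multiset.mem_map.1 hz
    have hi := hpos i
    have hcz : 1 + 2 * (x i).re ≠ 0 := fun h => by simp [h] at hi
    refine ⟨fun h => hcz ?_, fun h => hcz ?_, ?_⟩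
    · rw [hre]
      refine cos_eq_zero_of (Or.inl ?_)
      have h' : 3 * ((e i % N : ℕ) : ℝ) = N := by exact_mod_cast h
      rw [← h']
      have : ((e i % N : ℕ) : ℝ) ≠ 0 := by intro h0; rw [h0] at h'; linarith
      field_simp
    · rw [hre]
      refine cos_eq_zero_of (Or.inr ?_)
      have h' : 3 * ((e i % N : ℕ) : ℝ) = 2 * N := by exact_mod_cast h
      field_simp
      linarith
    · have hcount : (Finset.univ.val.map e).countP (fun y => Dv N (y % N) < Dv N (e i % N)) =
          ((Finset.univ.erase i).filter fun j => (x i).im - (x j).im < 0).card := by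
        rw [Multiset.countP_map]
        change ((Finset.univ : Finset (Fin 5)).filter _).card = _
        congr 1
        ext j
        simp only [Finset.mem_filter, Finset.mem_univ, true_and, Finset.mem_erase, and_true,
          sub_neg, hlt]
        refine ⟨fun h => ⟨fun h' => by simp [h'] at h, h⟩, fun h => h.2⟩
      rw [hcount, isL_iff]
      have hcos : 1 + 2 * (x i).re < 0 ↔ N < 3 * (e i % N) ∧ 3 * (e i % N) < 2 * N := by
        rw [hre, cos_lt_iff (by positivity), div_lt_div_iff₀ (by norm_num) hNR,
          div_lt_div_iff₀ hNR (by norm_num)]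
        · have hp : 0 < 2 * Real.pi := by positivity
          rw [← Nat.cast_lt (α := ℝ), ← Nat.cast_lt (α := ℝ),
            show 2 * Real.pi * ((e i % N : ℕ) : ℝ) * 3 = 2 * Real.pi * (3 * (e i % N : ℕ)) by ring,
            show 4 * Real.pi * (N : ℝ) = 2 * Real.pi * (2 * N) by ring]
          rw [mul_lt_mul_iff_right₀ hp, mul_lt_mul_iff_right₀ hp]
          push_cast
          rfl
        · rw [div_le_iff₀ hNR]
          have : ((e i % N : ℕ) : ℝ) ≤ N := by exact_mod_cast (hmod i).le
          exact mul_le_mul_of_nonneg_left this (by positivity)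
      rw [← hcos]
      rcases prod_sign (Finset.univ.erase i) (fun j => (x i).im - (x j).im)
        (fun j hj => hne i j (Finset.ne_of_mem_erase hj).symm) with ⟨h1, h2⟩ | ⟨h1, h2⟩
      · refine ⟨fun h => absurd hi (mul_neg_of_neg_of_pos h h1).not_gt, fun h => ?_⟩
        exact absurd h2 (Nat.not_even_iff_odd.2 h)
      · refine ⟨fun _ => h2, fun _ => ?_⟩
        by_contra h
        exact absurd hi (mul_nonpos_of_nonneg_of_nonpos (not_lt.1 h) h1.le).not_gt

open ComplexConjugate

theorem laurent_eval {y y' e1 e2 e3 e4 : ℂ} (h : y * y' = 1) :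
    y' ^ 2 * (y ^ 4 - e1 * y ^ 3 + e2 * y ^ 2 - e3 * y + e4) =
      y ^ 2 - e1 * y + e2 - e3 * y' + e4 * y' ^ 2 := by
  linear_combination (y ^ 2 * (y * y' + 1) - e1 * y * (y * y' + 1) + e2 * (y * y' + 1) -
    e3 * y') * h

theorem diag_formula {x a b c e x' a' b' c' e' dx da db dc de : ℂ}
    (hx : x * x' = 1) (ha : a * a' = 1) (hb : b * b' = 1) (hc : c * c' = 1) (he : e * e' = 1)
    (hdet : x * a * b * c * e = 1)
    (h0 : dx + da + db + dc + de = 1)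
    (h1 : x * dx + a * da + b * db + c * dc + e * de = -1)
    (h1' : x' * dx + a' * da + b' * db + c' * dc + e' * de = -1)
    (h2 : x ^ 2 * dx + a ^ 2 * da + b ^ 2 * db + c ^ 2 * dc + e ^ 2 * de =
      x' + a' + b' + c' + e')
    (h2' : x' ^ 2 * dx + a' ^ 2 * da + b' ^ 2 * db + c' ^ 2 * dc + e' ^ 2 * de =
      x + a + b + c + e) :
    x * (1 + (x + x') * dx) * ((x - a) * (x - b) * (x - c) * (x - e)) =
      (1 + x + x ^ 2) * ((1 + x * a) * (1 + x * b) * (1 + x * c) * (1 + x * e)) := by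
  obtain ⟨e1, he1⟩ : ∃ z, z = a + b + c + e := ⟨_, rfl⟩
  obtain ⟨e2, he2⟩ : ∃ z, z = a * b + a * c + a * e + b * c + b * e + c * e := ⟨_, rfl⟩
  obtain ⟨e3, he3⟩ : ∃ z, z = a * b * c + a * b * e + a * c * e + b * c * e := ⟨_, rfl⟩
  obtain ⟨e4, he4⟩ : ∃ z, z = a * b * c * e := ⟨_, rfl⟩
  have hx4 : x * e4 = 1 := by rw [he4]; linear_combination hdet
  have hinv : x' + a' + b' + c' + e' = e4 + x * e3 := by
    have k1 : x' = a * b * c * e := by linear_combination a * b * c * e * hx - x' * hdet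
    have k2 : a' = x * b * c * e := by linear_combination x * b * c * e * ha - a' * hdet
    have k3 : b' = x * a * c * e := by linear_combination x * a * c * e * hb - b' * hdet
    have k4 : c' = x * a * b * e := by linear_combination x * a * b * e * hc - c' * hdet
    have k5 : e' = x * a * b * c := by linear_combination x * a * b * c * he - e' * hdet
    rw [k1, k2, k3, k4, k5, he3, he4]
    ring
  have hq : ∀ y, (y - a) * (y - b) * (y - c) * (y - e) =
      y ^ 4 - e1 * y ^ 3 + e2 * y ^ 2 - e3 * y + e4 := fun y => by
    rw [he1, he2, he3, he4]; ring
  have hr : (1 + x * a) * (1 + x * b) * (1 + x * c) * (1 + x * e) =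
      1 + x * e1 + x ^ 2 * e2 + x ^ 3 * e3 + x ^ 4 * e4 := by
    rw [he1, he2, he3, he4]; ring
  have la := laurent_eval (e1 := e1) (e2 := e2) (e3 := e3) (e4 := e4) ha
  have lb := laurent_eval (e1 := e1) (e2 := e2) (e3 := e3) (e4 := e4) hb
  have lc := laurent_eval (e1 := e1) (e2 := e2) (e3 := e3) (e4 := e4) hc
  have le := laurent_eval (e1 := e1) (e2 := e2) (e3 := e3) (e4 := e4) he
  have lx := laurent_eval (e1 := e1) (e2 := e2) (e3 := e3) (e4 := e4) hx
  rw [← hq] at la lb lc le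
  simp only [sub_self, zero_mul, mul_zero] at la lb lc le
  rw [hq, hr]
  obtain ⟨Q, hQ⟩ : ∃ Q, Q = x ^ 4 - e1 * x ^ 3 + e2 * x ^ 2 - e3 * x + e4 := ⟨_, rfl⟩
  rw [← hQ] at lx ⊢
  have key : x' ^ 2 * Q * dx = (e4 + x * e3) + e1 + e2 + e3 + e4 * (x + e1) := by
    rw [he1] at la lb lc le lx ⊢
    linear_combination dx * lx + da * la + db * lb + dc * lc + de * le + h2 - (a + b + c + e) * h1 +
      e2 * h0 - e3 * h1' + e4 * h2' + hinv
  have key2 : Q * dx = x ^ 3 * e3 + x ^ 2 * (e1 + e2 + e3 + 1) + x * (1 + e1) := by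
    linear_combination x ^ 2 * key - (x * x' + 1) * Q * dx * hx +
      (x * (1 + x + e1)) * hx4
  linear_combination (x ^ 2 + x * x') * key2 + x * hQ +
    (x ^ 3 * e3 + x ^ 2 * (e1 + e2 + e3 + 1) + x * (1 + e1)) * hx -
    (x ^ 3 + x ^ 4 + x ^ 5 - 1) * hx4

theorem sign_aux {x a : ℂ} (hx : x * conj x = 1) (ha : a * conj a = 1) :
    (1 + x * a) * conj (x - a) = -2 * Complex.I * ((x.im - a.im : ℝ) : ℂ) := by
  have h1 := Complex.sub_conj x
  have h2 := Complex.sub_conj a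
  rw [map_sub]
  push_cast at *
  linear_combination a * hx - x * ha - h1 + h2

theorem sign_of_formula {x a b c e r : ℂ}
    (hx : x * conj x = 1) (ha : a * conj a = 1) (hb : b * conj b = 1) (hc : c * conj c = 1)
    (he : e * conj e = 1) (hxa : x ≠ a) (hxb : x ≠ b) (hxc : x ≠ c) (hxe : x ≠ e)
    {t : ℝ} (ht : 0 < t) (hr : r = t)
    (h : x * r * ((x - a) * (x - b) * (x - c) * (x - e)) =
      (1 + x + x ^ 2) * ((1 + x * a) * (1 + x * b) * (1 + x * c) * (1 + x * e))) :
    0 < (1 + 2 * x.re) * ((x.im - a.im) * (x.im - b.im) * (x.im - c.im) * (x.im - e.im)) := by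
  have hre : 1 + x + x ^ 2 = x * ((1 + 2 * x.re : ℝ) : ℂ) := by
    have := Complex.add_conj x
    push_cast at *
    linear_combination x * this - hx
  have hx0 : x ≠ 0 := fun h0 => by simp [h0] at hx
  have h' : (t : ℂ) * ((x - a) * (x - b) * (x - c) * (x - e)) =
      ((1 + 2 * x.re : ℝ) : ℂ) * ((1 + x * a) * (1 + x * b) * (1 + x * c) * (1 + x * e)) := by
    apply mul_left_cancel₀ hx0
    rw [hre] at h
    rw [← hr]
    linear_combination h
  have key : t * (Complex.normSq (x - a) * Complex.normSq (x - b) * Complex.normSq (x - c) *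
      Complex.normSq (x - e)) = 16 * ((1 + 2 * x.re) *
      ((x.im - a.im) * (x.im - b.im) * (x.im - c.im) * (x.im - e.im))) := by
    apply Complex.ofReal_injective
    have I4 : Complex.I ^ 4 = 1 := Complex.I_pow_four
    have sa := sign_aux hx ha
    have sb := sign_aux hx hb
    have sc := sign_aux hx hc
    have se := sign_aux hx he
    simp only [Complex.ofReal_mul, Complex.normSq_eq_conj_mul_self] at *
    generalize conj (x - a) = A at *
    generalize conj (x - b) = B at *
    generalize conj (x - c) = C at *
    generalize conj (x - e) = E at *
    calc _ = (t * ((x - a) * (x - b) * (x - c) * (x - e))) * (A * B * C * E) := by ring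
      _ = ((1 + 2 * x.re : ℝ) : ℂ) * (((1 + x * a) * A) * ((1 + x * b) * B) * ((1 + x * c) * C) *
          ((1 + x * e) * E)) := by rw [h']; ring
      _ = _ := by
        rw [sa, sb, sc, se]
        push_cast
        linear_combination 16 * (1 + 2 * (x.re : ℂ)) * ((x.im - a.im) * (x.im - b.im) *
          (x.im - c.im) * (x.im - e.im)) * I4
  have pos : ∀ z, x ≠ z → 0 < Complex.normSq (x - z) := fun z hz =>
    Complex.normSq_pos.2 (sub_ne_zero.2 hz)
  have := pos a hxa
  have := pos b hxb
  have := pos c hxc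
  have := pos e hxe
  have : 0 < t * (Complex.normSq (x - a) * Complex.normSq (x - b) * Complex.normSq (x - c) *
      Complex.normSq (x - e)) := by positivity
  rw [key] at this
  linarith

theorem sign_pattern (l d : Fin 5 → ℂ) (hl : ∀ i, l i * conj (l i) = 1) (hinj : l.Injective)
    (hdet : ∏ i, l i = 1) (h0 : ∑ i, d i = 1) (h1 : ∑ i, l i * d i = -1)
    (h1' : ∑ i, conj (l i) * d i = -1) (h2 : ∑ i, l i ^ 2 * d i = ∑ i, conj (l i))
    (h2' : ∑ i, conj (l i) ^ 2 * d i = ∑ i, l i)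
    (hT : ∀ i, ∃ t : ℝ, 0 < t ∧ 1 + (l i + conj (l i)) * d i = t) (i : Fin 5) :
    0 < (1 + 2 * (l i).re) * ∏ j ∈ Finset.univ.erase i, ((l i).im - (l j).im) := by
  have key : ∀ x a b c e : Fin 5, x ≠ a → x ≠ b → x ≠ c → x ≠ e →
      l x * l a * l b * l c * l e = 1 →
      d x + d a + d b + d c + d e = 1 →
      l x * d x + l a * d a + l b * d b + l c * d c + l e * d e = -1 →
      conj (l x) * d x + conj (l a) * d a + conj (l b) * d b + conj (l c) * d c +
        conj (l e) * d e = -1 →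
      l x ^ 2 * d x + l a ^ 2 * d a + l b ^ 2 * d b + l c ^ 2 * d c + l e ^ 2 * d e =
        conj (l x) + conj (l a) + conj (l b) + conj (l c) + conj (l e) →
      conj (l x) ^ 2 * d x + conj (l a) ^ 2 * d a + conj (l b) ^ 2 * d b + conj (l c) ^ 2 * d c +
        conj (l e) ^ 2 * d e = l x + l a + l b + l c + l e →
      0 < (1 + 2 * (l x).re) * (((l x).im - (l a).im) * ((l x).im - (l b).im) *
        ((l x).im - (l c).im) * ((l x).im - (l e).im)) := by
    intro x a b c e hxa hxb hxc hxe k k0 k1 k1' k2 k2'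
    obtain ⟨t, ht, hr⟩ := hT x
    exact sign_of_formula (hl x) (hl a) (hl b) (hl c) (hl e) (hinj.ne hxa) (hinj.ne hxb)
      (hinj.ne hxc) (hinj.ne hxe) ht hr
      (diag_formula (hl x) (hl a) (hl b) (hl c) (hl e) k k0 k1 k1' k2 k2')
  simp only [Fin.sum_univ_five, Fin.prod_univ_five] at hdet h0 h1 h1' h2 h2'
  have hi : i = 0 ∨ i = 1 ∨ i = 2 ∨ i = 3 ∨ i = 4 := by revert i; decide
  rcases hi with rfl | rfl | rfl | rfl | rfl
  · rw [show (Finset.univ.erase 0 : Finset (Fin 5)) = {1, 2, 3, 4} by decide]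
    simpa [mul_assoc] using key 0 1 2 3 4 (by decide) (by decide) (by decide) (by decide)
      (by linear_combination hdet) (by linear_combination h0) (by linear_combination h1)
      (by linear_combination h1') (by linear_combination h2) (by linear_combination h2')
  · rw [show (Finset.univ.erase 1 : Finset (Fin 5)) = {0, 2, 3, 4} by decide]
    simpa [mul_assoc] using key 1 0 2 3 4 (by decide) (by decide) (by decide) (by decide)
      (by linear_combination hdet) (by linear_combination h0) (by linear_combination h1)
      (by linear_combination h1') (by linear_combination h2) (by linear_combination h2')
  · rw [show (Finset.univ.erase 2 : Finset (Fin 5)) = {0, 1, 3, 4} by decide]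
    simpa [mul_assoc] using key 2 0 1 3 4 (by decide) (by decide) (by decide) (by decide)
      (by linear_combination hdet) (by linear_combination h0) (by linear_combination h1)
      (by linear_combination h1') (by linear_combination h2) (by linear_combination h2')
  · rw [show (Finset.univ.erase 3 : Finset (Fin 5)) = {0, 1, 2, 4} by decide]
    simpa [mul_assoc] using key 3 0 1 2 4 (by decide) (by decide) (by decide) (by decide)
      (by linear_combination hdet) (by linear_combination h0) (by linear_combination h1)
      (by linear_combination h1') (by linear_combination h2) (by linear_combination h2')
  · rw [show (Finset.univ.erase 4 : Finset (Fin 5)) = {0, 1, 2, 3} by decide]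
    simpa [mul_assoc] using key 4 0 1 2 3 (by decide) (by decide) (by decide) (by decide)
      (by linear_combination hdet) (by linear_combination h0) (by linear_combination h1)
      (by linear_combination h1') (by linear_combination h2) (by linear_combination h2')

open Matrix

theorem invariant_form {Γ n : Type*} [Group Γ] [Finite Γ] [Fintype n] [DecidableEq n]
    (f : Γ →* Matrix n n ℂ) {a : Γ} {l : n → ℂ} (hl : l.Injective) (ha : f a = diagonal l) :
    ∃ h : n → ℝ, (∀ i, 0 < h i) ∧
      ∀ g, (f g)ᴴ * diagonal (fun i => (h i : ℂ)) * f g = diagonal (fun i => (h i : ℂ)) := by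
  have := Fintype.ofFinite Γ
  obtain ⟨H, hH⟩ : ∃ H, H = ∑ g, (f g)ᴴ * f g := ⟨_, rfl⟩
  have hinv : ∀ g, (f g)ᴴ * H * f g = H := fun g => by
    rw [hH, Finset.mul_sum, Finset.sum_mul]
    refine Fintype.sum_equiv (Equiv.mulRight g) _ _ fun x => ?_
    simp [conjTranspose_mul, Matrix.mul_assoc]
  have hdiag : ∀ i, H i i = ((∑ g, ∑ k, Complex.normSq (f g k i) : ℝ) : ℂ) := fun i => by
    rw [hH, Matrix.sum_apply]
    push_cast
    refine Finset.sum_congr rfl fun g _ => ?_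
    rw [Matrix.mul_apply]
    exact Finset.sum_congr rfl fun k _ => by
      rw [conjTranspose_apply, Complex.normSq_eq_conj_mul_self]; rfl
  have hpos : ∀ i, 0 < ∑ g, ∑ k, Complex.normSq (f g k i) := fun i => by
    refine Finset.sum_pos' (fun g _ => Finset.sum_nonneg fun k _ => Complex.normSq_nonneg _)
      ⟨1, Finset.mem_univ _, ?_⟩
    refine Finset.sum_pos' (fun k _ => Complex.normSq_nonneg _) ⟨i, Finset.mem_univ _, ?_⟩
    simp
  have hent : ∀ i j, conj (l i) * H i j * l j = H i j := fun i j => by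
    have := congrFun (congrFun (hinv a) i) j
    rwa [ha, diagonal_conjTranspose, mul_diagonal, diagonal_mul] at this
  have hne : ∀ i, H i i ≠ 0 := fun i => by
    rw [hdiag]
    exact_mod_cast (hpos i).ne'
  have hoff : ∀ i j, i ≠ j → H i j = 0 := fun i j hij => by
    by_contra h
    have h1 : conj (l i) * l j = 1 :=
      mul_right_cancel₀ h (by linear_combination hent i j)
    have h2 : conj (l i) * l i = 1 :=
      mul_right_cancel₀ (hne i) (by linear_combination hent i i)
    have h3 : conj (l i) ≠ 0 := fun h0 => by simp [h0] at h1
    exact hij (hl (mul_left_cancel₀ h3 (h2.trans h1.symm)))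
  have hHd : H = diagonal (fun i => ((∑ g, ∑ k, Complex.normSq (f g k i) : ℝ) : ℂ)) := by
    ext i j
    by_cases hij : i = j
    · subst hij; rw [diagonal_apply_eq, hdiag]
    · rw [diagonal_apply_ne _ hij, hoff i j hij]
  exact ⟨fun i => ∑ g, ∑ k, Complex.normSq (f g k i), hpos, fun g => by rw [← hHd]; exact hinv g⟩

theorem diag_entry_nonneg {Γ n : Type*} [Group Γ] [Finite Γ] [Fintype n] [DecidableEq n]
    (f : Γ →* Matrix n n ℂ) {a u : Γ} {l : n → ℂ} (hl : l.Injective) (ha : f a = diagonal l)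
    {U T : Matrix n n ℂ} (hu : f u = U) (hU : U * U * U = 1) (hT : T = 1 + U + U * U) (i : n) :
    ∃ t : ℝ, 0 ≤ t ∧ T i i = t ∧ (t = 0 → ∀ j, T j i = 0) := by
  obtain ⟨h, hpos, hinv⟩ := invariant_form f hl ha
  obtain ⟨H, hH⟩ : ∃ H : Matrix n n ℂ, H = diagonal (fun i => (h i : ℂ)) := ⟨_, rfl⟩
  have hi := hinv u
  rw [← hH, hu] at hi
  have h1 : Uᴴ * H = H * (U * U) := by
    calc Uᴴ * H = Uᴴ * H * (U * U * U) := by rw [hU, mul_one]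
      _ = (Uᴴ * H * U) * (U * U) := by simp only [mul_assoc]
      _ = _ := by rw [hi]
  have h2 : Uᴴ * Uᴴ * H = H * U := by
    calc Uᴴ * Uᴴ * H = Uᴴ * (H * (U * U)) := by rw [mul_assoc, h1]
      _ = (Uᴴ * H * U) * U := by simp only [mul_assoc]
      _ = _ := by rw [hi]
  have hTH : Tᴴ * H = H * T := by
    rw [hT]
    simp only [conjTranspose_add, conjTranspose_mul, conjTranspose_one, add_mul, mul_add, one_mul,
      mul_one, h1, h2]
    abel
  have hTT : T * T = T + T + T := by
    rw [hT]
    simp only [add_mul, mul_add, one_mul, mul_one, hU, ← mul_assoc]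
    abel
  have hent : ∀ j, conj (T j i) * h j = h i * T i j := fun j => by
    have := congrFun (congrFun hTH i) j
    rwa [hH, mul_diagonal, diagonal_mul, conjTranspose_apply] at this
  have hsum : 3 * h i * T i i = ((∑ j, Complex.normSq (T j i) * h j : ℝ) : ℂ) := by
    have := congrFun (congrFun hTT i) i
    rw [Matrix.mul_apply] at this
    simp only [Matrix.add_apply] at this
    calc 3 * h i * T i i = h i * (T i i + T i i + T i i) := by ring
      _ = ∑ j, h i * (T i j * T j i) := by rw [← this, Finset.mul_sum]
      _ = _ := by
        push_cast
        refine Finset.sum_congr rfl fun j _ => ?_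
        rw [Complex.normSq_eq_conj_mul_self]
        linear_combination -T j i * hent j
  have hh : (h i : ℂ) ≠ 0 := by exact_mod_cast (hpos i).ne'
  have hnn : ∀ j, 0 ≤ Complex.normSq (T j i) * h j := fun j =>
    mul_nonneg (Complex.normSq_nonneg _) (hpos j).le
  refine ⟨(∑ j, Complex.normSq (T j i) * h j) / (3 * h i),
    div_nonneg (Finset.sum_nonneg fun j _ => hnn j) (by linarith [hpos i]), ?_, fun h0 j => ?_⟩
  · rw [Complex.ofReal_div, ← hsum]
    push_cast
    field_simp
  · have h3 : (3 * h i) ≠ 0 := by linarith [hpos i, (hpos i).ne']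
    have h4 := (div_eq_zero_iff.1 h0).resolve_right (by have := hpos i; positivity)
    have h5 := (Finset.sum_eq_zero_iff_of_nonneg fun j _ => hnn j).1 h4 j (Finset.mem_univ j)
    exact Complex.normSq_eq_zero.1 ((mul_eq_zero.1 h5).resolve_right (hpos j).ne')

theorem sign_pattern_of_diagonal {Γ : Type*} [Group Γ] [Finite Γ]
    (f : Γ →* Matrix (Fin 5) (Fin 5) ℂ) {a u : Γ} {l : Fin 5 → ℂ} {D K : Matrix (Fin 5) (Fin 5) ℂ}
    (hl : l.Injective) (hl1 : ∀ i, l i * conj (l i) = 1) (ha : f a = diagonal l) (hu : f u = K)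
    (hK : K = diagonal l * D) (hD : D * D = 1) (hKKK : K * K * K = 1)
    (htD : D.trace = 1) (htK : K.trace = -1) (htKK : (K * K).trace = -1) (hdet : ∏ i, l i = 1)
    (hT : ∀ i, (1 + K + K * K) i i ≠ 0) (i : Fin 5) :
    0 < (1 + 2 * (l i).re) * ∏ j ∈ Finset.univ.erase i, ((l i).im - (l j).im) := by
  have hAA' : diagonal l * diagonal (fun i => conj (l i)) = 1 := by
    rw [diagonal_mul_diagonal, ← diagonal_one]
    exact congrArg diagonal (funext hl1)
  have hA'A : diagonal (fun i => conj (l i)) * diagonal l = 1 := mul_eq_one_comm.1 hAA'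
  have hKK : K * K = D * diagonal (fun i => conj (l i)) := by
    calc K * K = K * K * (K * (D * diagonal (fun i => conj (l i)))) := by
          rw [hK, mul_assoc (diagonal l) D (D * _), ← mul_assoc D D, hD, one_mul, hAA', mul_one]
      _ = K * K * K * (D * diagonal (fun i => conj (l i))) := by rw [mul_assoc (K * K)]
      _ = _ := by rw [hKKK, one_mul]
  have hADA : diagonal l * D * diagonal l = D * diagonal (fun i => conj (l i)) * D := by
    have : diagonal l * D * (diagonal l * D) = D * diagonal (fun i => conj (l i)) := by
      rw [← hK, hKK]
    rw [← this]
    simp only [mul_assoc, hD, mul_one]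
  have hA'DA' : diagonal (fun i => conj (l i)) * D * diagonal (fun i => conj (l i)) =
      D * diagonal l * D := by
    have h : D * diagonal l * D * (diagonal l * D * diagonal l) = 1 := by
      rw [hADA]
      calc _ = D * diagonal l * (D * D) * diagonal (fun i => conj (l i)) * D := by
            simp only [mul_assoc]
        _ = D * (diagonal l * diagonal (fun i => conj (l i))) * D := by
            rw [hD, mul_one, mul_assoc D]
        _ = 1 := by rw [hAA', mul_one, hD]
    calc _ = D * diagonal l * D * (diagonal l * D * diagonal l) *
          (diagonal (fun i => conj (l i)) * D * diagonal (fun i => conj (l i))) := by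
          rw [h, one_mul]
      _ = D * diagonal l * D * (diagonal l * D * (diagonal l * diagonal (fun i => conj (l i))) * D *
          diagonal (fun i => conj (l i))) := by simp only [mul_assoc]
      _ = D * diagonal l * D * (diagonal l * (D * D) * diagonal (fun i => conj (l i))) := by
          rw [hAA', mul_one, mul_assoc _ D D]
      _ = _ := by rw [hD, mul_one, hAA', mul_one]
  refine sign_pattern l (fun i => D i i) hl1 hl hdet ?_ ?_ ?_ ?_ ?_ (fun i => ?_) i
  · exact htD
  · rw [← htK, hK]
    exact Finset.sum_congr rfl fun i _ => (diagonal_mul _ _ _ _).symm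
  · rw [← htKK, hKK]
    exact Finset.sum_congr rfl fun i _ => by
      rw [diag_apply, mul_diagonal, mul_comm]
  · have h : (diagonal l * D * diagonal l).trace = ∑ i, conj (l i) := by
      rw [hADA, trace_mul_comm, ← mul_assoc, hD, one_mul, trace_diagonal]
    rw [← h]
    exact Finset.sum_congr rfl fun i _ => by
      rw [diag_apply, mul_diagonal, diagonal_mul]; ring
  · have h : (diagonal (fun i => conj (l i)) * D * diagonal (fun i => conj (l i))).trace =
        ∑ i, l i := by
      rw [hA'DA', trace_mul_comm, ← mul_assoc, hD, one_mul, trace_diagonal]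
    rw [← h]
    exact Finset.sum_congr rfl fun i _ => by
      rw [diag_apply, mul_diagonal, diagonal_mul]; ring
  · obtain ⟨t, h0, h1, h2⟩ := diag_entry_nonneg f hl ha hu hKKK rfl i
    refine ⟨t, lt_of_le_of_ne h0 fun h => hT i (h2 h.symm i), ?_⟩
    rw [← h1, hKK, Matrix.add_apply, Matrix.add_apply, hK, diagonal_mul, mul_diagonal, one_apply_eq]
    ring

theorem root_pow {N k e : ℕ} :
    Complex.exp (2 * Real.pi * Complex.I * e / N) ^ k =
      Complex.exp (2 * Real.pi * Complex.I * (k * e : ℕ) / N) := by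
  rw [← Complex.exp_nat_mul]
  congr 1
  push_cast
  ring

theorem root_eq_iff {N e e' : ℕ} (hN : 0 < N) :
    Complex.exp (2 * Real.pi * Complex.I * e / N) =
      Complex.exp (2 * Real.pi * Complex.I * e' / N) ↔ e % N = e' % N := by
  have hζ := Complex.isPrimitiveRoot_exp N hN.ne'
  have h : ∀ e : ℕ, Complex.exp (2 * Real.pi * Complex.I * e / N) =
      Complex.exp (2 * Real.pi * Complex.I / N) ^ e := fun e => by
    rw [← Complex.exp_nat_mul]
    congr 1
    ring
  rw [h, h, (isOfFinOrder_iff_pow_eq_one.2 ⟨N, hN, hζ.pow_eq_one⟩).pow_eq_pow_iff_modEq,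
    ← hζ.eq_orderOf]
  rfl

theorem exists_pow_eq_of_diagonal {Γ : Type*} [Group Γ] [Finite Γ]
    (f : Γ →* Matrix (Fin 5) (Fin 5) ℂ) {a u : Γ} {l : Fin 5 → ℂ} {D K : Matrix (Fin 5) (Fin 5) ℂ}
    (hl : l.Injective) (ha : f a = diagonal l) (hu : f u = K)
    (hK : K = diagonal l * D) (hD : D * D = 1) (hKKK : K * K * K = 1)
    (htD : D.trace = 1) (htK : K.trace = -1) (htKK : (K * K).trace = -1) (hdet : ∏ i, l i = 1)
    (hT : ∀ i, (1 + K + K * K) i i ≠ 0) :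
    ∃ t ∈ [1, 2, 3, 4, 5, 6, 9, 10, 11, 12], ∀ i j, l i ^ t = l j ^ t := by
  obtain ⟨N, hN, haN⟩ : ∃ N, 0 < N ∧ a ^ N = 1 := ⟨orderOf a, orderOf_pos a, pow_orderOf_eq_one a⟩
  have : NeZero N := ⟨hN.ne'⟩
  have hlN : ∀ i, l i ^ N = 1 := fun i => by
    have h : diagonal l ^ N = 1 := by rw [← ha, ← map_pow, haN, map_one]
    rw [diagonal_pow] at h
    simpa using congrFun (congrFun h i) i
  have hconj : ∀ z : ℂ, z ^ N = 1 → z * conj z = 1 := fun z hz => by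
    rw [Complex.mul_conj, Complex.normSq_eq_norm_sq, Complex.norm_eq_one_of_pow_eq_one hz hN.ne']
    simp
  have hex : ∀ i, ∃ e : ℕ, l i = Complex.exp (2 * Real.pi * Complex.I * e / N) := fun i => by
    obtain ⟨e, -, he⟩ := (Complex.isPrimitiveRoot_exp N hN.ne').eq_pow_of_pow_eq_one (hlN i)
    refine ⟨e, ?_⟩
    rw [← he, ← Complex.exp_nat_mul]
    congr 1
    ring
  choose e he using hex
  have hvalid : Valid N (Finset.univ.val.map e) := by
    refine ⟨rfl, ?_, fun k hk => ?_⟩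
    · simp only [he] at hdet
      rw [← Complex.exp_sum] at hdet
      have h : Complex.exp (2 * Real.pi * Complex.I * (∑ i, e i : ℕ) / N) =
          Complex.exp (2 * Real.pi * Complex.I * (0 : ℕ) / N) := by
        rw [Nat.cast_zero, mul_zero, zero_div, Complex.exp_zero, ← hdet]
        congr 1
        push_cast
        rw [Finset.mul_sum, Finset.sum_div]
      rw [root_eq_iff hN, Nat.zero_mod] at h
      exact Nat.dvd_of_mod_eq_zero h
    · rw [Multiset.map_map]
      obtain ⟨σ, hσ⟩ := exists_ringEquiv_pow hN hk
      have hmap : ∀ M M' : Matrix (Fin 5) (Fin 5) ℂ, (M * M').map σ = M.map σ * M'.map σ :=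
        fun M M' => Matrix.map_mul
      have htr : ∀ M : Matrix (Fin 5) (Fin 5) ℂ, (M.map σ).trace = σ M.trace := fun M => by
        simp [Matrix.trace]
      have hone : (1 : Matrix (Fin 5) (Fin 5) ℂ).map σ = 1 := by simp
      have hdg : (diagonal l).map σ = diagonal (fun i => σ (l i)) := by
        rw [diagonal_map (map_zero σ)]
      refine pat_of_pos hN _ (fun i => σ (l i)) (fun i => ?_) ?_
      · rw [hσ _ (hlN i), he, root_pow]; rfl
      · refine sign_pattern_of_diagonal ((σ.toRingHom.mapMatrix.toMonoidHom).comp f) (a := a) (u := u)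
          (l := fun i => σ (l i)) (D := D.map σ) (K := K.map σ) (fun i j h => hl (σ.injective h))
          (fun i => hconj _ ?_) ?_ ?_ ?_ ?_ ?_ ?_ ?_ ?_ ?_ ?_
        · rw [← map_pow, hlN, map_one]
        · rw [← hdg, ← ha]; rfl
        · rw [← hu]; rfl
        · rw [hK, hmap, hdg]
        · rw [← hmap, hD, hone]
        · rw [← hmap, ← hmap, hKKK, hone]
        · rw [htr, htD, map_one]
        · rw [htr, htK, map_neg, map_one]
        · rw [← hmap, htr, htKK, map_neg, map_one]
        · rw [← map_prod, hdet, map_one]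
        · intro i h
          refine hT i (σ.injective ?_)
          rw [map_zero, ← h, ← hmap]
          simp [Matrix.add_apply, -Matrix.map_mul]
  obtain ⟨t, ht, h⟩ := hvalid.good hN
  refine ⟨t, ht, fun i j => ?_⟩
  rw [he, he, root_pow, root_pow, root_eq_iff hN]
  exact h _ (Multiset.mem_map_of_mem e (Finset.mem_univ i)) _
    (Multiset.mem_map_of_mem e (Finset.mem_univ j))

theorem exists_common_vector {V W : Submodule ℂ (Fin 5 → ℂ)}
    (h : 5 < Module.finrank ℂ V + Module.finrank ℂ W) : ∃ w ≠ 0, w ∈ V ∧ w ∈ W := by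
  have h1 := Submodule.finrank_sup_add_finrank_inf_eq V W
  have h2 := Submodule.finrank_le (V ⊔ W)
  rw [Module.finrank_fin_fun] at h2
  have h3 : V ⊓ W ≠ ⊥ := fun h0 => by
    rw [h0, finrank_bot] at h1
    omega
  obtain ⟨w, hw, hw0⟩ := Submodule.exists_mem_ne_zero_of_ne_bot h3
  exact ⟨w, hw0, hw⟩

theorem finrank_ker_add_trace {E : Matrix (Fin 5) (Fin 5) ℂ} (hE : E * E = E) {r : ℕ}
    (hr : E.trace = r) : Module.finrank ℂ (LinearMap.ker E.mulVecLin) + r = 5 := by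
  have hid : IsIdempotentElem E.mulVecLin := by
    rw [IsIdempotentElem, Module.End.mul_eq_comp, ← mulVecLin_mul, hE]
  have h1 := (LinearMap.IsIdempotentElem.isProj_range _ hid).trace
  have h2 : LinearMap.trace ℂ (Fin 5 → ℂ) E.mulVecLin = E.trace := by
    rw [← toLin'_apply', trace_toLin'_eq]
  rw [h2, hr, Nat.cast_inj] at h1
  have h3 := LinearMap.finrank_range_add_finrank_ker E.mulVecLin
  rw [Module.finrank_fin_fun] at h3
  omega

theorem no_small_invariant {A D : Matrix (Fin 5) (Fin 5) ℂ} (hirr : MatPairIrreducible A D)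
    {w w' : Fin 5 → ℂ} (hw : w ≠ 0) (hA : A *ᵥ w ∈ Submodule.span ℂ {w, w'})
    (hA' : A *ᵥ w' ∈ Submodule.span ℂ {w, w'}) (hD : D *ᵥ w ∈ Submodule.span ℂ {w, w'})
    (hD' : D *ᵥ w' ∈ Submodule.span ℂ {w, w'}) : False := by
  have key : ∀ M : Matrix (Fin 5) (Fin 5) ℂ, M *ᵥ w ∈ Submodule.span ℂ {w, w'} →
      M *ᵥ w' ∈ Submodule.span ℂ {w, w'} →
      ∀ v ∈ Submodule.span ℂ {w, w'}, M *ᵥ v ∈ Submodule.span ℂ {w, w'} := fun M h h' v hv => by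
    obtain ⟨x, y, rfl⟩ := Submodule.mem_span_pair.1 hv
    rw [mulVec_add, mulVec_smul, mulVec_smul]
    exact add_mem (Submodule.smul_mem _ _ h) (Submodule.smul_mem _ _ h')
  rcases hirr _ (key A hA hA') (key D hD hD') with h | h
  · refine hw ?_
    rw [← Submodule.mem_bot ℂ, ← h]
    exact Submodule.subset_span (by simp)
  · have h1 : Module.finrank ℂ (Submodule.span ℂ {w, w'}) = 5 := by
      rw [h, finrank_top, Module.finrank_fin_fun]
    have h2 := finrank_span_le_card (R := ℂ) ({w, w'} : Set (Fin 5 → ℂ))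
    have h3 : ({w, w'} : Set (Fin 5 → ℂ)).toFinset.card ≤ 2 := by
      rw [Set.toFinset_insert, Set.toFinset_singleton]
      exact Finset.card_le_two
    omega

theorem no_eigenvector_in_ker {A D K : Matrix (Fin 5) (Fin 5) ℂ} (hirr : MatPairIrreducible A D)
    (hK : K = A * D) (hD : D * D = 1) (hKKK : K * K * K = 1) {w : Fin 5 → ℂ} {c : ℂ} (hw : w ≠ 0)
    (hA : A *ᵥ w = c • w) (hT : (1 + K + K * K) *ᵥ w = 0) : False := by
  have hKD : K * D = A := by rw [hK, mul_assoc, hD, mul_one]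
  have hinv : D * (K * K) * A = 1 := by
    rw [mul_eq_one_comm, ← mul_assoc, ← hKD, mul_assoc K, hD, mul_one, ← mul_assoc, hKKK]
  have h1 : c • (D * (K * K)) *ᵥ w = w := by
    rw [← mulVec_smul, ← hA, mulVec_mulVec, hinv, one_mulVec]
  have hc : c ≠ 0 := fun h0 => hw (by rw [← h1, h0, zero_smul])
  have h2 : (K * K) *ᵥ w = c⁻¹ • D *ᵥ w := by
    conv_rhs => rw [← h1]
    rw [mulVec_smul, inv_smul_smul₀ hc, mulVec_mulVec, ← mul_assoc D, hD, one_mul]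
  have h3 : A *ᵥ (D *ᵥ w) = -w - c⁻¹ • D *ᵥ w := by
    rw [mulVec_mulVec, ← hK, ← h2]
    rw [add_mulVec, add_mulVec, one_mulVec] at hT
    linear_combination (exp := 1) hT
  have hm : w ∈ Submodule.span ℂ {w, D *ᵥ w} := Submodule.subset_span (by simp)
  have hm' : D *ᵥ w ∈ Submodule.span ℂ {w, D *ᵥ w} := Submodule.subset_span (by simp)
  refine no_small_invariant hirr (w' := D *ᵥ w) hw ?_ ?_ hm' ?_
  · rw [hA]
    exact Submodule.smul_mem _ _ hm
  · rw [h3]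
    exact sub_mem (neg_mem hm) (Submodule.smul_mem _ _ hm')
  · rw [mulVec_mulVec, hD, one_mulVec]
    exact hm

theorem exists_eigenbasis {A : Matrix (Fin 5) (Fin 5) ℂ} {N : ℕ} (hN : 0 < N) (hA : A ^ N = 1) :
    ∃ (b : Module.Basis (Fin 5) ℂ (Fin 5 → ℂ)) (l : Fin 5 → ℂ), ∀ i, A *ᵥ b i = l i • b i := by
  have hss : Module.End.IsSemisimple (toLin' A) := by
    refine Module.End.isSemisimple_of_squarefree_aeval_eq_zero
      (p := (Polynomial.X ^ N - 1 : Polynomial ℂ)) ?_ ?_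
    · exact (Polynomial.separable_X_pow_sub_C (1 : ℂ) (by exact_mod_cast hN.ne')
        one_ne_zero).squarefree
    · rw [map_sub, map_pow, Polynomial.aeval_X, map_one, ← toLin'_pow, hA, toLin'_one]
      exact sub_self _
  obtain ⟨s, hs⟩ : ∃ s : Set (Fin 5 → ℂ), s = {v | ∃ c : ℂ, A *ᵥ v = c • v} := ⟨_, rfl⟩
  have hspan : Submodule.span ℂ s = ⊤ := by
    rw [eq_top_iff, ← hss.iSup_eigenspace_eq_top, iSup_le_iff]
    intro c v hv
    refine Submodule.subset_span ?_
    rw [Module.End.mem_eigenspace_iff, toLin'_apply] at hv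
    rw [hs]
    exact ⟨c, hv⟩
  obtain ⟨t, hts, hspan', hli⟩ := exists_linearIndependent ℂ s
  let b := Module.Basis.mk hli (by rw [Subtype.range_coe, hspan', hspan])
  have hb : ∀ i, ∃ c : ℂ, A *ᵥ b.reindex (b.indexEquiv (Pi.basisFun ℂ (Fin 5))) i =
      c • b.reindex (b.indexEquiv (Pi.basisFun ℂ (Fin 5))) i := fun i => by
    rw [Module.Basis.reindex_apply, Module.Basis.mk_apply]
    have h := hts (Subtype.coe_prop ((b.indexEquiv (Pi.basisFun ℂ (Fin 5))).symm i))
    rwa [hs] at h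
  choose l hl using hb
  exact ⟨_, l, hl⟩

theorem exists_pow_eq_smul_one {Γ : Type*} [Group Γ] [Finite Γ]
    (f : Γ →* Matrix (Fin 5) (Fin 5) ℂ) {a u : Γ} {A D K : Matrix (Fin 5) (Fin 5) ℂ}
    (ha : f a = A) (hu : f u = K) (hK : K = A * D) (hD : D * D = 1) (hKKK : K * K * K = 1)
    (htD : D.trace = 1) (htK : K.trace = -1) (htKK : (K * K).trace = -1) (hdet : A.det = 1)
    (hirr : MatPairIrreducible A D) :
    ∃ t ∈ [1, 2, 3, 4, 5, 6, 9, 10, 11, 12], ∃ c : ℂ, A ^ t = c • (1 : Matrix _ _ ℂ) := by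
  have haN : A ^ orderOf a = 1 := by rw [← ha, ← map_pow, pow_orderOf_eq_one, map_one]
  obtain ⟨b, l, hbl⟩ := exists_eigenbasis (orderOf_pos a) haN
  obtain ⟨T, hT⟩ : ∃ T, T = 1 + K + K * K := ⟨_, rfl⟩
  have hTne : ∀ w c, w ≠ 0 → A *ᵥ w = c • w → T *ᵥ w ≠ 0 := fun w c hw hc h =>
    no_eigenvector_in_ker hirr hK hD hKKK hw hc (hT ▸ h)
  have hTT : T * T = (3 : ℂ) • T := by
    rw [hT]
    simp only [add_mul, mul_add, one_mul, mul_one, hKKK, ← mul_assoc]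
    module
  have hker : Module.finrank ℂ (LinearMap.ker T.mulVecLin) = 4 := by
    have h1 : ((3 : ℂ)⁻¹ • T) * ((3 : ℂ)⁻¹ • T) = (3 : ℂ)⁻¹ • T := by
      rw [smul_mul_smul_comm, hTT, smul_smul]
      norm_num
    have h2 : ((3 : ℂ)⁻¹ • T).trace = (1 : ℕ) := by
      rw [hT, trace_smul, trace_add, trace_add, htK, htKK, trace_one]
      norm_num
    have h3 := finrank_ker_add_trace h1 h2
    have h4 : LinearMap.ker ((3 : ℂ)⁻¹ • T).mulVecLin = LinearMap.ker T.mulVecLin := by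
      ext v
      rw [LinearMap.mem_ker, LinearMap.mem_ker, mulVecLin_apply, mulVecLin_apply, smul_mulVec,
        smul_eq_zero, or_iff_right (by norm_num)]
    rw [h4] at h3
    omega
  have hl : l.Injective := fun i j hij => by
    by_contra hne
    have h1 : Module.finrank ℂ (Submodule.span ℂ (Set.range ![b i, b j])) = 2 := by
      rw [finrank_span_eq_card, Fintype.card_fin]
      rw [LinearIndependent.pair_iff]
      intro s t hst
      have h2 := congrArg (fun v => (b.repr v i, b.repr v j)) hst
      simpa [Finsupp.single_apply, hne, Ne.symm hne] using h2
    obtain ⟨w, hw0, hw1, hw2⟩ := exists_common_vector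
      (V := Submodule.span ℂ (Set.range ![b i, b j])) (W := LinearMap.ker T.mulVecLin)
      (by rw [h1, hker]; norm_num)
    rw [LinearMap.mem_ker, mulVecLin_apply] at hw2
    refine hTne w (l i) hw0 ?_ hw2
    rw [Matrix.range_cons, Matrix.range_cons, Matrix.range_empty, Set.union_empty,
      Set.singleton_union, Submodule.mem_span_pair] at hw1
    obtain ⟨x, y, rfl⟩ := hw1
    rw [mulVec_add, mulVec_smul, mulVec_smul, hbl, hbl, ← hij]
    module
  let e := Pi.basisFun ℂ (Fin 5)
  obtain ⟨P, hP⟩ : ∃ P, P = e.toMatrix b := ⟨_, rfl⟩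
  obtain ⟨Q, hQ⟩ : ∃ Q, Q = b.toMatrix e := ⟨_, rfl⟩
  have hPQ : P * Q = 1 := by rw [hP, hQ]; exact e.toMatrix_mul_toMatrix_flip b
  have hQP : Q * P = 1 := by rw [hP, hQ]; exact b.toMatrix_mul_toMatrix_flip e
  have hPb : ∀ i, P *ᵥ Pi.single i 1 = b i := fun i => by
    ext j
    rw [mulVec_single_one, hP]
    rfl
  have hAP : A * P = P * diagonal l := by
    refine ext_of_mulVec_single fun i => ?_
    rw [← mulVec_mulVec, ← mulVec_mulVec, hPb, hbl, diagonal_mulVec_single, mul_one, ← hPb,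
      ← mulVec_smul, ← Pi.single_smul]
    simp
  have hconj : ∀ M M' : Matrix (Fin 5) (Fin 5) ℂ, Q * (M * M') * P = (Q * M * P) * (Q * M' * P) :=
    fun M M' => by
      calc _ = Q * M * 1 * M' * P := by simp only [mul_assoc, mul_one]
        _ = _ := by rw [← hPQ]; simp only [mul_assoc]
  have htr : ∀ M : Matrix (Fin 5) (Fin 5) ℂ, (Q * M * P).trace = M.trace := fun M => by
    rw [trace_mul_comm, ← mul_assoc, hPQ, one_mul]
  have hQAP : Q * A * P = diagonal l := by rw [mul_assoc, hAP, ← mul_assoc, hQP, one_mul]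
  let f' : Γ →* Matrix (Fin 5) (Fin 5) ℂ :=
    { toFun := fun g => Q * f g * P
      map_one' := by rw [map_one, mul_one, hQP]
      map_mul' := fun g h => by rw [map_mul, hconj] }
  have hKKK' : Q * K * P * (Q * K * P) * (Q * K * P) = 1 := by
    rw [← hconj, ← hconj, hKKK, mul_one, hQP]
  have hQTP : 1 + Q * K * P + Q * K * P * (Q * K * P) = Q * T * P := by
    rw [hT, mul_add, mul_add, add_mul, add_mul, mul_one, hQP, hconj]
  have hfa : f' a = diagonal l := by rw [← hQAP, ← ha]; rfl
  have hfu : f' u = Q * K * P := by rw [← hu]; rfl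
  obtain ⟨t, ht, h⟩ := exists_pow_eq_of_diagonal f' (a := a) (u := u) (D := Q * D * P) hl hfa hfu
    (by rw [hK, hconj, hQAP]) (by rw [← hconj, hD, mul_one, hQP]) hKKK' (by rw [htr, htD])
    (by rw [htr, htK]) (by rw [← hconj, htr, htKK])
    (by
      have h1 : (Q * A * P).det = 1 := by
        rw [det_mul, det_mul, hdet, mul_one, ← det_mul, hQP, det_one]
      rwa [hQAP, det_diagonal] at h1)
    (fun i h0 => by
      obtain ⟨t, -, h1, h2⟩ := diag_entry_nonneg f' hl hfa hfu hKKK' rfl i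
      rw [h0] at h1
      have h3 := h2 (by exact_mod_cast h1.symm)
      rw [hQTP] at h3
      refine hTne (b i) (l i) (b.ne_zero i) (hbl i) ?_
      have h4 : (Q * T * P) *ᵥ Pi.single i 1 = 0 := by
        ext j
        rw [mulVec_single_one]
        exact h3 j
      calc T *ᵥ b i = (P * (Q * T * P)) *ᵥ Pi.single i 1 := by
            rw [← mul_assoc, ← mul_assoc, hPQ, one_mul, ← mulVec_mulVec, hPb]
        _ = 0 := by rw [← mulVec_mulVec, h4, mulVec_zero])
  refine ⟨t, ht, l 0 ^ t, ?_⟩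
  have h1 : (diagonal l) ^ t = l 0 ^ t • (1 : Matrix (Fin 5) (Fin 5) ℂ) := by
    rw [diagonal_pow, ← diagonal_one, ← diagonal_smul]
    congr 1
    ext i
    simpa using h i 0
  have h2 : A = P * diagonal l * Q := by rw [← hAP, mul_assoc, hPQ, mul_one]
  have h3 : ∀ t, A ^ t = P * diagonal l ^ t * Q := fun t => by
    induction t with
    | zero => rw [pow_zero, pow_zero, mul_one, hPQ]
    | succ t ih =>
      rw [pow_succ, ih, pow_succ]
      nth_rw 1 [h2]
      calc _ = P * diagonal l ^ t * (Q * P) * diagonal l * Q := by simp only [mul_assoc]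
        _ = _ := by rw [hQP, mul_one]; simp only [mul_assoc]
  rw [h3, h1, mul_smul_comm, mul_one, smul_mul_assoc, hPQ]

theorem toMatrix_eigenbasis {M : Matrix (Fin 5) (Fin 5) ℂ}
    {b : Module.Basis (Fin 5) ℂ (Fin 5 → ℂ)} {l : Fin 5 → ℂ} (h : ∀ i, M *ᵥ b i = l i • b i) :
    LinearMap.toMatrix b b (toLin' M) = diagonal l := by
  ext i j
  rw [LinearMap.toMatrix_apply, toLin'_apply, h, map_smul, Module.Basis.repr_self,
    Finsupp.smul_single_one, Finsupp.single_apply, diagonal_apply]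
  split_ifs with h1 h2 h2
  · rw [h1]
  · exact absurd h1.symm h2
  · exact absurd h2.symm h1
  · rfl

theorem trace_eigenbasis {M : Matrix (Fin 5) (Fin 5) ℂ}
    {b : Module.Basis (Fin 5) ℂ (Fin 5 → ℂ)} {l : Fin 5 → ℂ} (h : ∀ i, M *ᵥ b i = l i • b i) :
    M.trace = ∑ i, l i := by
  rw [← trace_toLin'_eq, LinearMap.trace_eq_matrix_trace ℂ b, toMatrix_eigenbasis h,
    trace_diagonal]

theorem det_eigenbasis {M : Matrix (Fin 5) (Fin 5) ℂ}
    {b : Module.Basis (Fin 5) ℂ (Fin 5 → ℂ)} {l : Fin 5 → ℂ} (h : ∀ i, M *ᵥ b i = l i • b i) :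
    M.det = ∏ i, l i := by
  rw [← LinearMap.det_toLin', ← LinearMap.det_toMatrix b, toMatrix_eigenbasis h, det_diagonal]

theorem exists_multiplicities {M : Matrix (Fin 5) (Fin 5) ℂ} {n : ℕ} {ω : ℂ} (hn : 0 < n)
    (hω : IsPrimitiveRoot ω n) (hM : M ^ n = 1) :
    ∃ k : Fin n → ℕ, ∑ j : Fin n, k j = 5 ∧ M.trace = ∑ j : Fin n, (k j : ℂ) * ω ^ (j : ℕ) ∧
      (M * M).trace = ∑ j : Fin n, (k j : ℂ) * (ω ^ (j : ℕ)) ^ 2 ∧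
      M.det = ∏ j : Fin n, (ω ^ (j : ℕ)) ^ k j ∧
      ∀ j : Fin n, ∃ V : Submodule ℂ (Fin 5 → ℂ), Module.finrank ℂ V = k j ∧
        ∀ v ∈ V, M *ᵥ v = ω ^ (j : ℕ) • v := by
  have : NeZero n := ⟨hn.ne'⟩
  obtain ⟨b, l, hbl⟩ := exists_eigenbasis hn hM
  have hpow : ∀ t i, M ^ t *ᵥ b i = l i ^ t • b i := fun t i => by
    induction t with
    | zero => simp
    | succ t ih => rw [pow_succ, ← mulVec_mulVec, hbl, mulVec_smul, ih, smul_smul, pow_succ, mul_comm]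
  have hm : ∀ i, ∃ m : Fin n, l i = ω ^ (m : ℕ) := fun i => by
    have h := hpow n i
    rw [hM, one_mulVec] at h
    have h1 : l i ^ n = 1 := by
      have h2 := congrArg (fun v => b.repr v i) h
      simpa using h2.symm
    obtain ⟨e, he, h2⟩ := hω.eq_pow_of_pow_eq_one h1
    exact ⟨⟨e, he⟩, h2.symm⟩
  choose m hm using hm
  refine ⟨fun j => (Finset.univ.filter fun i => m i = j).card, ?_, ?_, ?_, ?_, fun j => ?_⟩
  · exact (Finset.card_eq_sum_card_fiberwise fun i _ => Finset.mem_univ (m i)).symm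
  · rw [trace_eigenbasis hbl, ← Finset.sum_fiberwise Finset.univ m]
    refine Finset.sum_congr rfl fun j _ => ?_
    rw [← nsmul_eq_mul, ← Finset.sum_const]
    exact Finset.sum_congr rfl fun i hi => by rw [hm, (Finset.mem_filter.1 hi).2]
  · rw [← pow_two, trace_eigenbasis (hpow 2), ← Finset.sum_fiberwise Finset.univ m]
    refine Finset.sum_congr rfl fun j _ => ?_
    rw [← nsmul_eq_mul, ← Finset.sum_const]
    exact Finset.sum_congr rfl fun i hi => by rw [hm, (Finset.mem_filter.1 hi).2]
  · rw [det_eigenbasis hbl, ← Finset.prod_fiberwise Finset.univ m]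
    refine Finset.prod_congr rfl fun j _ => ?_
    rw [← Finset.prod_const]
    exact Finset.prod_congr rfl fun i hi => by rw [hm, (Finset.mem_filter.1 hi).2]
  · refine ⟨Submodule.span ℂ (Set.range fun i : {i // m i = j} => b i), ?_, fun v hv => ?_⟩
    · exact (finrank_span_eq_card (b.linearIndependent.comp (Subtype.val : {i // m i = j} → Fin 5)
        Subtype.val_injective)).trans (Fintype.card_subtype _)
    · induction hv using Submodule.span_induction with
      | mem x hx =>
        obtain ⟨⟨i, hi⟩, rfl⟩ := hx
        rw [hbl, hm, hi]
      | zero => rw [mulVec_zero, smul_zero]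
      | add x y _ _ hx hy => rw [mulVec_add, hx, hy, smul_add]
      | smul c x _ hx => rw [mulVec_smul, hx, smul_comm]

theorem trace_dichotomy {D K : Matrix (Fin 5) (Fin 5) ℂ} {ω : ℂ} (hω : IsPrimitiveRoot ω 3)
    (hD : D * D = 1) (hK : K * K * K = 1)
    (hno : ∀ (w : Fin 5 → ℂ) (c d : ℂ), w ≠ 0 → D *ᵥ w = c • w → K *ᵥ w = d • w → False) :
    ((D.trace = 1 ∧ D.det = 1) ∨ (D.trace = -1 ∧ D.det = -1)) ∧
      ∃ j : Fin 3, K.det = (ω ^ (j : ℕ)) ^ 5 ∧ K.trace = -ω ^ (j : ℕ) ∧ (K * K).trace = -(ω ^ (j : ℕ)) ^ 2 := by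
  obtain ⟨p, hp, hp1, -, hp2, hp3⟩ := exists_multiplicities (M := D) (ω := -1) two_pos
    (IsPrimitiveRoot.neg_one 0 (by norm_num)) (by rw [pow_two, hD])
  obtain ⟨k, hk, hk1, hk2, hk3, hk4⟩ := exists_multiplicities (M := K) three_pos hω
    (by rw [pow_three', hK])
  have hle : ∀ i j, p i + k j ≤ 5 := fun i j => by
    by_contra h
    obtain ⟨V, hV, hV'⟩ := hp3 i
    obtain ⟨W, hW, hW'⟩ := hk4 j
    obtain ⟨w, hw, h1, h2⟩ := exists_common_vector (V := V) (W := W) (by omega)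
    exact hno w _ _ hw (hV' w h1) (hW' w h2)
  have h3 : ω ^ 3 = 1 := hω.pow_eq_one
  have hs : 1 + ω + ω ^ 2 = 0 := by
    have := hω.geom_sum_eq_zero (by norm_num)
    simpa [Finset.sum_range_succ] using this
  simp only [Fin.sum_univ_two, Fin.prod_univ_two, Fin.sum_univ_three, Fin.prod_univ_three,
    Fin.val_zero, Fin.val_one, Fin.val_two, pow_zero, pow_one, one_pow, mul_one, one_mul] at *
  have a0 := hle 0 0
  have a1 := hle 0 1
  have a2 := hle 0 2
  have a3 := hle 1 0
  have a4 := hle 1 1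
  have a5 := hle 1 2
  have hp' : (p 0 = 3 ∧ p 1 = 2) ∨ (p 0 = 2 ∧ p 1 = 3) := by omega
  have hk' : (k 0 = 1 ∧ k 1 = 2 ∧ k 2 = 2) ∨ (k 0 = 2 ∧ k 1 = 1 ∧ k 2 = 2) ∨
      (k 0 = 2 ∧ k 1 = 2 ∧ k 2 = 1) := by omega
  refine ⟨?_, ?_⟩
  · rcases hp' with ⟨h0, h1⟩ | ⟨h0, h1⟩
    · left
      rw [hp1, hp2, h0, h1]
      norm_num
    · right
      rw [hp1, hp2, h0, h1]
      norm_num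
  · rcases hk' with ⟨h0, h1, h2⟩ | ⟨h0, h1, h2⟩ | ⟨h0, h1, h2⟩
    · refine ⟨0, ?_, ?_, ?_⟩
      · rw [hk3, h1, h2]
        simp only [Fin.val_zero]
        linear_combination (ω ^ 3 + 1) * h3
      · rw [hk1, h0, h1, h2]
        push_cast
        simp only [Fin.val_zero]
        linear_combination 2 * hs
      · rw [hk2, h0, h1, h2]
        push_cast
        simp only [Fin.val_zero]
        linear_combination 2 * hs + 2 * ω * h3
    · refine ⟨1, ?_, ?_, ?_⟩
      · rw [hk3, h1, h2]
        simp only [Fin.val_one]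
        ring
      · rw [hk1, h0, h1, h2]
        push_cast
        simp only [Fin.val_one]
        linear_combination 2 * hs
      · rw [hk2, h0, h1, h2]
        push_cast
        simp only [Fin.val_one]
        linear_combination 2 * hs + 2 * ω * h3
    · refine ⟨2, ?_, ?_, ?_⟩
      · rw [hk3, h1, h2]
        simp only [Fin.val_two]
        linear_combination -(ω ^ 4) * (ω ^ 3 + 1) * h3
      · rw [hk1, h0, h1, h2]
        push_cast
        simp only [Fin.val_two]
        linear_combination 2 * hs
      · rw [hk2, h0, h1, h2]
        push_cast
        simp only [Fin.val_two]
        linear_combination 2 * hs + 2 * ω * h3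

section Braid

variable {A B : Matrix (Fin 5) (Fin 5) ℂ}

theorem eq_smul_one_of_commute (hirr : MatPairIrreducible A B) {C : Matrix (Fin 5) (Fin 5) ℂ}
    (hA : C * A = A * C) (hB : C * B = B * C) : ∃ c : ℂ, C = c • (1 : Matrix (Fin 5) (Fin 5) ℂ) := by
  obtain ⟨c, hc⟩ := Module.End.exists_eigenvalue (toLin' C)
  have hmem : ∀ v, v ∈ Module.End.eigenspace (toLin' C) c ↔ C *ᵥ v = c • v := fun v => by
    rw [Module.End.mem_eigenspace_iff, toLin'_apply]
  have hinv : ∀ M, C * M = M * C → ∀ v ∈ Module.End.eigenspace (toLin' C) c,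
      M *ᵥ v ∈ Module.End.eigenspace (toLin' C) c := fun M hM v hv => by
    rw [hmem] at hv ⊢
    rw [mulVec_mulVec, hM, ← mulVec_mulVec, hv, mulVec_smul]
  refine ⟨c, ?_⟩
  rcases hirr _ (hinv A hA) (hinv B hB) with h | h
  · exact absurd h hc
  · refine ext_of_mulVec_single fun i => ?_
    have : Pi.single i 1 ∈ Module.End.eigenspace (toLin' C) c := by rw [h]; trivial
    rw [(hmem _).1 this, smul_mulVec, one_mulVec]

theorem braid_mul_left (h : A * B * A = B * A * B) : A * B * A * A = B * (A * B * A) := by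
  calc A * B * A * A = B * A * B * A := by rw [h]
    _ = B * (A * B * A) := by simp only [mul_assoc]

theorem braid_mul_right (h : A * B * A = B * A * B) : A * B * A * B = A * (A * B * A) := by
  rw [mul_assoc, mul_assoc, ← mul_assoc B, ← h]

theorem exists_braid_sq_eq (h : A * B * A = B * A * B) (hirr : MatPairIrreducible A B) :
    ∃ c : ℂ, A * B * A * (A * B * A) = c • (1 : Matrix (Fin 5) (Fin 5) ℂ) := by
  have h1 := braid_mul_left h
  have h2 := braid_mul_right h
  refine eq_smul_one_of_commute hirr ?_ ?_
  · generalize A * B * A = D at *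
    rw [mul_assoc, h1, ← mul_assoc, h2, mul_assoc]
  · generalize A * B * A = D at *
    rw [mul_assoc, h2, ← mul_assoc, h1, mul_assoc]

theorem pairIrreducible_smul (h : A * B * A = B * A * B) (hirr : MatPairIrreducible A B) {c μ : ℂ}
    (hc : A * B * A * (A * B * A) = c • (1 : Matrix (Fin 5) (Fin 5) ℂ)) (hc0 : c ≠ 0)
    (hμ : μ ≠ 0) : MatPairIrreducible (μ • A) (μ ^ 3 • (A * B * A)) := by
  intro W hA hD
  have hA' : ∀ v ∈ W, A *ᵥ v ∈ W := fun v hv => by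
    have := W.smul_mem μ⁻¹ (hA v hv)
    rwa [smul_mulVec, inv_smul_smul₀ hμ] at this
  have hD' : ∀ v ∈ W, (A * B * A) *ᵥ v ∈ W := fun v hv => by
    have := W.smul_mem (μ ^ 3)⁻¹ (hD v hv)
    rwa [smul_mulVec, inv_smul_smul₀ (pow_ne_zero 3 hμ)] at this
  refine hirr W hA' fun v hv => ?_
  have h1 := W.smul_mem c⁻¹ (hD' _ (hA' _ (hD' v hv)))
  rwa [mulVec_mulVec, braid_mul_left h, mulVec_mulVec, mul_assoc, hc, mul_smul_comm, mul_one, smul_mulVec,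
    inv_smul_smul₀ hc0] at h1

theorem braid_cube (h : A * B * A = B * A * B) {c : ℂ}
    (hc : A * B * A * (A * B * A) = c • (1 : Matrix (Fin 5) (Fin 5) ℂ)) :
    A * (A * B * A) * (A * (A * B * A)) * (A * (A * B * A)) =
      c ^ 2 • (1 : Matrix (Fin 5) (Fin 5) ℂ) := by
  calc A * (A * B * A) * (A * (A * B * A)) * (A * (A * B * A))
      = A * (A * B * A * A) * (A * B * A) * (A * (A * B * A)) := by simp only [mul_assoc]
    _ = A * B * (A * B * A * (A * B * A)) * (A * (A * B * A)) := by
        rw [braid_mul_left h]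
        simp only [mul_assoc]
    _ = A * B * (c • 1) * (A * (A * B * A)) := by rw [hc]
    _ = c • (A * B * A * (A * B * A)) := by
        simp only [mul_assoc, mul_smul_comm, smul_mul_assoc, mul_one]
    _ = c ^ 2 • 1 := by rw [hc, smul_smul, pow_two]

theorem exists_normalising_scalar (h : A * B * A = B * A * B) (hirr : MatPairIrreducible A B) {c : ℂ}
    (hc : A * B * A * (A * B * A) = c • (1 : Matrix (Fin 5) (Fin 5) ℂ)) (hc0 : c ≠ 0) :
    ∃ μ : ℂ, μ ^ 6 * c = 1 ∧ (μ ^ 3 • (A * B * A)).trace = 1 ∧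
      (μ ^ 4 • (A * (A * B * A))).trace = -1 ∧
      (μ ^ 4 • (A * (A * B * A)) * μ ^ 4 • (A * (A * B * A))).trace = -1 ∧ (μ • A).det = 1 := by
  obtain ⟨μ, hμ⟩ := IsAlgClosed.exists_pow_nat_eq c⁻¹ (n := 6) (by norm_num)
  have hμc : μ ^ 6 * c = 1 := by rw [hμ, inv_mul_cancel₀ hc0]
  have hμ0 : μ ≠ 0 := by
    rintro rfl
    norm_num at hμc
  have hirr' := pairIrreducible_smul h hirr hc hc0 hμ0
  have hAD : μ • A * μ ^ 3 • (A * B * A) = μ ^ 4 • (A * (A * B * A)) := by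
    rw [smul_mul_smul_comm, ← pow_succ']
  have hDD : μ ^ 3 • (A * B * A) * μ ^ 3 • (A * B * A) = 1 := by
    rw [smul_mul_smul_comm, hc, smul_smul, ← pow_add, hμc, one_smul]
  have hKKK : μ ^ 4 • (A * (A * B * A)) * μ ^ 4 • (A * (A * B * A)) * μ ^ 4 • (A * (A * B * A)) = 1 := by
    rw [smul_mul_smul_comm, smul_mul_smul_comm, braid_cube h hc, smul_smul,
      show μ ^ 4 * μ ^ 4 * μ ^ 4 * c ^ 2 = (μ ^ 6 * c) ^ 2 by ring, hμc, one_pow, one_smul]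
  have hω := Complex.isPrimitiveRoot_exp 3 (by norm_num)
  obtain ⟨hD, j, hj1, hj2, hj3⟩ := trace_dichotomy hω hDD hKKK fun w d k hw hdw hkw => by
    have hAK : μ • A = μ ^ 4 • (A * (A * B * A)) * μ ^ 3 • (A * B * A) := by
      rw [← hAD, mul_assoc, hDD, mul_one]
    have hA' : (μ • A) *ᵥ w ∈ Submodule.span ℂ {w, w} := by
      rw [hAK, ← mulVec_mulVec, hdw, mulVec_smul, hkw]
      exact Submodule.smul_mem _ _ (Submodule.smul_mem _ _ (Submodule.subset_span (by simp)))
    have hD' : (μ ^ 3 • (A * B * A)) *ᵥ w ∈ Submodule.span ℂ {w, w} := by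
      rw [hdw]
      exact Submodule.smul_mem _ _ (Submodule.subset_span (by simp))
    exact no_small_invariant hirr' hw hA' hA' hD' hD'
  have hζ : (Complex.exp (2 * Real.pi * Complex.I / (3 : ℕ)) ^ (j : ℕ)) ^ 3 = 1 := by
    rw [pow_right_comm, hω.pow_eq_one, one_pow]
  generalize Complex.exp (2 * Real.pi * Complex.I / (3 : ℕ)) ^ (j : ℕ) = ζ at *
  generalize hD0 : A * B * A = D at *
  generalize hK0 : A * D = K at *
  have key : ∀ e : ℂ, e ^ 2 = 1 → e * (μ ^ 3 • D).trace = 1 → e * (μ ^ 3 • D).det = 1 →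
      ∃ μ : ℂ, μ ^ 6 * c = 1 ∧ (μ ^ 3 • D).trace = 1 ∧ (μ ^ 4 • K).trace = -1 ∧
        (μ ^ 4 • K * μ ^ 4 • K).trace = -1 ∧ (μ • A).det = 1 := fun e he h1 h2 => by
    simp only [smul_mul_smul_comm, trace_smul, det_smul, smul_eq_mul, Fintype.card_fin] at *
    have hz6 : ζ ^ 6 = 1 := by linear_combination (ζ ^ 3 + 1) * hζ
    have hz9 : ζ ^ 9 = 1 := by linear_combination ζ ^ 6 * hζ + hz6
    have hz18 : ζ ^ 18 = 1 := by linear_combination (ζ ^ 9 + 1) * hz9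
    refine ⟨e * ζ ^ 2 * μ, ?_, ?_, ?_, ?_, ?_⟩
    · linear_combination (e ^ 4 + e ^ 2 + 1) * μ ^ 6 * c * ζ ^ 12 * he +
        (ζ ^ 6 + 1) * μ ^ 6 * c * hz6 + hμc
    · linear_combination e ^ 3 * μ ^ 3 * D.trace * hz6 + e * μ ^ 3 * D.trace * he + h1
    · linear_combination (e ^ 2 + 1) * ζ ^ 8 * μ ^ 4 * K.trace * he + ζ ^ 8 * hj2 - hz9
    · linear_combination (e ^ 4 + 1) * (e ^ 2 + 1) * ζ ^ 16 * μ ^ 8 * (K * K).trace * he +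
        ζ ^ 16 * hj3 - hz18
    · have h3 : A.det * D.det = K.det := by rw [← hK0, det_mul]
      linear_combination -(e ^ 5 * ζ ^ 10 * μ ^ 5 * A.det) * h2 + e ^ 6 * ζ ^ 10 * μ ^ 20 * h3 +
        e ^ 6 * ζ ^ 10 * hj1 + (e ^ 4 + e ^ 2 + 1) * ζ ^ 15 * he + ζ ^ 6 * hz9 + hz6
  rcases hD with ⟨h1, h2⟩ | ⟨h1, h2⟩
  · exact key 1 (by norm_num) (by rw [h1, one_mul]) (by rw [h2, one_mul])
  · exact key (-1) (by norm_num) (by rw [h1]; norm_num) (by rw [h2]; norm_num)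

theorem infinite_matGenGroup (hA : IsUnit A) (hB : IsUnit B) (h : A * B * A = B * A * B)
    (hirr : MatPairIrreducible A B)
    (hpo : ∀ t ∈ [1, 2, 3, 4, 5, 6, 9, 10, 11, 12], ∀ c : ℂ,
      A ^ t ≠ c • (1 : Matrix (Fin 5) (Fin 5) ℂ)) :
    (matGenGroup A B : Set (Matrix (Fin 5) (Fin 5) ℂ)ˣ).Infinite := by
  intro hfin
  have : Finite (matGenGroup A B) := hfin
  obtain ⟨a, rfl⟩ := hA
  obtain ⟨b, rfl⟩ := hB
  let ga : matGenGroup (a : Matrix (Fin 5) (Fin 5) ℂ) b := ⟨a, Subgroup.subset_closure (Or.inl rfl)⟩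
  let gb : matGenGroup (a : Matrix (Fin 5) (Fin 5) ℂ) b := ⟨b, Subgroup.subset_closure (Or.inr rfl)⟩
  obtain ⟨c, hc⟩ := exists_braid_sq_eq h hirr
  have hcm : ∀ n : ℕ, ((a * b * a * (a * b * a)) ^ n : (Matrix (Fin 5) (Fin 5) ℂ)ˣ) =
      c ^ n • (1 : Matrix (Fin 5) (Fin 5) ℂ) := fun n => by
    have hc' : ((a * b * a * (a * b * a) : (Matrix (Fin 5) (Fin 5) ℂ)ˣ) : Matrix (Fin 5) (Fin 5) ℂ) =
        c • 1 := by simpa only [Units.val_mul] using hc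
    rw [Units.val_pow_eq_pow_val, hc', smul_pow, one_pow]
  obtain ⟨m, hm, hm1⟩ : ∃ m, 0 < m ∧ c ^ m = 1 := by
    obtain ⟨m, hm, hm1⟩ := (isOfFinOrder_of_finite (ga * gb * ga * (ga * gb * ga))).exists_pow_eq_one
    refine ⟨m, hm, ?_⟩
    have h1 : (a * b * a * (a * b * a)) ^ m = 1 := congrArg Subtype.val hm1
    have h2 := hcm m
    rw [h1, Units.val_one] at h2
    simpa using (congrFun₂ h2 0 0).symm
  have hc0 : c ≠ 0 := by
    rintro rfl
    rw [zero_pow hm.ne'] at hm1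
    exact zero_ne_one hm1
  obtain ⟨μ, hμc, htD, htK, htKK, hdet⟩ := exists_normalising_scalar h hirr hc hc0
  have hμ0 : μ ≠ 0 := by
    rintro rfl
    norm_num at hμc
  have hμm : μ ^ (6 * m) = 1 := by
    have := congrArg (· ^ m) hμc
    simpa only [mul_pow, hm1, mul_one, one_pow, ← pow_mul] using this
  have : NeZero (6 * m) := ⟨by omega⟩
  let z : rootsOfUnity (6 * m) ℂ := rootsOfUnity.mkOfPowEq μ hμm
  have hz : ((z : ℂˣ) : ℂ) = μ := rootsOfUnity.coe_mkOfPowEq hμm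
  let f : matGenGroup (a : Matrix (Fin 5) (Fin 5) ℂ) b × rootsOfUnity (6 * m) ℂ →*
      Matrix (Fin 5) (Fin 5) ℂ :=
    { toFun := fun g => ((g.2 : ℂˣ) : ℂ) • ((g.1 : (Matrix (Fin 5) (Fin 5) ℂ)ˣ) : Matrix (Fin 5) (Fin 5) ℂ)
      map_one' := by simp
      map_mul' := fun g g' => by rw [smul_mul_smul_comm]; rfl }
  obtain ⟨t, ht, c', hc'⟩ := exists_pow_eq_smul_one f (a := (ga, z)) (u := (ga * (ga * gb * ga), z ^ 4))
    (A := μ • (a : Matrix (Fin 5) (Fin 5) ℂ)) (D := μ ^ 3 • (a * b * a : Matrix (Fin 5) (Fin 5) ℂ))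
    (K := μ ^ 4 • (a * (a * b * a) : Matrix (Fin 5) (Fin 5) ℂ))
    (by simp [f, ga, hz]) (by simp [f, ga, gb, hz])
    (by rw [smul_mul_smul_comm, ← pow_succ'])
    (by rw [smul_mul_smul_comm, hc, smul_smul, ← pow_add, hμc, one_smul])
    (by rw [smul_mul_smul_comm, smul_mul_smul_comm, braid_cube h hc, smul_smul,
      show μ ^ 4 * μ ^ 4 * μ ^ 4 * c ^ 2 = (μ ^ 6 * c) ^ 2 by ring, hμc, one_pow, one_smul])
    htD htK htKK hdet (pairIrreducible_smul h hirr hc hc0 hμ0)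
  refine hpo t ht ((μ ^ t)⁻¹ * c') ?_
  rw [mul_smul, ← hc', smul_pow, inv_smul_smul₀ (pow_ne_zero t hμ0)]

end Braid

end FiniteBraid

theorem stmt18 (A B : Matrix (Fin 5) (Fin 5) ℂ) (hA : IsUnit A) (hB : IsUnit B)
    (hbraid : A * B * A = B * A * B)
    (hirr : MatPairIrreducible A B)
    (hprim : ¬ MatGroupImprimitive (matGenGroup A B))
    (hpo : ∀ t ∈ ({1, 2, 3, 4, 5, 6, 9, 10, 11, 12} : Set ℕ), ∀ c : ℂ,
      A ^ t ≠ c • (1 : Matrix (Fin 5) (Fin 5) ℂ)) :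
    Set.Infinite (matGenGroup A B : Set (Matrix (Fin 5) (Fin 5) ℂ)ˣ) := by
  exact FiniteBraid.infinite_matGenGroup hA hB hbraid hirr fun t ht => hpo t (by simpa using ht)
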